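/- Let (a,b) ∈ ℝ² be a Diophantine vector. Then for Lebesgue-almost every β ∈ ℝ one has limsup Δ(a(t,s) u(aβ+b, β) ℤ³) / log max(t,s) ≥ 2/3, where the limsup is taken over pairs (t,s) ∈ ℝ²_{≥0} with max(t,s) → ∞. -/

import Mathlib

/-!
Lower bound in the logarithm law for Diophantine lines in
`SL(3,ℝ)/SL(3,ℤ)` (part of Chow–Yang, Corollary 1.8): for a Diophantine
vector `(a,b)`, for almost every `β`,
`limsup Δ(a(t,s) u(aβ+b, β) ℤ³) / log max(t,s) ≥ 2/3`, the limsup being over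
`(t,s) ∈ ℝ²_{≥0}` with `max(t,s) → ∞`.  The `limsup ≥ 2/3` statement is
spelled out with explicit quantifiers.
-/

open MeasureTheory Matrix

noncomputable section

/-- Distance from a real number to the nearest integer, `⟨x⟩`. -/
def distNearestInt (x : ℝ) : ℝ := |x - round x|

/-- `(a, b) ∈ ℝ²` is Diophantine:
`inf_{q ∈ ℕ} q^{1/2+κ} max(⟨qa⟩, ⟨qb⟩) > 0` for some `κ > 0`. -/
def IsDiophantine (a b : ℝ) : Prop :=
  ∃ κ : ℝ, 0 < κ ∧ ∃ δ : ℝ, 0 < δ ∧ ∀ q : ℕ, 0 < q →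
    δ ≤ (q : ℝ) ^ ((1 : ℝ) / 2 + κ) *
      max (distNearestInt (q * a)) (distNearestInt (q * b))

/-- The diagonal matrix `a(t,s) = diag(e^t, e^s, e^{-t-s})`. -/
def aM (t s : ℝ) : Matrix (Fin 3) (Fin 3) ℝ :=
  !![Real.exp t, 0, 0; 0, Real.exp s, 0; 0, 0, Real.exp (-t - s)]

/-- The unipotent matrix `u(y,x)` with rows `(1,0,y), (0,1,x), (0,0,1)`. -/
def uM (y x : ℝ) : Matrix (Fin 3) (Fin 3) ℝ := !![1, 0, y; 0, 1, x; 0, 0, 1]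

/-- `Δ(g ℤ³) = max_{v ∈ gℤ³ \ {0}} log (1/‖v‖)`, with `‖·‖` the sup norm. -/
def latDelta (g : Matrix (Fin 3) (Fin 3) ℝ) : ℝ :=
  ⨆ v : {v : Fin 3 → ℤ // v ≠ 0},
    Real.log (1 / ‖g.mulVec fun i => ((v : Fin 3 → ℤ) i : ℝ)‖)

abbrev dn (x : ℝ) : ℝ := distNearestInt x

lemma dn_le (x : ℝ) (z : ℤ) : dn x ≤ |x - z| := round_le x z

lemma dn_nonneg (x : ℝ) : 0 ≤ dn x := abs_nonneg _

lemma dn_le_half (x : ℝ) : dn x ≤ 1 / 2 := abs_sub_round x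

lemma dn_neg (x : ℝ) : dn (-x) = dn x := by
  have h : ∀ y : ℝ, dn (-y) ≤ dn y := by
    intro y
    have := dn_le (-y) (-(round y))
    refine this.trans (le_of_eq ?_)
    show _ = |y - round y|
    rw [← abs_neg]; congr 1; push_cast; ring
  refine le_antisymm (h x) ?_
  have := h (-x)
  rwa [neg_neg] at this

lemma dn_add_int (x : ℝ) (n : ℤ) : dn (x + n) = dn x := by
  show |x + n - round (x + n)| = |x - round x|
  rw [round_add_intCast]; push_cast; congr 1; ring

lemma dn_add_le (x y : ℝ) : dn (x + y) ≤ dn x + dn y := by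
  have := dn_le (x + y) (round x + round y)
  refine this.trans ?_
  show _ ≤ |x - round x| + |y - round y|
  refine le_trans (le_of_eq ?_) (abs_add_le _ _)
  congr 1; push_cast; ring

lemma dn_sub_le (x y : ℝ) : dn (x - y) ≤ dn x + dn y := by
  rw [sub_eq_add_neg]; refine (dn_add_le _ _).trans ?_
  rw [dn_neg]

lemma dn_nat_mul_le (n : ℕ) (x : ℝ) : dn (n * x) ≤ n * dn x := by
  have := dn_le (n * x) (n * round x)
  refine this.trans (le_of_eq ?_)
  show _ = n * |x - round x|
  push_cast
  rw [← mul_sub, abs_mul, Nat.abs_cast]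

lemma dn_int_mul_le (n : ℤ) (x : ℝ) : dn (n * x) ≤ |(n : ℝ)| * dn x := by
  have := dn_le (n * x) (n * round x)
  refine this.trans (le_of_eq ?_)
  show _ = |(n : ℝ)| * |x - round x|
  push_cast
  rw [← mul_sub, abs_mul]

/-- additive character -/
def ee (x : ℝ) : ℂ := Complex.exp (Complex.I * ((2 * Real.pi * x : ℝ) : ℂ))

lemma ee_add (x y : ℝ) : ee (x + y) = ee x * ee y := by
  unfold ee; rw [← Complex.exp_add]; congr 1; push_cast; ring

lemma ee_zero : ee 0 = 1 := by simp [ee]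

lemma norm_ee (x : ℝ) : ‖ee x‖ = 1 := by
  unfold ee; rw [mul_comm]; exact Complex.norm_exp_ofReal_mul_I _

lemma ee_int (n : ℤ) : ee n = 1 := by
  unfold ee
  rw [Complex.exp_eq_one_iff]
  exact ⟨n, by push_cast; ring⟩

lemma ee_conj (x : ℝ) : (starRingEnd ℂ) (ee x) = ee (-x) := by
  unfold ee
  rw [← Complex.exp_conj]; congr 1
  rw [map_mul, Complex.conj_I, Complex.conj_ofReal]; push_cast; ring

lemma ee_sub_conj (x y : ℝ) : ee x * (starRingEnd ℂ) (ee y) = ee (x - y) := by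
  rw [ee_conj, ← ee_add, sub_eq_add_neg]

lemma ee_sub_round (x : ℝ) : ee x = ee (x - round x) := by
  have : x = (x - round x) + (round x : ℤ) := by ring
  conv_lhs => rw [this, ee_add, ee_int, mul_one]

lemma ee_sub_one_ge (x : ℝ) : 4 * dn x ≤ ‖ee x - 1‖ := by
  rw [ee_sub_round]
  unfold ee
  rw [Complex.norm_exp_I_mul_ofReal_sub_one]
  have h0 : dn x = |x - round x| := rfl
  rw [h0]
  set φ := x - round x with hφ
  have h1 : |φ| ≤ 1 / 2 := dn_le_half x
  have h2 : 2 * Real.pi * φ / 2 = Real.pi * φ := by ring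
  rw [h2, Real.norm_eq_abs, abs_mul]
  have h3 : |Real.sin (Real.pi * φ)| = |Real.sin (Real.pi * |φ|)| := by
    rcases abs_cases φ with ⟨h, _⟩ | ⟨h, _⟩
    · rw [h]
    · rw [h, mul_neg, Real.sin_neg, abs_neg]
  rw [h3]
  have h4 : 2 / Real.pi * (Real.pi * |φ|) ≤ Real.sin (Real.pi * |φ|) := by
    apply Real.mul_le_sin
    · positivity
    · nlinarith [Real.pi_pos]
  have h5 : 2 / Real.pi * (Real.pi * |φ|) = 2 * |φ| := by
    field_simp
  rw [h5] at h4
  have := le_abs_self (Real.sin (Real.pi * |φ|))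
  have h6 : |(2:ℝ)| = 2 := by norm_num
  rw [h6]; linarith

/-- geometric sum bound over naturals. -/
lemma geom_bound_range (θ : ℝ) (N : ℕ) :
    2 * dn θ * ‖∑ n ∈ Finset.range N, ee (n * θ)‖ ≤ 1 := by
  have hp : ∀ n : ℕ, ee (n * θ) = (ee θ) ^ n := by
    intro n
    induction n with
    | zero => simp [ee_zero]
    | succ k ih => rw [pow_succ, ← ih, ← ee_add]; congr 1; push_cast; ring
  simp_rw [hp]
  have h1 := mul_geom_sum (ee θ) N
  have h2 : ‖ee θ - 1‖ * ‖∑ n ∈ Finset.range N, (ee θ) ^ n‖ ≤ 2 := by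
    rw [← norm_mul, h1]
    refine (norm_sub_le _ _).trans ?_
    rw [norm_pow, norm_ee]; norm_num
  have h3 := ee_sub_one_ge θ
  have h4 := norm_nonneg (∑ n ∈ Finset.range N, (ee θ) ^ n)
  nlinarith

/-- shifted integer interval `[u, u+N)` -/
lemma geom_bound (θ : ℝ) (u : ℤ) (N : ℕ) :
    2 * dn θ * ‖∑ n ∈ Finset.range N, ee (((u + n : ℤ) : ℝ) * θ)‖ ≤ 1 := by
  have : ∑ n ∈ Finset.range N, ee (((u + n : ℤ) : ℝ) * θ) =
      ee (u * θ) * ∑ n ∈ Finset.range N, ee (n * θ) := by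
    rw [Finset.mul_sum]
    refine Finset.sum_congr rfl fun n _ => ?_
    rw [← ee_add]; congr 1; push_cast; ring
  rw [this, norm_mul, norm_ee, one_mul]
  exact geom_bound_range θ N

lemma sum_Icc_eq_range (f : ℤ → ℂ) (u : ℤ) (N : ℕ) :
    ∑ s ∈ Finset.Ico u (u + N), f s = ∑ n ∈ Finset.range N, f (u + n) := by
  symm
  refine Finset.sum_bij (fun n _ => u + (n : ℤ)) ?_ ?_ ?_ ?_
  · intro n hn; simp at hn ⊢; exact hn
  · intro n _ m _ h; simpa using h
  · intro s hs
    rw [Finset.mem_Ico] at hs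
    refine ⟨(s - u).toNat, ?_, ?_⟩
    · rw [Finset.mem_range]; omega
    · simp; omega
  · intro n _; rfl

lemma geom_bound_Ico (θ : ℝ) (u : ℤ) (N : ℕ) :
    2 * dn θ * ‖∑ s ∈ Finset.Ico u (u + N), ee ((s : ℝ) * θ)‖ ≤ 1 := by
  rw [sum_Icc_eq_range (fun s => ee ((s:ℝ) * θ))]
  exact geom_bound θ u N

lemma geom_bound_Icc (θ : ℝ) (S : ℕ) :
    2 * dn θ * ‖∑ s ∈ Finset.Icc (-(S:ℤ)) S, ee ((s : ℝ) * θ)‖ ≤ 1 := by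
  have : Finset.Icc (-(S:ℤ)) S = Finset.Ico (-(S:ℤ)) (-(S:ℤ) + (2 * S + 1 : ℕ)) := by
    ext x; simp only [Finset.mem_Icc, Finset.mem_Ico]; push_cast; omega
  rw [this]; exact geom_bound_Ico θ _ _

lemma fejer_lower (θ : ℝ) (h : ℕ) (hh : 1 ≤ h) (hθ : dn θ ≤ 1 / (8 * h)) :
    (h : ℝ) ^ 2 / 2 ≤ ‖∑ n ∈ Finset.range h, ee (n * θ)‖ ^ 2 := by
  set φ := θ - round θ with hφ
  have hφ' : |φ| ≤ 1 / (8 * h) := hθ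
  have hpos : (0:ℝ) < h := by exact_mod_cast hh
  have e1 : ∀ n : ℕ, ee (n * θ) = ee (n * φ) := by
    intro n
    have : (n : ℝ) * θ = n * φ + ((n * round θ : ℤ) : ℝ) := by rw [hφ]; push_cast; ring
    rw [this, ee_add, ee_int, mul_one]
  have e2 : ∀ n ∈ Finset.range h, Real.sqrt 2 / 2 ≤ (ee (n * θ)).re := by
    intro n hn
    rw [e1]
    unfold ee
    rw [mul_comm Complex.I, Complex.exp_ofReal_mul_I_re, ← Real.cos_abs, ← Real.cos_pi_div_four]
    have hn' : (n:ℝ) ≤ h := by exact_mod_cast (Finset.mem_range.mp hn).le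
    apply Real.cos_le_cos_of_nonneg_of_le_pi (abs_nonneg _)
    · linarith [Real.pi_pos]
    · rw [abs_mul, abs_mul, abs_mul, abs_of_pos Real.pi_pos, Nat.abs_cast]
      have : (n:ℝ) * |φ| ≤ 1 / 8 := by
        calc (n:ℝ) * |φ| ≤ h * (1 / (8 * h)) := by gcongr
          _ = 1 / 8 := by field_simp
      have h6 : |(2:ℝ)| = 2 := by norm_num
      rw [h6]
      nlinarith [Real.pi_pos]
  have e3 : (h:ℝ) * (Real.sqrt 2 / 2) ≤ ‖∑ n ∈ Finset.range h, ee (n * θ)‖ := by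
    refine le_trans ?_ (Complex.re_le_norm _)
    rw [Complex.re_sum]
    refine le_trans ?_ (Finset.sum_le_sum e2)
    simp
  have e4 : 0 ≤ (h:ℝ) * (Real.sqrt 2 / 2) := by positivity
  have e5 := pow_le_pow_left₀ e4 e3 2
  refine le_trans (le_of_eq ?_) e5
  rw [mul_pow, div_pow, Real.sq_sqrt (by norm_num)]; ring

lemma normsq_sum_ee {ι : Type*} (X : Finset ι) (f : ι → ℝ) :
    ((‖∑ n ∈ X, ee (f n)‖ ^ 2 : ℝ) : ℂ) = ∑ n ∈ X, ∑ m ∈ X, ee (f n - f m) := by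
  rw [Complex.ofReal_pow, ← Complex.mul_conj', map_sum, Finset.sum_mul_sum]
  refine Finset.sum_congr rfl fun n _ => Finset.sum_congr rfl fun m _ => ?_
  rw [ee_sub_conj]

/-- two dimensional Fejer count -/
lemma fejer_count {ι : Type*} (X : Finset ι) (θ θ' : ι → ℝ) (h h' : ℕ) (hh : 1 ≤ h) (hh' : 1 ≤ h')
    (B : ℝ) (hB0 : 0 ≤ B)
    (hB : ∀ m m' : ℤ, |m| < h → |m'| < h' → ¬ (m = 0 ∧ m' = 0) →
      ‖∑ x ∈ X, ee (m * θ x + m' * θ' x)‖ ≤ B) :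
    ((X.filter fun x => dn (θ x) ≤ 1 / (8 * h) ∧ dn (θ' x) ≤ 1 / (8 * h')).card : ℝ) ≤
      4 * (X.card / (h * h') + B) := by
  have hp : (0:ℝ) < h := by exact_mod_cast hh
  have hp' : (0:ℝ) < h' := by exact_mod_cast hh'
  set F : ι → ℝ := fun x => ‖∑ n ∈ Finset.range h, ee (n * θ x)‖ ^ 2 *
    ‖∑ n ∈ Finset.range h', ee (n * θ' x)‖ ^ 2 with hF
  have hFn : ∀ x, 0 ≤ F x := fun x => by rw [hF]; positivity
  have s1 : ((X.filter fun x => dn (θ x) ≤ 1 / (8 * h) ∧ dn (θ' x) ≤ 1 / (8 * h')).card : ℝ) *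
      ((h:ℝ) ^ 2 * h' ^ 2 / 4) ≤ ∑ x ∈ X, F x := by
    rw [← nsmul_eq_mul, ← Finset.sum_const]
    refine le_trans (Finset.sum_le_sum (g := F) ?_)
      (Finset.sum_le_sum_of_subset_of_nonneg (Finset.filter_subset _ _) fun x _ _ => hFn x)
    intro x hx
    obtain ⟨-, hx1, hx2⟩ := Finset.mem_filter.mp hx
    have a1 := fejer_lower (θ x) h hh hx1
    have a2 := fejer_lower (θ' x) h' hh' hx2
    calc (h:ℝ) ^ 2 * h' ^ 2 / 4 = ((h:ℝ) ^ 2 / 2) * ((h':ℝ) ^ 2 / 2) := by ring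
      _ ≤ _ := mul_le_mul a1 a2 (by positivity) (by positivity)
  have s2 : ((∑ x ∈ X, F x : ℝ) : ℂ) = ∑ n ∈ Finset.range h, ∑ m ∈ Finset.range h,
      ∑ n' ∈ Finset.range h', ∑ m' ∈ Finset.range h',
        ∑ x ∈ X, ee (((n - m : ℤ) : ℝ) * θ x + ((n' - m' : ℤ) : ℝ) * θ' x) := by
    have : ∀ x, ((F x : ℝ) : ℂ) = ∑ n ∈ Finset.range h, ∑ m ∈ Finset.range h,
      ∑ n' ∈ Finset.range h', ∑ m' ∈ Finset.range h',
        ee (((n - m : ℤ) : ℝ) * θ x + ((n' - m' : ℤ) : ℝ) * θ' x) := by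
      intro x
      rw [hF]
      simp only [Complex.ofReal_mul]
      rw [normsq_sum_ee, normsq_sum_ee]
      rw [Finset.sum_mul]
      refine Finset.sum_congr rfl fun n _ => ?_
      rw [Finset.sum_mul]
      refine Finset.sum_congr rfl fun m _ => ?_
      rw [Finset.mul_sum]
      refine Finset.sum_congr rfl fun n' _ => ?_
      rw [Finset.mul_sum]
      refine Finset.sum_congr rfl fun m' _ => ?_
      rw [← ee_add]; congr 1; push_cast; ring
    push_cast [this]
    rw [Finset.sum_comm]
    refine Finset.sum_congr rfl fun n _ => ?_
    rw [Finset.sum_comm]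
    refine Finset.sum_congr rfl fun n _ => ?_
    rw [Finset.sum_comm]
    refine Finset.sum_congr rfl fun n _ => ?_
    rw [Finset.sum_comm]
  have s3 : ∑ x ∈ X, F x ≤ (h:ℝ) * h' * X.card + (h:ℝ) ^ 2 * h' ^ 2 * B := by
    have t0 : ∑ x ∈ X, F x = ‖((∑ x ∈ X, F x : ℝ) : ℂ)‖ := by
      rw [Complex.norm_real, Real.norm_eq_abs, abs_of_nonneg (Finset.sum_nonneg fun x _ => hFn x)]
    rw [t0, s2]
    have key : ∀ n ∈ Finset.range h, ∀ m ∈ Finset.range h, ∀ n' ∈ Finset.range h',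
        ∀ m' ∈ Finset.range h',
        ‖∑ x ∈ X, ee (((n - m : ℤ) : ℝ) * θ x + ((n' - m' : ℤ) : ℝ) * θ' x)‖ ≤
        (if n = m then (if n' = m' then (X.card:ℝ) else 0) else 0) + B := by
      intro n hn m hm n' hn' m' hm'
      rw [Finset.mem_range] at hn hm hn' hm'
      by_cases hz : n = m ∧ n' = m'
      · obtain ⟨rfl, rfl⟩ := hz
        simp [ee_zero, hB0]
      · have : ((if n = m then (if n' = m' then (X.card:ℝ) else 0) else 0)) = 0 := by
          split_ifs with c1 c2
          · exact absurd ⟨c1, c2⟩ hz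
          · rfl
          · rfl
        rw [this, zero_add]
        apply hB
        · rw [abs_lt]; constructor <;> omega
        · rw [abs_lt]; constructor <;> omega
        · omega
    calc _ ≤ ∑ n ∈ Finset.range h, ∑ m ∈ Finset.range h,
      ∑ n' ∈ Finset.range h', ∑ m' ∈ Finset.range h',
        ((if n = m then (if n' = m' then (X.card:ℝ) else 0) else 0) + B) := by
          refine (norm_sum_le _ _).trans (Finset.sum_le_sum fun n hn => ?_)
          refine (norm_sum_le _ _).trans (Finset.sum_le_sum fun m hm => ?_)
          refine (norm_sum_le _ _).trans (Finset.sum_le_sum fun n' hn' => ?_)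
          refine (norm_sum_le _ _).trans (Finset.sum_le_sum fun m' hm' => ?_)
          exact key n hn m hm n' hn' m' hm'
      _ = _ := by
          simp only [Finset.sum_add_distrib, Finset.sum_const, Finset.card_range, nsmul_eq_mul]
          have : ∑ n ∈ Finset.range h, ∑ m ∈ Finset.range h, ∑ n' ∈ Finset.range h',
              ∑ m' ∈ Finset.range h',
              (if n = m then (if n' = m' then (X.card:ℝ) else 0) else 0) = h * h' * X.card := by
            have i1 : ∀ n ∈ Finset.range h, ∑ m ∈ Finset.range h, ∑ n' ∈ Finset.range h',
              ∑ m' ∈ Finset.range h',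
              (if n = m then (if n' = m' then (X.card:ℝ) else 0) else 0) = h' * X.card := by
              intro n hn
              rw [Finset.sum_eq_single_of_mem n hn]
              · simp only [if_true]
                have : ∀ n' ∈ Finset.range h', ∑ m' ∈ Finset.range h',
                  (if n' = m' then (X.card:ℝ) else 0) = X.card := by
                  intro n' hn'
                  rw [Finset.sum_ite_eq, if_pos hn']
                rw [Finset.sum_congr rfl this]; simp
              · intro m _ hm; simp [hm.symm]
            rw [Finset.sum_congr rfl i1]; simp; ring
          rw [this]; ring
  have s4 := s1.trans s3
  have hq : (0:ℝ) < (h:ℝ) ^ 2 * h' ^ 2 / 4 := by positivity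
  have s5 : 4 * ((X.card:ℝ) / (h * h') + B) * ((h:ℝ) ^ 2 * h' ^ 2 / 4) =
      (h:ℝ) * h' * X.card + (h:ℝ) ^ 2 * h' ^ 2 * B := by
    field_simp
  rw [← s5] at s4
  exact le_of_mul_le_mul_right s4 hq



def DC (a b : ℝ) (C0 : ℕ) (δ : ℝ) : Prop :=
  0 < δ ∧ ∀ q : ℕ, 0 < q → δ ≤ (q : ℝ) ^ C0 * max (dn (q * a)) (dn (q * b))

lemma card_le_fiber {α β : Type*} [DecidableEq β] (s : Finset α) (f : α → β) (t : Finset β)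
    (hm : ∀ x ∈ s, f x ∈ t) (n : ℝ)
    (hn : ∀ y ∈ t, ((s.filter fun x => f x = y).card : ℝ) ≤ n) :
    (s.card : ℝ) ≤ t.card * n := by
  rw [Finset.card_eq_sum_card_fiberwise (f := f) (t := t) hm]
  push_cast
  refine (Finset.sum_le_sum hn).trans ?_
  simp

lemma dn_mul_abs (m : ℤ) (x : ℝ) : dn (m * x) = dn ((m.natAbs : ℝ) * x) := by
  rcases Int.natAbs_eq m with h | h
  · conv_lhs => rw [h]
    simp
  · conv_lhs => rw [h]
    push_cast
    rw [neg_mul, dn_neg]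
    simp

/-- box count -/
lemma box_count (a b : ℝ) (C0 : ℕ) (δ : ℝ) (hdc : DC a b C0 δ) (u1 u2 : ℤ) (P d h : ℕ)
    (hd : 1 ≤ d) (hh : 1 ≤ h) :
    (((Finset.Ico u1 (u1 + P) ×ˢ Finset.Ico u2 (u2 + P)).filter fun v : ℤ × ℤ =>
      dn (d * (a * v.1 + b * v.2)) ≤ 1 / (8 * h)).card : ℝ) ≤
      4 * ((P:ℝ) ^ 2 / h + P * (h * d : ℝ) ^ C0 / (2 * δ)) := by
  obtain ⟨hδ, hq⟩ := hdc
  set X := Finset.Ico u1 (u1 + P) ×ˢ Finset.Ico u2 (u2 + P) with hX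
  have hc : ∀ u : ℤ, (Finset.Ico u (u + P)).card = P := by intro u; simp
  have hXc : (X.card : ℝ) = (P:ℝ) ^ 2 := by
    rw [hX, Finset.card_product, hc, hc]; push_cast; ring
  have hB : ∀ m m' : ℤ, |m| < h → |m'| < ((1:ℕ):ℤ) → ¬ (m = 0 ∧ m' = 0) →
      ‖∑ x ∈ X, ee (m * (d * (a * x.1 + b * x.2)) + m' * (0:ℝ))‖ ≤
        P * (h * d : ℝ) ^ C0 / (2 * δ) := by
    intro m m' hm hm' hne
    have hm0 : m' = 0 := by rw [abs_lt] at hm'; omega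
    have hmne : m ≠ 0 := fun h => hne ⟨h, hm0⟩
    set q : ℕ := m.natAbs * d with hqd
    have hqpos : 0 < q := Nat.mul_pos (Int.natAbs_pos.mpr hmne) hd
    have hqle : (q : ℝ) ≤ h * d := by
      rw [hqd]; push_cast
      have : (m.natAbs : ℤ) < h := by rw [Int.natCast_natAbs]; exact hm
      have : (m.natAbs : ℝ) ≤ h := by exact_mod_cast this.le
      gcongr
    have hmax := hq q hqpos
    have hpw : (q:ℝ) ^ C0 ≤ (h * d : ℝ) ^ C0 := pow_le_pow_left₀ (by positivity) hqle _
    have hfac : ∑ x ∈ X, ee (m * (d * (a * x.1 + b * x.2)) + m' * (0:ℝ)) =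
        (∑ s ∈ Finset.Ico u1 (u1 + P), ee (s * (m * (d * a)))) *
        (∑ s ∈ Finset.Ico u2 (u2 + P), ee (s * (m * (d * b)))) := by
      rw [Finset.sum_mul_sum, hX, Finset.sum_product]
      refine Finset.sum_congr rfl fun x _ => Finset.sum_congr rfl fun y _ => ?_
      rw [← ee_add]; congr 1; ring
    have hdnq : ∀ c : ℝ, dn (m * (d * c)) = dn (q * c) := by
      intro c; rw [dn_mul_abs, hqd]; push_cast; congr 1; ring
    have tr : ∀ (u : ℤ) (c : ℝ), ‖∑ s ∈ Finset.Ico u (u + P), ee (s * c)‖ ≤ P := by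
      intro u c
      refine (norm_sum_le _ _).trans ?_
      simp [norm_ee]
    have ge : ∀ (u : ℤ) (c : ℝ), δ ≤ (h * d : ℝ) ^ C0 * dn (q * c) →
        ‖∑ s ∈ Finset.Ico u (u + P), ee (s * (m * (d * c)))‖ ≤ (h * d : ℝ) ^ C0 / (2 * δ) := by
      intro u c hcc
      have g := geom_bound_Ico (m * (d * c)) u P
      rw [hdnq] at g
      rw [le_div_iff₀ (by positivity)]
      set N := ‖∑ s ∈ Finset.Ico u (u + P), ee (s * (m * (d * c)))‖
      have hN : 0 ≤ N := norm_nonneg _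
      have hhd : 0 ≤ (h * d : ℝ) ^ C0 := by positivity
      calc N * (2 * δ) ≤ N * (2 * ((h * d : ℝ) ^ C0 * dn (q * c))) := by gcongr
        _ = (h * d : ℝ) ^ C0 * (2 * dn (q * c) * N) := by ring
        _ ≤ (h * d : ℝ) ^ C0 * 1 := by gcongr
        _ = _ := by ring
    rw [hfac, norm_mul]
    rcases max_cases (dn (q * a)) (dn (q * b)) with ⟨hm1, -⟩ | ⟨hm1, -⟩
    · rw [hm1] at hmax
      have h1 := ge u1 a (hmax.trans (by gcongr; exact dn_nonneg _))
      have h2 := tr u2 (m * (d * b))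
      calc _ ≤ (h * d : ℝ) ^ C0 / (2 * δ) * P := mul_le_mul h1 h2 (norm_nonneg _) (by positivity)
        _ = _ := by ring
    · rw [hm1] at hmax
      have h1 := ge u2 b (hmax.trans (by gcongr; exact dn_nonneg _))
      have h2 := tr u1 (m * (d * a))
      calc _ ≤ P * ((h * d : ℝ) ^ C0 / (2 * δ)) := mul_le_mul h2 h1 (norm_nonneg _) (by positivity)
        _ = _ := by ring
  have := fejer_count X (fun v => d * (a * v.1 + b * v.2)) (fun _ => 0) h 1 hh le_rfl
    (P * (h * d : ℝ) ^ C0 / (2 * δ)) (by positivity) hB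
  rw [hXc] at this
  refine le_trans ?_ (this.trans (le_of_eq (by push_cast; rw [mul_one])))
  norm_cast
  apply Finset.card_le_card
  intro v hv
  rw [Finset.mem_filter] at hv ⊢
  refine ⟨hv.1, by exact_mod_cast hv.2, ?_⟩
  have : dn 0 = 0 := by show |(0:ℝ) - round (0:ℝ)| = 0; simp
  rw [this]; positivity

/-- spaced points -/
lemma spaced_card (s : Finset ℤ) (lo hi W : ℝ) (hW : 0 < W) (hlh : lo ≤ hi)
    (hs : ∀ x ∈ s, lo ≤ x ∧ (x:ℝ) ≤ hi)
    (hsp : ∀ x ∈ s, ∀ y ∈ s, x ≠ y → W ≤ |((x - y : ℤ) : ℝ)|) :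
    (s.card : ℝ) ≤ (hi - lo) / W + 1 := by
  have hinj : Set.InjOn (fun x : ℤ => ⌊((x:ℝ) - lo) / W⌋₊) s := by
    intro x hx y hy hxy
    by_contra hne
    have h1 := hsp x hx y hy hne
    have hx0 : 0 ≤ ((x:ℝ) - lo) / W := div_nonneg (by linarith [(hs x hx).1]) hW.le
    have hy0 : 0 ≤ ((y:ℝ) - lo) / W := div_nonneg (by linarith [(hs y hy).1]) hW.le
    have a1 := Nat.floor_le hx0
    have a2 := Nat.lt_floor_add_one (((x:ℝ) - lo) / W)
    have b1 := Nat.floor_le hy0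
    have b2 := Nat.lt_floor_add_one (((y:ℝ) - lo) / W)
    simp only at hxy
    rw [hxy] at a1 a2
    have h2 : |((x:ℝ) - lo) / W - ((y:ℝ) - lo) / W| < 1 := by rw [abs_lt]; constructor <;> linarith
    have h3 : ((x:ℝ) - lo) / W - ((y:ℝ) - lo) / W = ((x - y : ℤ) : ℝ) / W := by push_cast; ring
    rw [h3, abs_div, abs_of_pos hW, div_lt_one hW] at h2
    linarith
  have hmap : ∀ x ∈ s, (fun x : ℤ => ⌊((x:ℝ) - lo) / W⌋₊) x ∈
      Finset.range (⌊(hi - lo) / W⌋₊ + 1) := by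
    intro x hx
    simp only [Finset.mem_range]
    have : ⌊((x:ℝ) - lo) / W⌋₊ ≤ ⌊(hi - lo) / W⌋₊ := by
      apply Nat.floor_le_floor
      have := (hs x hx).2
      gcongr
    omega
  have := Finset.card_le_card_of_injOn _ hmap hinj
  rw [Finset.card_range] at this
  have h4 : (s.card : ℝ) ≤ (⌊(hi - lo) / W⌋₊ : ℝ) + 1 := by exact_mod_cast this
  have := Nat.floor_le (div_nonneg (by linarith : 0 ≤ hi - lo) hW.le)
  linarith

lemma card_ints (E : ℝ) (hE : 0 ≤ E) (s : Finset ℤ) (hs : ∀ x ∈ s, x ≠ 0 ∧ |(x:ℝ)| ≤ E) :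
    (s.card : ℝ) ≤ 2 * E := by
  have hsub : s ⊆ (Finset.Icc (-⌊E⌋) ⌊E⌋).erase 0 := by
    intro x hx
    obtain ⟨h1, h2⟩ := hs x hx
    rw [abs_le] at h2
    rw [Finset.mem_erase, Finset.mem_Icc]
    refine ⟨h1, ?_, Int.le_floor.mpr h2.2⟩
    have : -x ≤ ⌊E⌋ := Int.le_floor.mpr (by push_cast; linarith)
    linarith
  have hc := Finset.card_le_card hsub
  have hf : 0 ≤ ⌊E⌋ := Int.floor_nonneg.mpr hE
  rw [Finset.card_erase_of_mem (by rw [Finset.mem_Icc]; constructor <;> linarith), Int.card_Icc] at hc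
  have : (s.card : ℤ) ≤ 2 * ⌊E⌋ := by omega
  have h2 : (s.card : ℝ) ≤ 2 * ⌊E⌋ := by exact_mod_cast this
  linarith [Int.floor_le E]

/-- the set near-return count -/
lemma nu_bound (a b η : ℝ) (X W : ℕ) (hW : 1 ≤ W)
    (hyp : ∀ q : ℕ, 1 ≤ q → q ≤ W ^ 2 → 2 * W * η < max (dn (q * a)) (dn (q * b))) :
    (((Finset.Icc (-(X:ℤ)) X ×ˢ Finset.Icc (-(X:ℤ)) X).filter fun v : ℤ × ℤ =>
      dn (a * v.1 + b * v.2) ≤ η).card : ℝ) ≤ (2 * X + 1) * (2 * X / W + 1) := by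
  have hWp : (0:ℝ) < W := by exact_mod_cast hW
  set s := (Finset.Icc (-(X:ℤ)) X ×ˢ Finset.Icc (-(X:ℤ)) X).filter fun v : ℤ × ℤ =>
      dn (a * v.1 + b * v.2) ≤ η with hs
  have hcard : ((Finset.Icc (-(X:ℤ)) X).card : ℝ) = 2 * X + 1 := by
    rw [Int.card_Icc]
    have : ((X:ℤ) + 1 - -(X:ℤ)).toNat = 2 * X + 1 := by omega
    rw [this]; push_cast; ring
  rw [← hcard]
  have hcase : (∀ t : ℕ, 1 ≤ t → t < W → 2 * η < dn (t * a)) ∨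
      (∀ t : ℕ, 1 ≤ t → t < W → 2 * η < dn (t * b)) := by
    by_contra hcon
    push Not at hcon
    obtain ⟨⟨t, ht1, ht2, ht3⟩, t', ht1', ht2', ht3'⟩ := hcon
    have := hyp (t * t') (Nat.mul_pos ht1 ht1') (by rw [sq]; exact Nat.mul_le_mul ht2.le ht2'.le)
    have h1 : dn ((t * t' : ℕ) * a) ≤ 2 * W * η := by
      have e : ((t * t' : ℕ) : ℝ) * a = (t' : ℝ) * (t * a) := by push_cast; ring
      rw [e]
      have : (t' : ℝ) ≤ W := by exact_mod_cast ht2'.le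
      calc _ ≤ (t' : ℝ) * dn (t * a) := dn_nat_mul_le _ _
        _ ≤ W * (2 * η) := mul_le_mul this ht3 (dn_nonneg _) hWp.le
        _ = _ := by ring
    have h2 : dn ((t * t' : ℕ) * b) ≤ 2 * W * η := by
      have e : ((t * t' : ℕ) : ℝ) * b = (t : ℝ) * (t' * b) := by push_cast; ring
      rw [e]
      have : (t : ℝ) ≤ W := by exact_mod_cast ht2.le
      calc _ ≤ (t : ℝ) * dn (t' * b) := dn_nat_mul_le _ _
        _ ≤ W * (2 * η) := mul_le_mul this ht3' (dn_nonneg _) hWp.le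
        _ = _ := by ring
    exact absurd this (not_lt.mpr (max_le h1 h2))
  have main : ∀ (c : ℝ) (F : Finset ℤ), (∀ t : ℕ, 1 ≤ t → t < W → 2 * η < dn (t * c)) →
      (∀ x ∈ F, -(X:ℤ) ≤ x ∧ x ≤ X) → (∃ e, ∀ x ∈ F, dn (c * x + e) ≤ η) →
      (F.card : ℝ) ≤ 2 * X / W + 1 := by
    intro c F hc hF ⟨e, he⟩
    have := spaced_card F (-(X:ℝ)) X W hWp (by linarith [Nat.cast_nonneg (α := ℝ) X])
      (fun x hx => ⟨by exact_mod_cast (hF x hx).1, by exact_mod_cast (hF x hx).2⟩) ?_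
    · refine this.trans (le_of_eq ?_); ring
    · intro x hx y hy hne
      by_contra hlt
      push Not at hlt
      have h1 : dn (((x - y : ℤ) : ℝ) * c) ≤ 2 * η := by
        have : ((x - y : ℤ) : ℝ) * c = (c * x + e) - (c * y + e) := by push_cast; ring
        rw [this]
        refine (dn_sub_le _ _).trans ?_
        linarith [he x hx, he y hy]
      rw [dn_mul_abs] at h1
      have h2 := hc (x - y).natAbs (Int.natAbs_pos.mpr (sub_ne_zero.mpr hne)) (by
        have : ((x - y).natAbs : ℝ) < W := by rw [Nat.cast_natAbs]; push_cast; push_cast at hlt; exact hlt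
        exact_mod_cast this)
      linarith
  rcases hcase with hc | hc
  · refine card_le_fiber s (fun v => v.2) _ ?_ _ ?_
    · intro v hv; rw [hs, Finset.mem_filter, Finset.mem_product] at hv; exact hv.1.2
    · intro y hy
      rw [← Finset.card_image_of_injOn (f := Prod.fst)]
      · apply main a _ hc
        · intro x hx
          rw [Finset.mem_image] at hx
          obtain ⟨v, hv, rfl⟩ := hx
          rw [Finset.mem_filter, hs, Finset.mem_filter, Finset.mem_product, Finset.mem_Icc] at hv
          exact hv.1.1.1
        · refine ⟨b * y, ?_⟩
          intro x hx
          rw [Finset.mem_image] at hx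
          obtain ⟨v, hv, rfl⟩ := hx
          rw [Finset.mem_filter, hs, Finset.mem_filter] at hv
          rw [← hv.2]; exact hv.1.2
      · intro v hv w hw h
        simp only [Finset.coe_filter, Set.mem_ofPred_eq] at hv hw
        exact Prod.ext h (hv.2.trans hw.2.symm)
  · refine card_le_fiber s (fun v => v.1) _ ?_ _ ?_
    · intro v hv; rw [hs, Finset.mem_filter, Finset.mem_product] at hv; exact hv.1.1
    · intro y hy
      rw [← Finset.card_image_of_injOn (f := Prod.snd)]
      · apply main b _ hc
        · intro x hx
          rw [Finset.mem_image] at hx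
          obtain ⟨v, hv, rfl⟩ := hx
          rw [Finset.mem_filter, hs, Finset.mem_filter, Finset.mem_product, Finset.mem_Icc,
            Finset.mem_Icc] at hv
          exact hv.1.1.2
        · refine ⟨a * y, ?_⟩
          intro x hx
          rw [Finset.mem_image] at hx
          obtain ⟨v, hv, rfl⟩ := hx
          rw [Finset.mem_filter, hs, Finset.mem_filter] at hv
          rw [← hv.2, add_comm]; exact hv.1.2
      · intro v hv w hw h
        simp only [Finset.coe_filter, Set.mem_ofPred_eq] at hv hw
        exact Prod.ext (hv.2.trans hw.2.symm) h

/-- large sieve -/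
lemma large_sieve {ι : Type*} (Γ : Finset ι) (z1 z2 : ι → ℝ) (S : ℕ) (η ν : ℝ) (hη : 0 < η)
    (hν : ∀ γ ∈ Γ, ((Γ.filter fun γ' => dn (z1 γ - z1 γ') ≤ η).card : ℝ) ≤ ν) :
    ∑ s ∈ Finset.Icc (-(S:ℤ)) S ×ˢ Finset.Icc (-(S:ℤ)) S,
      ‖∑ γ ∈ Γ, ee (s.1 * z1 γ + s.2 * z2 γ)‖ ^ 2 ≤
      (2 * S + 1) * ((2 * S + 1) * Γ.card * ν + (Γ.card : ℝ) ^ 2 / (2 * η)) := by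
  set I := Finset.Icc (-(S:ℤ)) S with hI
  have hcard : (I.card : ℝ) = 2 * S + 1 := by
    rw [Int.card_Icc]
    have : ((S:ℤ) + 1 - -(S:ℤ)).toNat = 2 * S + 1 := by omega
    rw [this]; push_cast; ring
  have tr : ∀ c : ℝ, ‖∑ s ∈ I, ee (s * c)‖ ≤ 2 * S + 1 := by
    intro c
    refine (norm_sum_le _ _).trans ?_
    simp only [norm_ee, Finset.sum_const, nsmul_eq_mul, mul_one]
    exact hcard.le
  have expand : ((∑ s ∈ I ×ˢ I, ‖∑ γ ∈ Γ, ee (s.1 * z1 γ + s.2 * z2 γ)‖ ^ 2 : ℝ) : ℂ) =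
      ∑ γ ∈ Γ, ∑ γ' ∈ Γ, (∑ s ∈ I, ee (s * (z1 γ - z1 γ'))) * (∑ s ∈ I, ee (s * (z2 γ - z2 γ'))) := by
    rw [Complex.ofReal_sum]
    simp_rw [normsq_sum_ee]
    rw [Finset.sum_comm]
    refine Finset.sum_congr rfl fun γ _ => ?_
    rw [Finset.sum_comm]
    refine Finset.sum_congr rfl fun γ' _ => ?_
    rw [Finset.sum_mul_sum, Finset.sum_product]
    refine Finset.sum_congr rfl fun x _ => Finset.sum_congr rfl fun y _ => ?_
    rw [← ee_add]; congr 1; ring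
  have hnn : 0 ≤ ∑ s ∈ I ×ˢ I, ‖∑ γ ∈ Γ, ee (s.1 * z1 γ + s.2 * z2 γ)‖ ^ 2 :=
    Finset.sum_nonneg fun _ _ => by positivity
  have e0 : ∑ s ∈ I ×ˢ I, ‖∑ γ ∈ Γ, ee (s.1 * z1 γ + s.2 * z2 γ)‖ ^ 2 =
    ‖((∑ s ∈ I ×ˢ I, ‖∑ γ ∈ Γ, ee (s.1 * z1 γ + s.2 * z2 γ)‖ ^ 2 : ℝ) : ℂ)‖ := by
    rw [Complex.norm_real, Real.norm_eq_abs, abs_of_nonneg hnn]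
  rw [e0, expand]
  have inner : ∀ γ ∈ Γ, ‖∑ γ' ∈ Γ, (∑ s ∈ I, ee (s * (z1 γ - z1 γ'))) *
      (∑ s ∈ I, ee (s * (z2 γ - z2 γ')))‖ ≤ (2 * S + 1) * ((2 * S + 1) * ν + Γ.card / (2 * η)) := by
    intro γ hγ
    have term : ∀ γ' ∈ Γ, ‖(∑ s ∈ I, ee (s * (z1 γ - z1 γ'))) *
      (∑ s ∈ I, ee (s * (z2 γ - z2 γ')))‖ ≤
        (2 * S + 1) * ((if dn (z1 γ - z1 γ') ≤ η then (2 * S + 1 : ℝ) else 0) + 1 / (2 * η)) := by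
      intro γ' _
      rw [norm_mul, mul_comm]
      refine mul_le_mul (tr _) ?_ (norm_nonneg _) (by positivity)
      split_ifs with hc
      · have := tr (z1 γ - z1 γ')
        have : 0 ≤ 1 / (2 * η) := by positivity
        linarith
      · rw [zero_add, le_div_iff₀ (by positivity)]
        have g := geom_bound_Icc (z1 γ - z1 γ') S
        push Not at hc
        have := norm_nonneg (∑ s ∈ Finset.Icc (-(S:ℤ)) S, ee (s * (z1 γ - z1 γ')))
        nlinarith
    refine (norm_sum_le _ _).trans ((Finset.sum_le_sum term).trans ?_)
    rw [← Finset.mul_sum, Finset.sum_add_distrib, Finset.sum_const, nsmul_eq_mul,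
      ← Finset.sum_filter, Finset.sum_const, nsmul_eq_mul]
    have := hν γ hγ
    have h2 : (0:ℝ) ≤ 2 * S + 1 := by positivity
    refine mul_le_mul_of_nonneg_left ?_ h2
    have h3 : ((Γ.filter fun γ' => dn (z1 γ - z1 γ') ≤ η).card : ℝ) * (2 * S + 1) ≤ ν * (2 * S + 1) := by
      gcongr
    have h4 : (Γ.card : ℝ) * (1 / (2 * η)) = Γ.card / (2 * η) := by ring
    rw [h4]; linarith
  refine (norm_sum_le _ _).trans ((Finset.sum_le_sum inner).trans (le_of_eq ?_))
  rw [Finset.sum_const, nsmul_eq_mul]; ring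



lemma line_lemma (s : Finset (ℤ × ℤ)) (c1 c2 : ℤ) (hc : c1 ≠ 0) (X D : ℝ) (hX : 0 ≤ X) (hD : 0 ≤ D)
    (hs : ∀ v ∈ s, |(v.1:ℝ)| ≤ X ∧ c1 * v.2 - c2 * v.1 ≠ 0 ∧ |((c1 * v.2 - c2 * v.1 : ℤ):ℝ)| ≤ D) :
    (s.card : ℝ) ≤ 2 * D * (1 + 2 * X / |(c1:ℝ)|) := by
  have hg0 : 0 < Int.gcd c1 c2 := Int.gcd_pos_of_ne_zero_left _ hc
  obtain ⟨f1, f2, hcop, e1, e2⟩ := Int.exists_gcd_one hg0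
  set g : ℕ := Int.gcd c1 c2
  have hgp : (0:ℝ) < g := by exact_mod_cast hg0
  have hg1 : (1:ℝ) ≤ g := by exact_mod_cast hg0
  have hf1 : f1 ≠ 0 := by rintro rfl; simp at e1; exact hc e1
  have hf1p : (0:ℝ) < |(f1:ℝ)| := abs_pos.mpr (by exact_mod_cast hf1)
  have hc1f : |(c1:ℝ)| = |(f1:ℝ)| * g := by
    rw [e1]; push_cast; rw [abs_mul, abs_of_pos hgp]
  have hval : ∀ v : ℤ × ℤ, c1 * v.2 - c2 * v.1 = (f1 * v.2 - f2 * v.1) * g := by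
    intro v; rw [e1, e2]; ring
  have hfib := card_le_fiber s (fun v => f1 * v.2 - f2 * v.1)
    (s.image fun v => f1 * v.2 - f2 * v.1) (fun x hx => Finset.mem_image_of_mem _ hx)
    (2 * X / |(f1:ℝ)| + 1) ?_
  · have hT : ((s.image fun v => f1 * v.2 - f2 * v.1).card : ℝ) ≤ 2 * (D / g) := by
      apply card_ints _ (by positivity)
      intro t ht
      rw [Finset.mem_image] at ht
      obtain ⟨v, hv, rfl⟩ := ht
      obtain ⟨-, h2, h3⟩ := hs v hv
      rw [hval] at h2 h3
      refine ⟨fun h => h2 (by rw [h, zero_mul]), ?_⟩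
      rw [le_div_iff₀ hgp]
      rw [Int.cast_mul, abs_mul, Int.cast_natCast, abs_of_pos hgp] at h3
      exact h3
    refine hfib.trans ?_
    calc _ ≤ 2 * (D / g) * (2 * X / |(f1:ℝ)| + 1) := by gcongr
      _ = 2 * D * (1 / g + 2 * X / |(c1:ℝ)|) := by rw [hc1f]; field_simp; ring
      _ ≤ _ := by
        have : 1 / (g:ℝ) ≤ 1 := by rw [div_le_one hgp]; exact hg1
        gcongr
  · intro t ht
    have hrel : ∀ v w : ℤ × ℤ, f1 * v.2 - f2 * v.1 = t → f1 * w.2 - f2 * w.1 = t →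
        f1 ∣ v.1 - w.1 := by
      intro v w hv hw
      have : f1 ∣ f2 * (v.1 - w.1) := ⟨v.2 - w.2, by linear_combination hw - hv⟩
      have hco : IsCoprime f1 f2 := Int.isCoprime_iff_gcd_eq_one.mpr hcop
      exact hco.dvd_of_dvd_mul_left this
    rw [← Finset.card_image_of_injOn (f := Prod.fst)]
    · refine (spaced_card _ (-X) X |(f1:ℝ)| hf1p (by linarith) ?_ ?_).trans (le_of_eq (by ring))
      · intro x hx
        rw [Finset.mem_image] at hx
        obtain ⟨v, hv, rfl⟩ := hx
        rw [Finset.mem_filter] at hv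
        exact abs_le.mp (hs v hv.1).1
      · intro x hx y hy hne
        rw [Finset.mem_image] at hx hy
        obtain ⟨v, hv, rfl⟩ := hx
        obtain ⟨w, hw, rfl⟩ := hy
        rw [Finset.mem_filter] at hv hw
        have := Int.le_of_dvd (abs_pos.mpr (sub_ne_zero.mpr hne))
          ((abs_dvd_abs _ _).mpr (hrel v w hv.2 hw.2))
        exact_mod_cast this
    · intro v hv w hw h
      simp only [Finset.coe_filter, Set.mem_ofPred_eq] at hv hw
      refine Prod.ext h ?_
      have h1 := hv.2.trans hw.2.symm
      rw [h] at h1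
      exact mul_left_cancel₀ hf1 (by linarith)

lemma line_lemma' (s : Finset (ℤ × ℤ)) (c1 c2 : ℤ) (hc : c2 ≠ 0) (X D : ℝ) (hX : 0 ≤ X) (hD : 0 ≤ D)
    (hs : ∀ v ∈ s, |(v.2:ℝ)| ≤ X ∧ c1 * v.2 - c2 * v.1 ≠ 0 ∧ |((c1 * v.2 - c2 * v.1 : ℤ):ℝ)| ≤ D) :
    (s.card : ℝ) ≤ 2 * D * (1 + 2 * X / |(c2:ℝ)|) := by
  rw [← Finset.card_image_of_injective s Prod.swap_injective]
  refine line_lemma _ c2 c1 hc X D hX hD ?_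
  intro v hv
  rw [Finset.mem_image] at hv
  obtain ⟨w, hw, rfl⟩ := hv
  obtain ⟨h1, h2, h3⟩ := hs w hw
  refine ⟨h1, ?_, ?_⟩
  · intro h; apply h2; simp at h; linarith
  · rw [← abs_neg] at h3
    simp only [Prod.fst_swap, Prod.snd_swap]
    refine le_trans (le_of_eq ?_) h3
    congr 1; push_cast; ring

/-- line lemma with sup norm -/
lemma line_lemma_max (s : Finset (ℤ × ℤ)) (c1 c2 : ℤ) (hc : ¬ (c1 = 0 ∧ c2 = 0)) (X D : ℝ)
    (hX : 0 ≤ X) (hD : 0 ≤ D)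
    (hs : ∀ v ∈ s, |(v.1:ℝ)| ≤ X ∧ |(v.2:ℝ)| ≤ X ∧
      c1 * v.2 - c2 * v.1 ≠ 0 ∧ |((c1 * v.2 - c2 * v.1 : ℤ):ℝ)| ≤ D) :
    (s.card : ℝ) ≤ 2 * D * (1 + 2 * X / max |(c1:ℝ)| |(c2:ℝ)|) := by
  rcases max_cases |(c1:ℝ)| |(c2:ℝ)| with ⟨h1, h2⟩ | ⟨h1, h2⟩
  · rw [h1]
    have : c1 ≠ 0 := by
      rintro rfl
      simp at h2
      exact hc ⟨rfl, h2⟩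
    exact line_lemma s c1 c2 this X D hX hD fun v hv => ⟨(hs v hv).1, (hs v hv).2.2⟩
  · rw [h1]
    have : c2 ≠ 0 := by
      rintro rfl
      simp at h2
      linarith [abs_nonneg (c1:ℝ)]
    exact line_lemma' s c1 c2 this X D hX hD fun v hv => ⟨(hs v hv).2.1, (hs v hv).2.2⟩

lemma sum_inv_max (S : ℕ) :
    ∑ s ∈ Finset.Icc (-(S:ℤ)) S, 1 / max 1 |(s:ℝ)| ≤ 3 + 2 * Real.log S := by
  have hh : ∀ N : ℕ, ∑ s ∈ Finset.Icc (-(N:ℤ)) N, 1 / max 1 |(s:ℝ)| = 1 + 2 * (harmonic N : ℝ) := by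
    intro N
    induction N with
    | zero => simp
    | succ n ih =>
      have e : Finset.Icc (-((n + 1 : ℕ):ℤ)) ((n + 1 : ℕ):ℤ) =
          insert (-((n:ℤ) + 1)) (insert ((n:ℤ) + 1) (Finset.Icc (-(n:ℤ)) n)) := by
        ext x; simp only [Finset.mem_insert, Finset.mem_Icc]; push_cast; omega
      rw [e, Finset.sum_insert, Finset.sum_insert, ih, harmonic_succ]
      · push_cast
        have h0 : (0:ℝ) ≤ (n:ℝ) + 1 := by positivity
        have h2 : |-1 + -(n:ℝ)| = n + 1 := by
          rw [← abs_neg]; rw [show -(-1 + -(n:ℝ)) = n + 1 by ring]; exact abs_of_nonneg h0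
        have h3 : max 1 ((n:ℝ) + 1) = n + 1 := max_eq_right (by linarith [Nat.cast_nonneg (α := ℝ) n])
        rw [neg_add_rev, h2, abs_of_nonneg h0, h3]
        rw [one_div]; ring
      · simp only [Finset.mem_Icc]; omega
      · simp only [Finset.mem_insert, Finset.mem_Icc]; omega
  rw [hh]
  have := harmonic_le_one_add_log S
  linarith

lemma expsum_bound {ι : Type*} (V : Finset ((ℤ × ℤ) × (ℤ × ℤ))) (T Z : ℕ) (hT : 1 ≤ T) (hZ : 1 ≤ Z)
    (D : ℝ) (hD : 0 ≤ D)
    (hV : ∀ v ∈ V, |(v.1.1:ℝ)| ≤ Z ∧ |(v.1.2:ℝ)| ≤ Z ∧ |(v.2.1:ℝ)| ≤ Z ∧ |(v.2.2:ℝ)| ≤ Z ∧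
      v.1.1 * v.2.2 - v.1.2 * v.2.1 ≠ 0 ∧ |((v.1.1 * v.2.2 - v.1.2 * v.2.1 : ℤ):ℝ)| ≤ D)
    (m m' : ℤ) (hm : |m| ≤ T) (hm' : |m'| ≤ T) (hne : ¬ (m = 0 ∧ m' = 0))
    (Γ : Finset ι) (z1 z2 : ι → ℝ) (S : ℕ) (hS : S = 2 * T * Z) (Q : ℝ)
    (hQ : ∑ s ∈ Finset.Icc (-(S:ℤ)) S ×ˢ Finset.Icc (-(S:ℤ)) S,
      ‖∑ γ ∈ Γ, ee (s.1 * z1 γ + s.2 * z2 γ)‖ ^ 2 ≤ Q) :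
    ‖∑ x ∈ V ×ˢ Γ, ee (m * (x.1.1.1 * z1 x.2 + x.1.1.2 * z2 x.2) +
      m' * (x.1.2.1 * z1 x.2 + x.1.2.2 * z2 x.2))‖ ≤
      4 * T * D * S * (3 + 2 * Real.log S) * Real.sqrt Q := by
  have hTp : (1:ℝ) ≤ T := by exact_mod_cast hT
  have hZp : (1:ℝ) ≤ Z := by exact_mod_cast hZ
  have hSr : (S:ℝ) = 2 * T * Z := by rw [hS]; push_cast; ring
  have hmr : |(m:ℝ)| ≤ T := by exact_mod_cast hm
  have hmr' : |(m':ℝ)| ≤ T := by exact_mod_cast hm'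
  set G : ℤ × ℤ → ℝ := fun s => ‖∑ γ ∈ Γ, ee (s.1 * z1 γ + s.2 * z2 γ)‖ with hG
  set B := Finset.Icc (-(S:ℤ)) S ×ˢ Finset.Icc (-(S:ℤ)) S with hB
  set σ : (ℤ × ℤ) × (ℤ × ℤ) → ℤ × ℤ := fun v => (m * v.1.1 + m' * v.2.1, m * v.1.2 + m' * v.2.2) with hσ
  -- elements
  have hmem1 : ∀ x y : ℤ, |(x:ℝ)| ≤ Z → |(y:ℝ)| ≤ Z → m * x + m' * y ∈ Finset.Icc (-(S:ℤ)) S := by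
    intro x y hx hy
    have : |((m * x + m' * y : ℤ) : ℝ)| ≤ S := by
      push_cast
      refine (abs_add_le _ _).trans ?_
      rw [abs_mul, abs_mul, hSr]
      have h1 : |(m:ℝ)| * |(x:ℝ)| ≤ T * Z := mul_le_mul hmr hx (abs_nonneg _) (by positivity)
      have h2 : |(m':ℝ)| * |(y:ℝ)| ≤ T * Z := mul_le_mul hmr' hy (abs_nonneg _) (by positivity)
      linarith
    have h3 : |m * x + m' * y| ≤ (S:ℤ) := by exact_mod_cast this
    rw [Finset.mem_Icc]; exact abs_le.mp h3
  have hmem : ∀ v ∈ V, σ v ∈ B := by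
    intro v hv
    obtain ⟨h1, h2, h3, h4, -, -⟩ := hV v hv
    rw [hB, Finset.mem_product]
    exact ⟨hmem1 _ _ h1 h3, hmem1 _ _ h2 h4⟩
  have hcr : ∀ v, (σ v).1 * v.2.2 - (σ v).2 * v.2.1 = m * (v.1.1 * v.2.2 - v.1.2 * v.2.1) := by
    intro v; simp only [hσ]; ring
  have hcr' : ∀ v, (σ v).1 * v.1.2 - (σ v).2 * v.1.1 = -m' * (v.1.1 * v.2.2 - v.1.2 * v.2.1) := by
    intro v; simp only [hσ]; ring
  have hnz : ∀ v ∈ V, ¬ ((σ v).1 = 0 ∧ (σ v).2 = 0) := by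
    intro v hv ⟨h1, h2⟩
    have hc := (hV v hv).2.2.2.2.1
    have e1 := hcr v
    have e2 := hcr' v
    rw [h1, h2] at e1 e2
    simp only [zero_mul, sub_zero] at e1 e2
    rcases mul_eq_zero.mp e1.symm with h | h
    · rcases mul_eq_zero.mp e2.symm with h' | h'
      · exact hne ⟨h, by linarith⟩
      · exact hc h'
    · exact hc h
  -- multiplicity
  set μ : ℤ × ℤ → ℝ := fun s => ((V.filter fun v => σ v = s).card : ℝ) with hμ
  have hmult : ∀ s ∈ B, μ s ≤ 4 * T * D * S * (Real.sqrt (1 / max 1 |(s.1:ℝ)|) *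
      Real.sqrt (1 / max 1 |(s.2:ℝ)|)) := by
    intro s hs
    have hrhs : 0 ≤ 4 * T * D * S * (Real.sqrt (1 / max 1 |(s.1:ℝ)|) *
      Real.sqrt (1 / max 1 |(s.2:ℝ)|)) := by positivity
    by_cases hem : (V.filter fun v => σ v = s) = ∅
    · simp only [hμ, hem, Finset.card_empty, Nat.cast_zero]; exact hrhs
    obtain ⟨v0, hv0⟩ := Finset.nonempty_iff_ne_empty.mpr hem
    rw [Finset.mem_filter] at hv0
    have hs0 : ¬ (s.1 = 0 ∧ s.2 = 0) := by rw [← hv0.2]; exact hnz v0 hv0.1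
    have hline : μ s ≤ 2 * (T * D) * (1 + 2 * Z / max |(s.1:ℝ)| |(s.2:ℝ)|) := by
      by_cases hm0 : m = 0
      · have hm0' : m' ≠ 0 := fun h => hne ⟨hm0, h⟩
        simp only [hμ]
        rw [← Finset.card_image_of_injOn (f := Prod.fst)]
        · refine line_lemma_max _ s.1 s.2 hs0 Z (T * D) (by positivity) (by positivity) ?_
          intro c hc
          rw [Finset.mem_image] at hc
          obtain ⟨v, hv, rfl⟩ := hc
          rw [Finset.mem_filter] at hv
          obtain ⟨h1, h2, h3, h4, h5, h6⟩ := hV v hv.1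
          rw [← hv.2, hcr']
          refine ⟨h1, h2, mul_ne_zero (neg_ne_zero.mpr hm0') h5, ?_⟩
          rw [Int.cast_mul, abs_mul, Int.cast_neg, abs_neg]
          exact mul_le_mul hmr' h6 (abs_nonneg _) (by positivity)
        · intro v hv w hw h
          simp only [Finset.coe_filter, Set.mem_ofPred_eq] at hv hw
          have e := hv.2.trans hw.2.symm
          simp only [hσ, hm0, zero_mul, zero_add, Prod.mk.injEq] at e
          refine Prod.ext h (Prod.ext ?_ ?_)
          · exact mul_left_cancel₀ hm0' e.1
          · exact mul_left_cancel₀ hm0' e.2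
      · simp only [hμ]
        rw [← Finset.card_image_of_injOn (f := Prod.snd)]
        · refine line_lemma_max _ s.1 s.2 hs0 Z (T * D) (by positivity) (by positivity) ?_
          intro c hc
          rw [Finset.mem_image] at hc
          obtain ⟨v, hv, rfl⟩ := hc
          rw [Finset.mem_filter] at hv
          obtain ⟨h1, h2, h3, h4, h5, h6⟩ := hV v hv.1
          rw [← hv.2, hcr]
          refine ⟨h3, h4, mul_ne_zero hm0 h5, ?_⟩
          rw [Int.cast_mul, abs_mul]
          exact mul_le_mul hmr h6 (abs_nonneg _) (by positivity)
        · intro v hv w hw h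
          simp only [Finset.coe_filter, Set.mem_ofPred_eq] at hv hw
          have e := hv.2.trans hw.2.symm
          simp only [hσ, h, Prod.mk.injEq] at e
          refine Prod.ext (Prod.ext ?_ ?_) h
          · exact mul_left_cancel₀ hm0 (by linarith [e.1])
          · exact mul_left_cancel₀ hm0 (by linarith [e.2])
    have hsB := hs
    rw [hB, Finset.mem_product, Finset.mem_Icc, Finset.mem_Icc] at hsB
    set M := max |(s.1:ℝ)| |(s.2:ℝ)| with hM
    have hM1 : 1 ≤ M := by
      rw [not_and_or] at hs0
      rcases hs0 with h | h
      · refine le_max_of_le_left ?_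
        have := Int.one_le_abs h
        exact_mod_cast this
      · refine le_max_of_le_right ?_
        have := Int.one_le_abs h
        exact_mod_cast this
    have hMS : M ≤ S := by
      refine max_le ?_ ?_
      · have := abs_le.mpr hsB.1; exact_mod_cast this
      · have := abs_le.mpr hsB.2; exact_mod_cast this
    have hMp : 0 < M := by linarith
    have step : μ s ≤ 4 * T * D * S * (1 / M) := by
      refine hline.trans ?_
      have : 1 + 2 * Z / M ≤ 2 * S / M := by
        rw [← sub_nonneg]
        have : 2 * (S:ℝ) / M - (1 + 2 * Z / M) = (2 * S - M - 2 * Z) / M := by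
          field_simp
          ring
        rw [this]
        apply div_nonneg _ hMp.le
        have : 2 * (Z:ℝ) ≤ S := by rw [hSr]; nlinarith
        linarith
      calc _ ≤ 2 * (T * D) * (2 * S / M) := by gcongr
        _ = _ := by ring
    refine step.trans ?_
    have : 1 / M ≤ Real.sqrt (1 / max 1 |(s.1:ℝ)|) * Real.sqrt (1 / max 1 |(s.2:ℝ)|) := by
      rw [← Real.sqrt_mul (by positivity)]
      apply Real.le_sqrt_of_sq_le
      rw [sq]
      have a1 : max 1 |(s.1:ℝ)| ≤ M := max_le hM1 (le_max_left _ _)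
      have a2 : max 1 |(s.2:ℝ)| ≤ M := max_le hM1 (le_max_right _ _)
      gcongr
    gcongr
  -- main
  have c1 : ‖∑ x ∈ V ×ˢ Γ, ee (m * (x.1.1.1 * z1 x.2 + x.1.1.2 * z2 x.2) +
      m' * (x.1.2.1 * z1 x.2 + x.1.2.2 * z2 x.2))‖ ≤ ∑ v ∈ V, G (σ v) := by
    rw [Finset.sum_product]
    refine (norm_sum_le _ _).trans (Finset.sum_le_sum fun v _ => ?_)
    simp only [hG, hσ]
    refine le_of_eq (congrArg _ (Finset.sum_congr rfl fun γ _ => ?_))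
    congr 1; push_cast; ring
  have c2 : ∑ v ∈ V, G (σ v) = ∑ s ∈ B, μ s * G s := by
    rw [← Finset.sum_fiberwise_of_maps_to hmem]
    refine Finset.sum_congr rfl fun s _ => ?_
    simp only [hμ]
    rw [← nsmul_eq_mul, ← Finset.sum_const]
    refine Finset.sum_congr rfl fun v hv => ?_
    rw [(Finset.mem_filter.mp hv).2]
  have hμ0 : ∀ s, 0 ≤ μ s := fun s => Nat.cast_nonneg _
  have hL : 0 ≤ 3 + 2 * Real.log S := by
    have : 0 ≤ Real.log S := Real.log_natCast_nonneg S
    linarith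
  have c3 : ∑ s ∈ B, μ s ^ 2 ≤ (4 * T * D * S * (3 + 2 * Real.log S)) ^ 2 := by
    calc ∑ s ∈ B, μ s ^ 2 ≤ ∑ s ∈ B, (4 * T * D * S) ^ 2 * ((1 / max 1 |(s.1:ℝ)|) *
        (1 / max 1 |(s.2:ℝ)|)) := by
          refine Finset.sum_le_sum fun s hs => ?_
          refine (pow_le_pow_left₀ (hμ0 s) (hmult s hs) 2).trans (le_of_eq ?_)
          rw [mul_pow, mul_pow (Real.sqrt _), Real.sq_sqrt (by positivity), Real.sq_sqrt (by positivity)]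
      _ = (4 * T * D * S) ^ 2 * ((∑ s ∈ Finset.Icc (-(S:ℤ)) S, 1 / max 1 |(s:ℝ)|) *
          (∑ s ∈ Finset.Icc (-(S:ℤ)) S, 1 / max 1 |(s:ℝ)|)) := by
          rw [← Finset.mul_sum, Finset.sum_mul_sum, hB, Finset.sum_product]
      _ ≤ (4 * T * D * S) ^ 2 * ((3 + 2 * Real.log S) * (3 + 2 * Real.log S)) := by
          have := sum_inv_max S
          have h0 : 0 ≤ ∑ s ∈ Finset.Icc (-(S:ℤ)) S, 1 / max 1 |(s:ℝ)| :=
            Finset.sum_nonneg fun _ _ => by positivity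
          gcongr
      _ = _ := by ring
  refine c1.trans ?_
  rw [c2]
  refine (Real.sum_mul_le_sqrt_mul_sqrt B μ G).trans ?_
  have d1 : Real.sqrt (∑ s ∈ B, μ s ^ 2) ≤ 4 * T * D * S * (3 + 2 * Real.log S) := by
    rw [Real.sqrt_le_left (by positivity)]; exact c3
  have d2 : Real.sqrt (∑ s ∈ B, G s ^ 2) ≤ Real.sqrt Q := Real.sqrt_le_sqrt hQ
  gcongr



lemma card_ints' (s : Finset ℤ) (lo hi : ℝ) (hlh : lo ≤ hi) (hs : ∀ x ∈ s, lo ≤ x ∧ (x:ℝ) ≤ hi) :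
    (s.card : ℝ) ≤ hi - lo + 1 := by
  have := spaced_card s lo hi 1 one_pos hlh hs ?_
  · simpa using this
  · intro x _ y _ hne
    have := Int.one_le_abs (sub_ne_zero.mpr hne)
    exact_mod_cast this

def VCond (P R A A' D : ℝ) (v : (ℤ × ℤ) × (ℤ × ℤ)) : Prop :=
  |(v.1.1:ℝ)| ≤ 2 * A / R ∧ |(v.1.2:ℝ)| ≤ A / P ∧ |(v.2.1:ℝ)| ≤ 3 * A' / R ∧
  |(v.2.2:ℝ)| ≤ 2 * A' / P ∧ A / (8192 * R) ≤ |(v.1.1:ℝ)| + |(v.1.2:ℝ)| ∧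
  v.1.1 * v.2.2 - v.1.2 * v.2.1 ≠ 0 ∧ |((v.1.1 * v.2.2 - v.1.2 * v.2.1 : ℤ):ℝ)| ≤ D

lemma V_count (V : Finset ((ℤ × ℤ) × (ℤ × ℤ))) (P R A A' D : ℝ) (hD : 1 ≤ D) (hR : 1 ≤ R)
    (hRP : R ≤ P) (hPA : P ≤ A) (hAA : A ≤ A') (hV : ∀ v ∈ V, VCond P R A A' D v) :
    (V.card : ℝ) ≤ 3072000 * (A * A' * D) / (R * P) := by
  have hPp : 0 < P := by linarith
  have hAp : 0 < A := by linarith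
  have hAp' : 0 < A' := by linarith
  have hRp : 0 < R := by linarith
  have hr1 : 1 ≤ A' / A := by rw [le_div_iff₀ hAp]; linarith
  have hfib := card_le_fiber V (fun v => v.1) (V.image fun v => v.1)
    (fun x hx => Finset.mem_image_of_mem _ hx) (204800 * D * (A' / A)) ?_
  · have hI : ((V.image fun v => v.1).card : ℝ) ≤ (5 * A / R) * (3 * A / P) := by
      have hAR : 1 ≤ A / R := by rw [le_div_iff₀ hRp]; linarith
      have hAP : 1 ≤ A / P := by rw [le_div_iff₀ hPp]; linarith
      have h1 := card_le_fiber (V.image fun v => v.1) (fun c => c.1)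
        ((V.image fun v => v.1).image fun c => c.1) (fun x hx => Finset.mem_image_of_mem _ hx)
        (3 * A / P) ?_
      · refine h1.trans ?_
        have : (((V.image fun v => v.1).image fun c => c.1).card : ℝ) ≤ 5 * A / R := by
          refine (card_ints' _ (-(2 * A / R)) (2 * A / R) ?_ ?_).trans ?_
          · have : 0 ≤ 2 * A / R := by positivity
            linarith
          · intro x hx
            simp only [Finset.mem_image] at hx
            obtain ⟨c, ⟨v, hv, rfl⟩, rfl⟩ := hx
            exact abs_le.mp (hV v hv).1
          · have e1 : 2 * A / R = 2 * (A / R) := by ring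
            have e2 : 5 * A / R = 5 * (A / R) := by ring
            rw [e1, e2]; linarith
        gcongr
      · intro y _
        rw [← Finset.card_image_of_injOn (f := Prod.snd)]
        · refine (card_ints' _ (-(A / P)) (A / P) ?_ ?_).trans ?_
          · have : 0 ≤ A / P := by positivity
            linarith
          · intro x hx
            simp only [Finset.mem_image, Finset.mem_filter] at hx
            obtain ⟨c, ⟨⟨v, hv, rfl⟩, _⟩, rfl⟩ := hx
            exact abs_le.mp (hV v hv).2.1
          · have e2 : 3 * A / P = 3 * (A / P) := by ring
            rw [e2]; linarith
        · intro v hv w hw h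
          simp only [Finset.coe_filter, Set.mem_ofPred_eq] at hv hw
          exact Prod.ext (hv.2.trans hw.2.symm) h
    refine hfib.trans ?_
    calc _ ≤ (5 * A / R) * (3 * A / P) * (204800 * D * (A' / A)) := by gcongr
      _ = 3072000 * (A * A' * D) / (R * P) := by field_simp; norm_num
  · intro c _
    rw [← Finset.card_image_of_injOn (f := Prod.snd)]
    swap
    · intro v hv w hw h
      simp only [Finset.coe_filter, Set.mem_ofPred_eq] at hv hw
      exact Prod.ext (hv.2.trans hw.2.symm) h
    by_cases hem : (V.filter fun v => v.1 = c) = ∅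
    · rw [hem]; simp; positivity
    obtain ⟨v0, hv0⟩ := Finset.nonempty_iff_ne_empty.mpr hem
    rw [Finset.mem_filter] at hv0
    have hlow := (hV v0 hv0.1).2.2.2.2.1
    rw [hv0.2] at hlow
    have hhalf : A / (8192 * R) = A / (16384 * R) + A / (16384 * R) := by field_simp; norm_num
    have hAq : 0 < A / (16384 * R) := by positivity
    rcases le_or_gt (A / (16384 * R)) |(c.1:ℝ)| with hcase | hcase
    · have hc0 : c.1 ≠ 0 := by
        intro h; rw [h] at hcase; simp at hcase; linarith
      have hcp : 0 < |(c.1:ℝ)| := by linarith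
      refine (line_lemma _ c.1 c.2 hc0 (3 * A' / R) D (by positivity) (by linarith) ?_).trans ?_
      · intro w hw
        simp only [Finset.mem_image, Finset.mem_filter] at hw
        obtain ⟨v, ⟨hv, rfl⟩, rfl⟩ := hw
        obtain ⟨_, _, h3, _, _, h6, h7⟩ := hV v hv
        exact ⟨h3, h6, h7⟩
      · have : 2 * (3 * A' / R) / |(c.1:ℝ)| ≤ 98304 * (A' / A) := by
          rw [div_le_iff₀ hcp]
          calc 2 * (3 * A' / R) = 98304 * (A' / A) * (A / (16384 * R)) := by field_simp; norm_num
            _ ≤ _ := by gcongr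
        calc 2 * D * (1 + 2 * (3 * A' / R) / |(c.1:ℝ)|) ≤ 2 * D * (1 * (A' / A) + 98304 * (A' / A)) := by
              gcongr; linarith
          _ ≤ 204800 * D * (A' / A) := by
              have : 0 ≤ D * (A' / A) := by positivity
              nlinarith
    · have hcase2 : A / (16384 * R) ≤ |(c.2:ℝ)| := by linarith
      have hc0 : c.2 ≠ 0 := by
        intro h; rw [h] at hcase2; simp at hcase2; linarith
      have hcp : 0 < |(c.2:ℝ)| := by linarith
      refine (line_lemma' _ c.1 c.2 hc0 (2 * A' / P) D (by positivity) (by linarith) ?_).trans ?_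
      · intro w hw
        simp only [Finset.mem_image, Finset.mem_filter] at hw
        obtain ⟨v, ⟨hv, rfl⟩, rfl⟩ := hw
        obtain ⟨_, _, _, h4, _, h6, h7⟩ := hV v hv
        exact ⟨h4, h6, h7⟩
      · have : 2 * (2 * A' / P) / |(c.2:ℝ)| ≤ 98304 * (A' / A) := by
          rw [div_le_iff₀ hcp]
          calc 2 * (2 * A' / P) ≤ 2 * (2 * A' / R) := by gcongr
            _ ≤ 2 * (3 * A' / R) := by gcongr; norm_num
            _ = 98304 * (A' / A) * (A / (16384 * R)) := by field_simp; norm_num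
            _ ≤ _ := by gcongr
        calc 2 * D * (1 + 2 * (2 * A' / P) / |(c.2:ℝ)|) ≤ 2 * D * (1 * (A' / A) + 98304 * (A' / A)) := by
              gcongr; linarith
          _ ≤ 204800 * D * (A' / A) := by
              have : 0 ≤ D * (A' / A) := by positivity
              nlinarith

def SCond (P R : ℕ) (x0 lam : ℝ) (γ : ℤ × ℤ) : Prop :=
  (R:ℤ) ≤ γ.2 ∧ γ.2 < 2 * R ∧ γ.2 ≤ P ∧ 0 ≤ γ.1 ∧ γ.1 ≤ P ∧ x0 * γ.2 - 1 ≤ γ.1 ∧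
    (γ.1:ℝ) ≤ (x0 + lam) * γ.2 + 1

lemma S_count (Γ : Finset (ℤ × ℤ)) (P R : ℕ) (x0 lam : ℝ) (hlam : 0 ≤ lam)
    (hΓ : ∀ γ ∈ Γ, SCond P R x0 lam γ) : (Γ.card : ℝ) ≤ R * (2 * R * lam + 3) := by
  have h1 := card_le_fiber Γ (fun c => c.2) (Finset.Ico (R:ℤ) (2 * R)) ?_ (2 * R * lam + 3) ?_
  · refine h1.trans (le_of_eq ?_)
    rw [Int.card_Ico]
    have : (2 * (R:ℤ) - R).toNat = R := by omega
    rw [this]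
  · intro γ hγ
    rw [Finset.mem_Ico]; exact ⟨(hΓ γ hγ).1, (hΓ γ hγ).2.1⟩
  · intro n hn
    rw [Finset.mem_Ico] at hn
    have hn0 : (0:ℝ) ≤ n := by
      have : (0:ℤ) ≤ n := by omega
      exact_mod_cast this
    have hn2 : (n:ℝ) ≤ 2 * R := by exact_mod_cast hn.2.le
    rw [← Finset.card_image_of_injOn (f := Prod.fst)]
    · refine (card_ints' _ (x0 * n - 1) ((x0 + lam) * n + 1) (by nlinarith) ?_).trans ?_
      · intro x hx
        simp only [Finset.mem_image, Finset.mem_filter] at hx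
        obtain ⟨γ, ⟨hγ, rfl⟩, rfl⟩ := hx
        exact (hΓ γ hγ).2.2.2.2.2
      · nlinarith
    · intro v hv w hw h
      simp only [Finset.coe_filter, Set.mem_ofPred_eq] at hv hw
      exact Prod.ext h (hv.2.trans hw.2.symm)

/-- standing hypotheses on parameters -/
structure Par (a b : ℝ) (T P N τ : ℕ) : Prop where
  hT : T = 2 ^ τ
  hP : P = 2 ^ N
  hTP : T ^ 60 ≤ P
  hbig : 8 + 2 * N + 12 * τ ≤ T
  hnu : ∀ q : ℕ, 1 ≤ q → q ≤ (T ^ 60) ^ 2 →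
    2 * (T ^ 60 : ℕ) * ((T:ℝ) ^ 60 / P) < max (dn (q * a)) (dn (q * b))

lemma log_S_bound (T P N τ : ℕ) (hT : T = 2 ^ τ) (hP : P = 2 ^ N) (hbig : 8 + 2 * N + 12 * τ ≤ T) :
    3 + 2 * Real.log ((6 * P * T ^ 6 : ℕ) : ℝ) ≤ T := by
  have h1 : ((6 * P * T ^ 6 : ℕ) : ℝ) ≤ (2:ℝ) ^ (N + 6 * τ + 3) := by
    rw [hT, hP]; push_cast
    rw [pow_add, pow_add, pow_mul', mul_comm 6]
    have : (0:ℝ) < 2 ^ N * (2 ^ τ) ^ 6 := by positivity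
    nlinarith
  have hpos : (0:ℝ) < ((6 * P * T ^ 6 : ℕ) : ℝ) := by
    rw [hT, hP]; positivity
  have h2 := Real.log_le_log hpos h1
  rw [Real.log_pow] at h2
  have h3 := Real.log_two_lt_d9
  have h4 : (8:ℝ) + 2 * N + 12 * τ ≤ T := by exact_mod_cast hbig
  push_cast at h2 ⊢
  have h5 : ((N:ℝ) + 6 * τ + 3) * Real.log 2 ≤ ((N:ℝ) + 6 * τ + 3) * 0.7 := by
    gcongr; linarith
  have : (0:ℝ) ≤ N := Nat.cast_nonneg _
  have : (0:ℝ) ≤ τ := Nat.cast_nonneg _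
  linarith

lemma err_bound (a b : ℝ) (T P N τ : ℕ) (hp : Par a b T P N τ) (x0 lam : ℝ) (hl0 : 0 ≤ lam)
    (hl1 : lam ≤ 1) (R : ℕ) (hR : 1 ≤ R) (hRP : R ≤ P) (hRT : P ≤ R * T ^ 4)
    (A A' D : ℝ) (hA : (P:ℝ) ^ 2 ≤ A) (hAA : A ≤ A') (hA' : A' ≤ (P:ℝ) ^ 2 * T) (hD1 : 1 ≤ D)
    (hD : D ≤ 4 * T ^ 2) (V : Finset ((ℤ × ℤ) × (ℤ × ℤ))) (hV : ∀ v ∈ V, VCond P R A A' D v)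
    (Γ : Finset (ℤ × ℤ)) (hΓ : ∀ γ ∈ Γ, SCond P R x0 lam γ) (z2 : ℤ × ℤ → ℝ)
    (m m' : ℤ) (hm : |m| ≤ T) (hm' : |m'| ≤ T) (hne : ¬ (m = 0 ∧ m' = 0)) :
    ‖∑ x ∈ V ×ˢ Γ, ee (m * (x.1.1.1 * (a * x.2.1 + b * x.2.2) + x.1.1.2 * z2 x.2) +
      m' * (x.1.2.1 * (a * x.2.1 + b * x.2.2) + x.1.2.2 * z2 x.2))‖ ≤ 8640 * (P:ℝ) ^ 4 / T ^ 14 := by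
  obtain ⟨hT, hP, hTP, hbig, hnu⟩ := hp
  have hT1 : 1 ≤ T := by rw [hT]; exact Nat.one_le_two_pow
  have hP1 : 1 ≤ P := by rw [hP]; exact Nat.one_le_two_pow
  have hTr : (1:ℝ) ≤ T := by exact_mod_cast hT1
  have hPr : (1:ℝ) ≤ P := by exact_mod_cast hP1
  have hRr : (1:ℝ) ≤ R := by exact_mod_cast hR
  have hRPr : (R:ℝ) ≤ P := by exact_mod_cast hRP
  have hRTr : (P:ℝ) ≤ R * T ^ 4 := by exact_mod_cast hRT
  have hTPr : (T:ℝ) ^ 60 ≤ P := by exact_mod_cast hTP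
  have hT5 : (1:ℝ) ≤ (T:ℝ) ^ 5 := one_le_pow₀ hTr
  have hA0 : 0 ≤ A := le_trans (by positivity) hA
  have hbd : A' / R ≤ P * T ^ 5 := by
    rw [div_le_iff₀ (by positivity)]
    calc A' ≤ (P:ℝ) * P * T := by rw [← sq]; exact hA'
      _ ≤ P * (R * T ^ 4) * T := by gcongr
      _ = _ := by ring
  have hbd2 : A' / P ≤ P * T ^ 5 := by
    refine le_trans ?_ hbd
    have : 0 ≤ A' := by linarith
    gcongr
  have hbd3 : A / R ≤ P * T ^ 5 := le_trans (by gcongr) hbd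
  have hbd4 : A / P ≤ P * T ^ 5 := le_trans (by gcongr) hbd2
  have hcardΓ : (Γ.card : ℝ) ≤ 5 * (P:ℝ) ^ 2 := by
    refine (S_count Γ P R x0 lam hl0 hΓ).trans ?_
    calc (R:ℝ) * (2 * R * lam + 3) ≤ P * (2 * P * 1 + 3 * P) := by
          gcongr; linarith
      _ = _ := by ring
  set Z := 3 * P * T ^ 5 with hZ
  set S := 6 * P * T ^ 6 with hS
  have hSZ : S = 2 * T * Z := by rw [hS, hZ]; ring
  have hZr : (Z:ℝ) = 3 * (P * T ^ 5) := by rw [hZ]; push_cast; ring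
  have hSr : (S:ℝ) = 6 * P * T ^ 6 := by rw [hS]; push_cast; ring
  set ν : ℝ := 9 * P ^ 2 / T ^ 60 with hν
  set η : ℝ := (T:ℝ) ^ 60 / P with hη
  have hηp : 0 < η := by rw [hη]; positivity
  have hls := large_sieve Γ (fun γ => a * γ.1 + b * γ.2) z2 S η ν hηp ?_
  swap
  · intro γ hγ
    have hnb := nu_bound a b η P (T ^ 60) (Nat.one_le_pow _ _ hT1) hnu
    have hle : ((Γ.filter fun γ' => dn ((a * γ.1 + b * γ.2) - (a * γ'.1 + b * γ'.2)) ≤ η).card : ℝ) ≤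
        (((Finset.Icc (-(P:ℤ)) P ×ˢ Finset.Icc (-(P:ℤ)) P).filter fun v : ℤ × ℤ =>
      dn (a * v.1 + b * v.2) ≤ η).card : ℝ) := by
      norm_cast
      refine Finset.card_le_card_of_injOn (fun γ' => (γ.1 - γ'.1, γ.2 - γ'.2)) ?_ ?_
      · intro γ' hγ'
        rw [Finset.mem_coe, Finset.mem_filter] at hγ'
        obtain ⟨b1, b2, b3, b4, b5, -⟩ := hΓ γ hγ
        obtain ⟨d1, d2, d3, d4, d5, -⟩ := hΓ γ' hγ'.1
        rw [Finset.mem_coe, Finset.mem_filter, Finset.mem_product, Finset.mem_Icc, Finset.mem_Icc]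
        refine ⟨⟨⟨?_, ?_⟩, ?_, ?_⟩, ?_⟩
        · simp only; omega
        · simp only; omega
        · simp only; omega
        · simp only; omega
        · refine le_trans (le_of_eq ?_) hγ'.2
          congr 1; push_cast; ring
      · intro x _ y _ h
        simp only [Prod.mk.injEq] at h
        exact Prod.ext (by linarith [h.1]) (by linarith [h.2])
    refine hle.trans (hnb.trans ?_)
    rw [hν]
    have hW : (0:ℝ) < (T:ℝ) ^ 60 := by positivity
    have h1 : (1:ℝ) ≤ P / T ^ 60 := by rw [le_div_iff₀ hW]; linarith
    push_cast
    calc (2 * (P:ℝ) + 1) * (2 * P / T ^ 60 + 1) ≤ (3 * P) * (3 * (P / T ^ 60)) := by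
          gcongr
          · linarith
          · have : 2 * (P:ℝ) / T ^ 60 = 2 * (P / T ^ 60) := by ring
            rw [this]; linarith
      _ = _ := by ring
  set Q : ℝ := (89 * (P:ℝ) ^ 3 / T ^ 24) ^ 2 with hQ
  have hQle : (2 * (S:ℝ) + 1) * ((2 * S + 1) * Γ.card * ν + (Γ.card : ℝ) ^ 2 / (2 * η)) ≤ Q := by
    have hPT : (1:ℝ) ≤ P * T ^ 6 := by
      have : (1:ℝ) ≤ (T:ℝ) ^ 6 := one_le_pow₀ hTr
      nlinarith
    have h2S : 2 * (S:ℝ) + 1 ≤ 13 * (P * T ^ 6) := by rw [hSr]; linarith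
    have hν0 : 0 ≤ ν := by rw [hν]; positivity
    have hS0 : (0:ℝ) ≤ S := Nat.cast_nonneg _
    calc _ ≤ 13 * ((P:ℝ) * T ^ 6) * (13 * (P * T ^ 6) * (5 * P ^ 2) * ν + (5 * (P:ℝ) ^ 2) ^ 2 / (2 * η)) := by
          gcongr
      _ = 7605 * ((P:ℝ) ^ 6 / T ^ 48) + 162.5 * (P ^ 6 / T ^ 54) := by
          rw [hν, hη]; field_simp; ring
      _ ≤ 7605 * ((P:ℝ) ^ 6 / T ^ 48) + 162.5 * (P ^ 6 / T ^ 48) := by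
          gcongr 7605 * ((P:ℝ) ^ 6 / T ^ 48) + 162.5 * (P ^ 6 / ?_)
          exact pow_le_pow_right₀ hTr (by norm_num)
      _ ≤ 7921 * ((P:ℝ) ^ 6 / T ^ 48) := by
          have : 0 ≤ (P:ℝ) ^ 6 / T ^ 48 := by positivity
          linarith
      _ = Q := by rw [hQ]; ring
  have hsqrtQ : Real.sqrt Q = 89 * (P:ℝ) ^ 3 / T ^ 24 := by
    rw [hQ]; exact Real.sqrt_sq (by positivity)
  have hex := expsum_bound V T Z hT1 (Nat.mul_pos (Nat.mul_pos (by norm_num) hP1) (Nat.pow_pos hT1)) D (by linarith) ?_ m m' hm hm' hne Γ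
    (fun γ => a * γ.1 + b * γ.2) z2 S hSZ Q (hls.trans hQle)
  · refine hex.trans ?_
    rw [hsqrtQ]
    have hlog := log_S_bound T P N τ hT hP hbig
    rw [← hS] at hlog
    have hlog0 : 0 ≤ 3 + 2 * Real.log (S:ℝ) := by
      have : 0 ≤ Real.log (S:ℝ) := Real.log_natCast_nonneg S
      linarith
    calc _ ≤ 4 * (T:ℝ) * (4 * T ^ 2) * S * T * (89 * (P:ℝ) ^ 3 / T ^ 24) := by gcongr
      _ = 8544 * (P:ℝ) ^ 4 / T ^ 14 := by rw [hSr]; field_simp; ring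
      _ ≤ _ := by gcongr; norm_num
  · intro v hv
    obtain ⟨h1, h2, h3, h4, h5, h6, h7⟩ := hV v hv
    have hPT5 : (0:ℝ) ≤ P * T ^ 5 := by positivity
    rw [hZr]
    refine ⟨h1.trans ?_, h2.trans ?_, h3.trans ?_, h4.trans ?_, h6, h7⟩
    · rw [mul_div_assoc]; linarith
    · linarith
    · rw [mul_div_assoc]; linarith
    · rw [mul_div_assoc]; linarith

lemma good_bound (a b : ℝ) (T P N τ : ℕ) (hp : Par a b T P N τ) (x0 lam : ℝ) (hl0 : 0 ≤ lam)
    (hl1 : lam ≤ 1) (R : ℕ) (hR : 1 ≤ R) (hRP : R ≤ P)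
    (A A' D : ℝ) (hA : (P:ℝ) ^ 2 ≤ A) (hAA : A ≤ A') (hA' : A' ≤ (P:ℝ) ^ 2 * T) (hD1 : 1 ≤ D)
    (hD : D ≤ 4 * T ^ 2) (h h' : ℕ) (hh : 1 ≤ h) (hh' : 1 ≤ h') (hhT : h ≤ T) (hhT' : h' ≤ T)
    (V : Finset ((ℤ × ℤ) × (ℤ × ℤ))) (hV : ∀ v ∈ V, VCond P R A A' D v)
    (Γ : Finset (ℤ × ℤ)) (hΓ : ∀ γ ∈ Γ, SCond P R x0 lam γ) (z2 : ℤ × ℤ → ℝ) :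
    (((V ×ˢ Γ).filter fun x : ((ℤ × ℤ) × (ℤ × ℤ)) × (ℤ × ℤ) =>
      dn (x.1.1.1 * (a * x.2.1 + b * x.2.2) + x.1.1.2 * z2 x.2) ≤ 1 / (8 * h) ∧
      dn (x.1.2.1 * (a * x.2.1 + b * x.2.2) + x.1.2.2 * z2 x.2) ≤ 1 / (8 * h')).card : ℝ) ≤
      4 * (3072000 * (A * A' * D) * (2 * R * lam + 3) / P) / (h * h') +
      15360000 * (A * A' * D) / T ^ 4 := by
  have hp' := hp
  obtain ⟨hT, hP, hTP, hbig, hnu⟩ := hp'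
  have hT1 : 1 ≤ T := by rw [hT]; exact Nat.one_le_two_pow
  have hP1 : 1 ≤ P := by rw [hP]; exact Nat.one_le_two_pow
  have hTr : (1:ℝ) ≤ T := by exact_mod_cast hT1
  have hPr : (1:ℝ) ≤ P := by exact_mod_cast hP1
  have hRr : (1:ℝ) ≤ R := by exact_mod_cast hR
  have hhr : (1:ℝ) ≤ h := by exact_mod_cast hh
  have hhr' : (1:ℝ) ≤ h' := by exact_mod_cast hh'
  have hRPr : (R:ℝ) ≤ P := by exact_mod_cast hRP
  have hTPr : (T:ℝ) ^ 60 ≤ P := by exact_mod_cast hTP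
  have hPA : (P:ℝ) ≤ A := by nlinarith
  have hU : (P:ℝ) ^ 4 ≤ A * A' * D := by
    have h1 : (P:ℝ) ^ 2 * P ^ 2 ≤ A * A' := mul_le_mul hA (hA.trans hAA) (by positivity) (by linarith)
    have h2 : 0 ≤ A * A' := le_trans (by positivity) h1
    nlinarith
  have hU0 : 0 ≤ A * A' * D := le_trans (by positivity) hU
  have hVc := V_count V P R A A' D hD1 hRr hRPr hPA hAA hV
  have hΓc := S_count Γ P R x0 lam hl0 hΓ
  have hXc : (((V ×ˢ Γ).card : ℕ) : ℝ) ≤ 3072000 * (A * A' * D) * (2 * R * lam + 3) / P := by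
    rw [Finset.card_product]; push_cast
    calc _ ≤ 3072000 * (A * A' * D) / (R * P) * (R * (2 * R * lam + 3)) := by gcongr
      _ = _ := by field_simp
  rcases le_or_gt P (R * T ^ 4) with hc | hc
  · have hf := fejer_count (V ×ˢ Γ) (fun x => x.1.1.1 * (a * x.2.1 + b * x.2.2) + x.1.1.2 * z2 x.2)
      (fun x => x.1.2.1 * (a * x.2.1 + b * x.2.2) + x.1.2.2 * z2 x.2) h h' hh hh'
      (8640 * (P:ℝ) ^ 4 / T ^ 14) (by positivity) ?_
    · refine hf.trans ?_
      have e1 : 8640 * (P:ℝ) ^ 4 / T ^ 14 ≤ 8640 * (A * A' * D) / T ^ 4 := by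
        have : (T:ℝ) ^ 4 ≤ T ^ 14 := pow_le_pow_right₀ hTr (by norm_num)
        gcongr
      have e2 : (((V ×ˢ Γ).card : ℕ) : ℝ) / (h * h') ≤
          3072000 * (A * A' * D) * (2 * R * lam + 3) / P / (h * h') := by gcongr
      have e3 : 0 ≤ (A * A' * D) / (T:ℝ) ^ 4 := by positivity
      have e4 : 8640 * (A * A' * D) / (T:ℝ) ^ 4 = 8640 * ((A * A' * D) / (T:ℝ) ^ 4) := by ring
      have e5 : 15360000 * (A * A' * D) / (T:ℝ) ^ 4 = 15360000 * ((A * A' * D) / (T:ℝ) ^ 4) := by ring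
      rw [e4] at e1
      rw [e5, mul_div_assoc 4 (3072000 * (A * A' * D) * (2 * R * lam + 3) / P)]
      linarith
    · intro m m' hm hm' hne
      exact err_bound a b T P N τ hp x0 lam hl0 hl1 R hR hRP hc A A' D hA hAA hA' hD1 hD V hV Γ hΓ z2
        m m' (by omega) (by omega) hne
  · have hcr : (R:ℝ) * T ^ 4 ≤ P := by exact_mod_cast hc.le
    refine le_trans (by exact_mod_cast Finset.card_filter_le _ _) (hXc.trans ?_)
    have e1 : (2 * R * lam + 3) / P ≤ 5 / (T:ℝ) ^ 4 := by
      rw [div_le_div_iff₀ (by positivity) (by positivity)]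
      have : (T:ℝ) ^ 4 ≤ P := (pow_le_pow_right₀ hTr (by norm_num : 4 ≤ 60)).trans hTPr
      have : (R:ℝ) * T ^ 4 * lam ≤ P * 1 := by gcongr
      nlinarith
    have e2 : 0 ≤ 4 * (3072000 * (A * A' * D) * (2 * R * lam + 3) / P) / (h * h') := by positivity
    have e3 : 3072000 * (A * A' * D) * (2 * R * lam + 3) / P ≤ 15360000 * (A * A' * D) / (T:ℝ) ^ 4 := by
      calc _ = 3072000 * (A * A' * D) * ((2 * R * lam + 3) / P) := by ring
        _ ≤ 3072000 * (A * A' * D) * (5 / (T:ℝ) ^ 4) := by gcongr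
        _ = _ := by ring
    linarith



def WCond (a b x0 lam A : ℝ) (h : ℕ) (w : ℤ × ℤ) : Prop :=
  A < 4096 * w.2 ∧ (w.2:ℝ) ≤ A ∧ x0 * w.2 ≤ w.1 ∧ (w.1:ℝ) ≤ (x0 + lam) * w.2 ∧
    dn (a * w.1 + b * w.2) ≤ 1 / (8 * h)

lemma exists_bz : ∃ bz : ℤ × ℤ → ℤ × ℤ, ∀ γ : ℤ × ℤ, 1 ≤ γ.2 → IsCoprime γ.1 γ.2 →
    γ.1 * (bz γ).2 - γ.2 * (bz γ).1 = 1 ∧ |(bz γ).2| ≤ γ.2 := by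
  have : ∀ γ : ℤ × ℤ, ∃ β : ℤ × ℤ, 1 ≤ γ.2 → IsCoprime γ.1 γ.2 →
    γ.1 * β.2 - γ.2 * β.1 = 1 ∧ |β.2| ≤ γ.2 := by
    intro γ
    by_cases h : 1 ≤ γ.2 ∧ IsCoprime γ.1 γ.2
    · obtain ⟨h1, u, v, huv⟩ := h
      refine ⟨(-v - γ.1 * (u / γ.2), u % γ.2), fun _ _ => ⟨?_, ?_⟩⟩
      · simp only
        have := Int.emod_add_mul_ediv u γ.2
        linear_combination huv + γ.1 * this
      · simp only
        rw [abs_of_nonneg (Int.emod_nonneg _ (by omega))]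
        exact (Int.emod_lt_of_pos _ (by omega)).le
    · refine ⟨0, fun h1 h2 => absurd ⟨h1, h2⟩ h⟩
  choose bz hbz using this
  exact ⟨bz, hbz⟩

lemma pe_aux1 (q q' c2 n d2 z P D : ℝ) (hq : 0 < q) (hq' : 0 < q') (hn : 0 < n)
    (hc : |c2| ≤ q / P) (hz : |z| ≤ D) (e1 : q * d2 = q' * c2 + n * z) :
    q * |d2| ≤ q' * (q / P) + n * D := by
  calc q * |d2| = |q * d2| := by rw [abs_mul, abs_of_pos hq]
    _ ≤ |q' * c2| + |n * z| := by rw [e1]; exact abs_add_le _ _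
    _ = q' * |c2| + n * |z| := by
        rw [abs_mul, abs_mul, abs_of_pos hq', abs_of_pos hn]
    _ ≤ _ := by gcongr

lemma pe_aux2 (n D q A A' P : ℝ) (hP : 1 ≤ P) (hn : n ≤ P) (hD1 : 1 ≤ D) (hDP : 4096 * D ≤ P)
    (hA : P ^ 2 ≤ A) (hAA : A ≤ A') (a1 : A < 4096 * q) : n * D ≤ q * (A' / P) := by
  have hP0 : 0 < P := by linarith
  have hA0 : 0 < A := lt_of_lt_of_le (by positivity) hA
  have f1 : n * D ≤ P * D := by gcongr
  have f2 : 4096 * (P * D) ≤ P * P := by nlinarith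
  have f3 : P ≤ A' / P := by
    rw [le_div_iff₀ (by positivity), ← sq]; linarith
  have f4 : A * P ≤ 4096 * q * (A' / P) :=
    mul_le_mul a1.le f3 hP0.le (by linarith)
  have f5 : P * P ≤ A * P := by
    have : P ≤ A := by nlinarith
    gcongr
  have f6 : 4096 * q * (A' / P) = 4096 * (q * (A' / P)) := by ring
  linarith

set_option maxHeartbeats 1000000 in
lemma param_exists (a b : ℝ) (T P N τ : ℕ) (hp : Par a b T P N τ) (x0 lam : ℝ) (hl0 : 0 ≤ lam)
    (hx0 : 0 ≤ x0) (hx1 : x0 + lam ≤ 1)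
    (A A' D : ℝ) (hA : (P:ℝ) ^ 2 ≤ A) (hAA : A ≤ A') (hD1 : 1 ≤ D)
    (hD : D ≤ 4 * T ^ 2) (h h' : ℕ) (bz : ℤ × ℤ → ℤ × ℤ)
    (hbz : ∀ γ : ℤ × ℤ, 1 ≤ γ.2 → IsCoprime γ.1 γ.2 →
      γ.1 * (bz γ).2 - γ.2 * (bz γ).1 = 1 ∧ |(bz γ).2| ≤ γ.2)
    (e : (ℤ × ℤ) × (ℤ × ℤ)) (h1 : WCond a b x0 lam A h e.1) (h2 : WCond a b x0 lam A' h' e.2)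
    (h3 : e.1.1 * e.2.2 - e.1.2 * e.2.1 ≠ 0)
    (h4 : |((e.1.1 * e.2.2 - e.1.2 * e.2.1 : ℤ):ℝ)| ≤ D) :
    ∃ x : (((ℤ × ℤ) × (ℤ × ℤ)) × (ℤ × ℤ)) × ℕ, x.2 ≤ N ∧
      VCond P ((2 ^ x.2 : ℕ):ℝ) A A' D x.1.1 ∧ SCond P (2 ^ x.2) x0 lam x.1.2 ∧
      e.1 = (x.1.1.1.1 * x.1.2.1 + x.1.1.1.2 * (bz x.1.2).1,
             x.1.1.1.1 * x.1.2.2 + x.1.1.1.2 * (bz x.1.2).2) ∧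
      e.2 = (x.1.1.2.1 * x.1.2.1 + x.1.1.2.2 * (bz x.1.2).1,
             x.1.1.2.1 * x.1.2.2 + x.1.1.2.2 * (bz x.1.2).2) := by
  obtain ⟨hT, hP, hTP, hbig, hnu⟩ := hp
  have hP1 : 1 ≤ P := by rw [hP]; exact Nat.one_le_two_pow
  have hPr : (1:ℝ) ≤ P := by exact_mod_cast hP1
  have hT8 : 8 ≤ T := by omega
  have hT8r : (8:ℝ) ≤ T := by exact_mod_cast hT8
  have hTPr : (T:ℝ) ^ 60 ≤ P := by exact_mod_cast hTP
  have hDP : 4096 * D ≤ (P:ℝ) := by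
    refine le_trans ?_ hTPr
    have e1 : (8:ℝ) ^ 5 ≤ (T:ℝ) ^ 5 := pow_le_pow_left₀ (by norm_num) hT8r 5
    have e2 : (T:ℝ) ^ 7 ≤ T ^ 60 := pow_le_pow_right₀ (by linarith) (by norm_num)
    calc 4096 * D ≤ 4096 * (4 * (T:ℝ) ^ 2) := by gcongr
      _ ≤ (8:ℝ) ^ 5 * T ^ 2 := by have : (0:ℝ) ≤ (T:ℝ) ^ 2 := by positivity
                                  nlinarith
      _ ≤ T ^ 5 * T ^ 2 := by gcongr
      _ = T ^ 7 := by ring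
      _ ≤ _ := e2
  obtain ⟨⟨p, q⟩, ⟨p', q'⟩⟩ := e
  obtain ⟨a1, a2, a3, a4, -⟩ := h1
  obtain ⟨b1, b2, b3, b4, -⟩ := h2
  simp only at a1 a2 a3 a4 b1 b2 b3 b4 h3 h4 ⊢
  have hAp : 0 < A := lt_of_lt_of_le (by positivity) hA
  have hq : (0:ℝ) < q := by linarith
  have hq' : (0:ℝ) < q' := by linarith
  set x : ℝ := p / q with hx
  have hxq : x * q = p := by rw [hx]; field_simp
  have hx0' : x0 ≤ x := by rw [hx, le_div_iff₀ hq]; exact a3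
  have hx1' : x ≤ x0 + lam := by rw [hx, div_le_iff₀ hq]; exact a4
  obtain ⟨ρ, hρ, hden⟩ := Real.exists_rat_abs_sub_le_and_den_le x hP1
  have hco : IsCoprime ρ.num (ρ.den : ℤ) := by
    rw [Int.isCoprime_iff_gcd_eq_one]
    exact ρ.reduced
  have hn1 : 1 ≤ (ρ.den : ℤ) := by exact_mod_cast ρ.den_pos
  set m : ℤ := ρ.num with hm
  set n : ℕ := ρ.den with hn
  have hnr : (0:ℝ) < n := by exact_mod_cast ρ.den_pos
  have hnr1 : (1:ℝ) ≤ n := by exact_mod_cast ρ.den_pos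
  have hρe : (ρ:ℝ) = m / n := by rw [hm, hn]; exact Rat.cast_def ρ
  have hnP : (n:ℝ) ≤ P := by exact_mod_cast hden
  -- |n x - m| ≤ 1/(P+1)
  have hmx : |n * x - m| ≤ 1 / ((P:ℝ) + 1) := by
    rw [hρe] at hρ
    have : n * x - m = n * (x - m / n) := by field_simp
    rw [this, abs_mul, abs_of_pos hnr]
    calc n * |x - m / n| ≤ n * (1 / (((P:ℝ) + 1) * n)) := by gcongr
      _ = _ := by field_simp
  have hsm : 1 / ((P:ℝ) + 1) < 1 := by rw [div_lt_one (by positivity)]; linarith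
  have hsm2 : 1 / ((P:ℝ) + 1) ≤ 1 / P := by gcongr; linarith
  obtain ⟨hmx1, hmx2⟩ := abs_le.mp hmx
  have hxnn : 0 ≤ n * x := by
    have : 0 ≤ x := by linarith
    positivity
  have hxn1 : n * x ≤ n := by
    have : x ≤ 1 := by linarith
    nlinarith
  have hm0 : 0 ≤ m := by
    have : (-1:ℝ) < m := by linarith
    have : (-1:ℤ) < m := by exact_mod_cast this
    omega
  have hmn : m ≤ n := by
    have : (m:ℝ) < n + 1 := by linarith
    have : m < (n:ℤ) + 1 := by exact_mod_cast this
    omega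
  have hmP : m ≤ P := by
    have : (n:ℤ) ≤ P := by exact_mod_cast hden
    omega
  obtain ⟨hdet, hnb⟩ := hbz (m, (n:ℤ)) hn1 hco
  set m' := (bz (m, (n:ℤ))).1 with hm'
  set n' := (bz (m, (n:ℤ))).2 with hn'
  simp only at hdet hnb
  have hnbr : |(n':ℝ)| ≤ n := by exact_mod_cast hnb
  set r := Nat.log 2 n with hr
  set R : ℕ := 2 ^ r with hR
  have hRn : R ≤ n := Nat.pow_log_le_self 2 (by have := ρ.den_pos; omega)
  have hRn2 : n < 2 * R := by
    have := Nat.lt_pow_succ_log_self (b := 2) (by norm_num) n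
    rw [hR, hr]; rw [Nat.succ_eq_add_one, pow_succ] at this; omega
  have hR1 : (1:ℝ) ≤ R := by rw [hR]; exact_mod_cast Nat.one_le_two_pow
  have hRnr : (R:ℝ) ≤ n := by exact_mod_cast hRn
  have hRnr2 : (n:ℝ) ≤ 2 * R := by exact_mod_cast hRn2.le
  have hRP : (R:ℝ) ≤ P := hRnr.trans hnP
  have hrN : r ≤ N := by
    have h5 : n ≤ 2 ^ N := by rw [← hP]; exact hden
    have h6 : 2 ^ r ≤ 2 ^ N := hRn.trans h5
    exact (Nat.pow_le_pow_iff_right (by norm_num)).mp h6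
  -- c's
  set c1 : ℤ := p * n' - q * m' with hc1
  set c2 : ℤ := m * q - n * p with hc2
  set d1 : ℤ := p' * n' - q' * m' with hd1
  set d2 : ℤ := m * q' - n * p' with hd2
  have hep : p = c1 * m + c2 * m' := by rw [hc1, hc2]; linear_combination (-p) * hdet
  have heq : q = c1 * n + c2 * n' := by rw [hc1, hc2]; linear_combination (-q) * hdet
  have hep' : p' = d1 * m + d2 * m' := by rw [hd1, hd2]; linear_combination (-p') * hdet
  have heq' : q' = d1 * n + d2 * n' := by rw [hd1, hd2]; linear_combination (-q') * hdet
  have hcross : c1 * d2 - c2 * d1 = p * q' - q * p' := by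
    rw [hc1, hc2, hd1, hd2]; linear_combination (p * q' - q * p') * hdet
  have hc2b : |(c2:ℝ)| ≤ q / P := by
    have : (c2:ℝ) = -(q * (n * x - m)) := by
      rw [hc2]; push_cast; rw [← hxq]; ring
    rw [this, abs_neg, abs_mul, abs_of_pos hq]
    calc q * |n * x - m| ≤ q * (1 / P) := by gcongr; exact hmx.trans hsm2
      _ = _ := by ring
  have hc1b : |(c1:ℝ)| * n ≤ q + |(c2:ℝ)| * n := by
    have e1 : (c1:ℝ) * n = q - c2 * n' := by
      have : (q:ℝ) = c1 * n + c2 * n' := by exact_mod_cast heq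
      linarith
    calc |(c1:ℝ)| * n = |(c1:ℝ) * n| := by rw [abs_mul, abs_of_pos hnr]
      _ = |(q:ℝ) - (c2:ℝ) * (n':ℝ)| := by rw [e1]
      _ ≤ |(q:ℝ)| + |(c2:ℝ) * n'| := abs_sub _ _
      _ ≤ q + |(c2:ℝ)| * n := by rw [abs_of_pos hq, abs_mul]; gcongr
  have hd1b : |(d1:ℝ)| * n ≤ q' + |(d2:ℝ)| * n := by
    have e1 : (d1:ℝ) * n = q' - d2 * n' := by
      have : (q':ℝ) = d1 * n + d2 * n' := by exact_mod_cast heq'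
      linarith
    calc |(d1:ℝ)| * n = |(d1:ℝ) * n| := by rw [abs_mul, abs_of_pos hnr]
      _ = |(q':ℝ) - (d2:ℝ) * (n':ℝ)| := by rw [e1]
      _ ≤ |(q':ℝ)| + |(d2:ℝ) * n'| := abs_sub _ _
      _ ≤ q' + |(d2:ℝ)| * n := by rw [abs_of_pos hq', abs_mul]; gcongr
  have hd2b : |(d2:ℝ)| ≤ 2 * A' / P := by
    have e1 : (q:ℝ) * d2 = q' * c2 + n * ((p * q' - q * p' : ℤ):ℝ) := by
      rw [hd2, hc2]; push_cast; ring
    have e2 : (q:ℝ) * |(d2:ℝ)| ≤ q' * (q / P) + n * D :=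
      pe_aux1 _ _ _ _ _ _ _ _ hq hq' hnr hc2b h4 e1
    have e3 : n * D ≤ q * (A' / P) := pe_aux2 _ _ _ A _ _ hPr hnP hD1 hDP hA hAA a1
    have e4 : (q':ℝ) * (q / P) ≤ q * (A' / P) := by
      calc (q':ℝ) * (q / P) = q * (q' / P) := by ring
        _ ≤ _ := by gcongr
    have e5 : (q:ℝ) * |(d2:ℝ)| ≤ q * (2 * A' / P) := by
      have : q * (2 * A' / P) = q * (A' / P) + q * (A' / P) := by ring
      linarith
    exact le_of_mul_le_mul_left e5 hq
  refine ⟨(((((c1, c2), (d1, d2))), (m, (n:ℤ))), r), hrN, ⟨?_, ?_, ?_, ?_, ?_, ?_, ?_⟩,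
    ⟨?_, ?_, ?_, ?_, ?_, ?_, ?_⟩, ?_, ?_⟩
  · simp only
    rw [← hR, le_div_iff₀ (by positivity)]
    have g1 : |(c2:ℝ)| * n ≤ q := by
      calc |(c2:ℝ)| * n ≤ q / P * P := by gcongr
        _ = q := by field_simp
    calc |(c1:ℝ)| * R ≤ |(c1:ℝ)| * n := by gcongr
      _ ≤ _ := by linarith
  · simp only
    exact hc2b.trans (by gcongr)
  · simp only
    rw [← hR, le_div_iff₀ (by positivity)]
    have hA'0 : 0 < A' := by linarith
    have g1 : |(d2:ℝ)| * n ≤ 2 * A' := by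
      calc |(d2:ℝ)| * n ≤ 2 * A' / P * P := by gcongr
        _ = 2 * A' := by field_simp
    calc |(d1:ℝ)| * R ≤ |(d1:ℝ)| * n := by gcongr
      _ ≤ _ := by linarith
  · exact hd2b
  · simp only
    rw [← hR, div_le_iff₀ (by positivity)]
    have g1 : (q:ℝ) ≤ (|(c1:ℝ)| + |(c2:ℝ)|) * n := by
      have e1 : (q:ℝ) = c1 * n + c2 * n' := by exact_mod_cast heq
      calc (q:ℝ) ≤ |(c1:ℝ) * n + c2 * n'| := by rw [← e1]; exact le_abs_self _
        _ ≤ |(c1:ℝ) * n| + |(c2:ℝ) * n'| := abs_add_le _ _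
        _ = |(c1:ℝ)| * n + |(c2:ℝ)| * |(n':ℝ)| := by rw [abs_mul, abs_mul, abs_of_pos hnr]
        _ ≤ |(c1:ℝ)| * n + |(c2:ℝ)| * n := by gcongr
        _ = _ := by ring
    have g2 : (|(c1:ℝ)| + |(c2:ℝ)|) * n ≤ (|(c1:ℝ)| + |(c2:ℝ)|) * (2 * R) := by gcongr
    linarith
  · simp only; rw [hcross]; exact h3
  · simp only; rw [hcross]; exact h4
  · simp only; exact_mod_cast hRn
  · simp only; exact_mod_cast hRn2
  · simp only; exact_mod_cast hden
  · exact hm0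
  · exact hmP
  · simp only
    push_cast
    have : x0 * n ≤ n * x := by
      rw [mul_comm]; exact mul_le_mul_of_nonneg_left hx0' hnr.le
    linarith
  · simp only
    push_cast
    have : n * x ≤ (x0 + lam) * n := by
      rw [mul_comm]; exact mul_le_mul_of_nonneg_right hx1' hnr.le
    linarith
  · exact Prod.ext hep heq
  · exact Prod.ext hep' heq'

lemma pair_bound_le (a b : ℝ) (T P N τ : ℕ) (hp : Par a b T P N τ) (x0 lam : ℝ) (hl0 : 0 ≤ lam)
    (hx0 : 0 ≤ x0) (hx1 : x0 + lam ≤ 1) (hlT : (N:ℝ) + 1 ≤ lam * T)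
    (A A' D : ℝ) (hA : (P:ℝ) ^ 2 ≤ A) (hAA : A ≤ A') (hA' : A' ≤ (P:ℝ) ^ 2 * T) (hD1 : 1 ≤ D)
    (hD : D ≤ 4 * T ^ 2) (h h' : ℕ) (hh : 1 ≤ h) (hh' : 1 ≤ h') (hhT : h ≤ T) (hhT' : h' ≤ T)
    (E : Finset ((ℤ × ℤ) × (ℤ × ℤ)))
    (hE : ∀ e ∈ E, WCond a b x0 lam A h e.1 ∧ WCond a b x0 lam A' h' e.2 ∧
      e.1.1 * e.2.2 - e.1.2 * e.2.1 ≠ 0 ∧ |((e.1.1 * e.2.2 - e.1.2 * e.2.1 : ℤ):ℝ)| ≤ D) :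
    (E.card : ℝ) ≤ 200000000 * lam * (A * A' * D) / (h * h') := by
  obtain ⟨bz, hbz⟩ := exists_bz
  have hp' := hp
  obtain ⟨hT, hP, hTP, hbig, hnu⟩ := hp'
  have hT1 : 1 ≤ T := by omega
  have hP1 : 1 ≤ P := by rw [hP]; exact Nat.one_le_two_pow
  have hTr : (1:ℝ) ≤ T := by exact_mod_cast hT1
  have hPr : (1:ℝ) ≤ P := by exact_mod_cast hP1
  have hTPr : (T:ℝ) ^ 60 ≤ P := by exact_mod_cast hTP
  have hhr : (1:ℝ) ≤ h := by exact_mod_cast hh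
  have hhr' : (1:ℝ) ≤ h' := by exact_mod_cast hh'
  have hhTr : (h:ℝ) ≤ T := by exact_mod_cast hhT
  have hhTr' : (h':ℝ) ≤ T := by exact_mod_cast hhT'
  have hP2 : (0:ℝ) < (P:ℝ) ^ 2 := by positivity
  have hU0 : 0 ≤ A * A' * D := by
    have : 0 ≤ A := by linarith
    have : 0 ≤ A' := by linarith
    have : 0 ≤ D := by linarith
    positivity
  have hex : ∀ e : (ℤ × ℤ) × (ℤ × ℤ), ∃ x : (((ℤ × ℤ) × (ℤ × ℤ)) × (ℤ × ℤ)) × ℕ, e ∈ E → x.2 ≤ N ∧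
      VCond P ((2 ^ x.2 : ℕ):ℝ) A A' D x.1.1 ∧ SCond P (2 ^ x.2) x0 lam x.1.2 ∧
      e.1 = (x.1.1.1.1 * x.1.2.1 + x.1.1.1.2 * (bz x.1.2).1,
             x.1.1.1.1 * x.1.2.2 + x.1.1.1.2 * (bz x.1.2).2) ∧
      e.2 = (x.1.1.2.1 * x.1.2.1 + x.1.1.2.2 * (bz x.1.2).1,
             x.1.1.2.1 * x.1.2.2 + x.1.1.2.2 * (bz x.1.2).2) := by
    intro e
    by_cases he : e ∈ E
    · obtain ⟨k1, k2, k3, k4⟩ := hE e he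
      obtain ⟨x, hx⟩ := param_exists a b T P N τ hp x0 lam hl0 hx0 hx1 A A' D hA hAA hD1 hD h h' bz hbz e
        k1 k2 k3 k4
      exact ⟨x, fun _ => hx⟩
    · exact ⟨default, fun h => absurd h he⟩
  choose f hf using hex
  have hmaps : ∀ e ∈ E, (f e).2 ∈ Finset.range (N + 1) := by
    intro e he
    rw [Finset.mem_range]
    have := (hf e he).1
    omega
  rw [Finset.card_eq_sum_card_fiberwise hmaps]
  push_cast
  have hblock : ∀ r ∈ Finset.range (N + 1), ((E.filter fun e => (f e).2 = r).card : ℝ) ≤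
      4 * (3072000 * (A * A' * D) * (2 * ((2 ^ r : ℕ):ℝ) * lam + 3) / P) / (h * h') +
      15360000 * (A * A' * D) / T ^ 4 := by
    intro r hr
    rw [Finset.mem_range] at hr
    set Er := E.filter fun e => (f e).2 = r with hEr
    set V := Er.image fun e => (f e).1.1 with hV
    set Γ := Er.image fun e => (f e).1.2 with hΓ
    refine le_trans ?_ (good_bound a b T P N τ hp x0 lam hl0 (by linarith) (2 ^ r) Nat.one_le_two_pow ?_
      A A' D hA hAA hA' hD1 hD h h' hh hh' hhT hhT' V ?_ Γ ?_ (fun γ => a * (bz γ).1 + b * (bz γ).2))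
    · refine Nat.cast_le.mpr ?_
      refine Finset.card_le_card_of_injOn (fun e => (f e).1) ?_ ?_
      · intro e he
        rw [Finset.mem_coe] at he
        have he' := he
        rw [hEr, Finset.mem_filter] at he'
        obtain ⟨k1, k2, -, -⟩ := hE e he'.1
        obtain ⟨-, -, -, g1, g2⟩ := hf e he'.1
        rw [Finset.mem_coe, Finset.mem_filter, Finset.mem_product]
        refine ⟨⟨Finset.mem_image_of_mem _ he, Finset.mem_image_of_mem _ he⟩, ?_, ?_⟩
        · refine le_trans (le_of_eq ?_) k1.2.2.2.2
          rw [g1]; congr 1; push_cast; ring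
        · refine le_trans (le_of_eq ?_) k2.2.2.2.2
          rw [g2]; congr 1; push_cast; ring
      · intro e he e' he' hee
        rw [Finset.mem_coe, hEr, Finset.mem_filter] at he he'
        obtain ⟨-, -, -, g1, g2⟩ := hf e he.1
        obtain ⟨-, -, -, g1', g2'⟩ := hf e' he'.1
        simp only at hee
        rw [hee] at g1 g2
        exact Prod.ext (g1.trans g1'.symm) (g2.trans g2'.symm)
    · rw [hP]; exact Nat.pow_le_pow_right (by norm_num) (by omega)
    · intro v hv
      rw [hV, Finset.mem_image] at hv
      obtain ⟨e, he, rfl⟩ := hv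
      rw [hEr, Finset.mem_filter] at he
      have := (hf e he.1).2.1
      rwa [he.2] at this
    · intro v hv
      rw [hΓ, Finset.mem_image] at hv
      obtain ⟨e, he, rfl⟩ := hv
      rw [hEr, Finset.mem_filter] at he
      have := (hf e he.1).2.2.1
      rwa [he.2] at this
  refine (Finset.sum_le_sum hblock).trans ?_
  set U := A * A' * D with hU
  have hsum2 : ∑ r ∈ Finset.range (N + 1), ((2 ^ r : ℕ):ℝ) ≤ 2 * P := by
    have : ∑ r ∈ Finset.range (N + 1), 2 ^ r ≤ 2 * P := by
      have := Nat.geomSum_eq (m := 2) le_rfl (N + 1)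
      rw [this, hP, pow_succ]; omega
    exact_mod_cast this
  have hsum : ∑ r ∈ Finset.range (N + 1),
      (4 * (3072000 * U * (2 * ((2 ^ r : ℕ):ℝ) * lam + 3) / P) / (h * h') + 15360000 * U / (T:ℝ) ^ 4) =
      12288000 * U / (h * h') / P * (2 * lam * (∑ r ∈ Finset.range (N + 1), ((2 ^ r : ℕ):ℝ)) + 3 * (N + 1))
       + (N + 1) * (15360000 * U / T ^ 4) := by
    rw [Finset.sum_add_distrib, Finset.sum_const, Finset.card_range, nsmul_eq_mul]
    push_cast
    congr 1
    rw [Finset.mul_sum]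
    have : (3 * ((N:ℝ) + 1)) = ∑ r ∈ Finset.range (N + 1), (3:ℝ) := by simp; ring
    rw [this, ← Finset.sum_add_distrib, Finset.mul_sum]
    refine Finset.sum_congr rfl fun r _ => ?_
    ring
  rw [hsum]
  have hTP1 : (T:ℝ) ≤ P := le_trans (by
    calc (T:ℝ) = T ^ 1 := (pow_one _).symm
      _ ≤ T ^ 60 := pow_le_pow_right₀ hTr (by norm_num)) hTPr
  have k1 : 12288000 * U / (h * h') / P * (2 * lam * (∑ r ∈ Finset.range (N + 1), ((2 ^ r : ℕ):ℝ)) + 3 * (N + 1))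
      ≤ 12288000 * U / (h * h') / P * (7 * lam * P) := by
    have : 2 * lam * (∑ r ∈ Finset.range (N + 1), ((2 ^ r : ℕ):ℝ)) + 3 * (N + 1) ≤ 7 * lam * P := by
      have g1 : 2 * lam * (∑ r ∈ Finset.range (N + 1), ((2 ^ r : ℕ):ℝ)) ≤ 2 * lam * (2 * P) := by gcongr
      have g2 : lam * T ≤ lam * P := by gcongr
      linarith
    gcongr
  have k2 : ((N:ℝ) + 1) * (15360000 * U / T ^ 4) ≤ 15360000 * lam * (U / (h * h')) := by
    calc ((N:ℝ) + 1) * (15360000 * U / T ^ 4) ≤ lam * T * (15360000 * U / T ^ 4) := by gcongr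
      _ = 15360000 * lam * (U / T ^ 3) := by field_simp
      _ ≤ 15360000 * lam * (U / (h * h')) := by
        have : (h:ℝ) * h' ≤ T ^ 3 := by
          calc (h:ℝ) * h' ≤ T * T := by gcongr
            _ ≤ T * T * T := by nlinarith
            _ = _ := by ring
        gcongr
  have k3 : 12288000 * U / (h * h') / P * (7 * lam * P) = 86016000 * lam * (U / (h * h')) := by
    field_simp; ring
  have k4 : 0 ≤ lam * (U / (h * h')) := by positivity
  have k5 : 200000000 * lam * U / (h * h') = 200000000 * lam * (U / (h * h')) := by ring
  rw [k5]; nlinarith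

lemma pair_bound (a b : ℝ) (T P N τ : ℕ) (hp : Par a b T P N τ) (x0 lam : ℝ) (hl0 : 0 ≤ lam)
    (hx0 : 0 ≤ x0) (hx1 : x0 + lam ≤ 1) (hlT : (N:ℝ) + 1 ≤ lam * T)
    (A A' D : ℝ) (hA : (P:ℝ) ^ 2 ≤ A) (hA2 : A ≤ (P:ℝ) ^ 2 * T) (hA' : (P:ℝ) ^ 2 ≤ A')
    (hA2' : A' ≤ (P:ℝ) ^ 2 * T) (hD1 : 1 ≤ D)
    (hD : D ≤ 4 * T ^ 2) (h h' : ℕ) (hh : 1 ≤ h) (hh' : 1 ≤ h') (hhT : h ≤ T) (hhT' : h' ≤ T)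
    (E : Finset ((ℤ × ℤ) × (ℤ × ℤ)))
    (hE : ∀ e ∈ E, WCond a b x0 lam A h e.1 ∧ WCond a b x0 lam A' h' e.2 ∧
      e.1.1 * e.2.2 - e.1.2 * e.2.1 ≠ 0 ∧ |((e.1.1 * e.2.2 - e.1.2 * e.2.1 : ℤ):ℝ)| ≤ D) :
    (E.card : ℝ) ≤ 200000000 * lam * (A * A' * D) / (h * h') := by
  rcases le_total A A' with hc | hc
  · exact pair_bound_le a b T P N τ hp x0 lam hl0 hx0 hx1 hlT A A' D hA hc hA2' hD1 hD h h' hh hh' hhT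
      hhT' E hE
  · rw [← Finset.card_image_of_injective E Prod.swap_injective]
    refine (pair_bound_le a b T P N τ hp x0 lam hl0 hx0 hx1 hlT A' A D hA' hc hA2 hD1 hD h' h hh' hh hhT'
      hhT _ ?_).trans (le_of_eq (by ring))
    intro e he
    rw [Finset.mem_image] at he
    obtain ⟨w, hw, rfl⟩ := he
    obtain ⟨h1, h2, h3, h4⟩ := hE w hw
    refine ⟨h2, h1, ?_, ?_⟩
    · simp only [Prod.fst_swap, Prod.snd_swap]
      intro h; apply h3; linarith
    · simp only [Prod.fst_swap, Prod.snd_swap]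
      rw [← abs_neg] at h4
      refine le_trans (le_of_eq ?_) h4
      congr 1; push_cast; ring



def Prim (p q r : ℤ) : Prop := ∀ d : ℤ, d ∣ p → d ∣ q → d ∣ r → IsUnit d

lemma floor_box (x y : ℝ) (M : ℕ) (hM : 1 ≤ M)
    (h : ⌊Int.fract x * M⌋₊ = ⌊Int.fract y * M⌋₊) : |Int.fract x - Int.fract y| ≤ 1 / M := by
  have hMr : (0:ℝ) < M := by exact_mod_cast hM
  have hx := Int.fract_nonneg x
  have hy := Int.fract_nonneg y
  have h1 := Nat.floor_le (show 0 ≤ Int.fract x * M by positivity)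
  have h2 := Nat.lt_floor_add_one (Int.fract x * M)
  have h3 := Nat.floor_le (show 0 ≤ Int.fract y * M by positivity)
  have h4 := Nat.lt_floor_add_one (Int.fract y * M)
  rw [h] at h1 h2
  rw [le_div_iff₀ hMr]
  have : |Int.fract x - Int.fract y| * M = |Int.fract x * M - Int.fract y * M| := by
    rw [← sub_mul, abs_mul, abs_of_pos hMr]
  rw [this, abs_le]
  constructor <;> linarith

lemma floor_mem (x : ℝ) (M : ℕ) (hM : 1 ≤ M) : ⌊Int.fract x * M⌋₊ ∈ Finset.range M := by
  have hMr : (0:ℝ) < M := by exact_mod_cast hM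
  rw [Finset.mem_range, Nat.floor_lt (by have := Int.fract_nonneg x; positivity)]
  have := Int.fract_lt_one x
  nlinarith

lemma dirichlet0 (a b β : ℝ) (H M : ℕ) (hH : 1 ≤ H) (hM : 1 ≤ M) :
    ∃ p q r : ℤ, 1 ≤ q ∧ q ≤ H * M ∧ |q * β - p| ≤ 1 / M ∧ |a * p + b * q - r| ≤ 1 / H := by
  let f : ℕ → ℕ × ℕ := fun q => (⌊Int.fract ((q:ℝ) * β) * M⌋₊,
    ⌊Int.fract (a * (⌊(q:ℝ) * β⌋ : ℤ) + b * q) * H⌋₊)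
  obtain ⟨x, hx, y, hy, hne, hf⟩ := Finset.exists_ne_map_eq_of_card_lt_of_maps_to
    (s := Finset.range (H * M + 1)) (t := Finset.range M ×ˢ Finset.range H) (f := f)
    (by simp; nlinarith) (by
      intro q _
      rw [Finset.mem_coe, Finset.mem_product]
      exact ⟨floor_mem _ _ hM, floor_mem _ _ hH⟩)
  wlog hxy : y < x generalizing x y
  · exact this y hy x hx hne.symm hf.symm (by omega)
  rw [Finset.mem_range] at hx hy
  simp only [f, Prod.mk.injEq] at hf
  have g1 := floor_box _ _ M hM hf.1
  have g2 := floor_box _ _ H hH hf.2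
  refine ⟨⌊(x:ℝ) * β⌋ - ⌊(y:ℝ) * β⌋, (x:ℤ) - y,
    ⌊a * (⌊(x:ℝ) * β⌋ : ℤ) + b * x⌋ - ⌊a * (⌊(y:ℝ) * β⌋ : ℤ) + b * y⌋, by omega, ?_, ?_, ?_⟩
  · have : (x:ℤ) ≤ (H * M : ℕ) := by exact_mod_cast (by omega)
    push_cast at this
    omega
  · refine le_trans (le_of_eq ?_) g1
    congr 1; unfold Int.fract; push_cast; ring
  · refine le_trans (le_of_eq ?_) g2
    congr 1; unfold Int.fract; push_cast; ring

lemma dirichlet_prim (a b β : ℝ) (H M : ℕ) (hH : 1 ≤ H) (hM : 1 ≤ M) :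
    ∃ p q r : ℤ, 1 ≤ q ∧ q ≤ H * M ∧ |q * β - p| ≤ 1 / M ∧ |a * p + b * q - r| ≤ 1 / H ∧
      Prim p q r := by
  obtain ⟨p, q, r, h1, h2, h3, h4⟩ := dirichlet0 a b β H M hH hM
  set g : ℕ := Int.gcd p (Int.gcd q r) with hg
  have hg0 : 0 < g := by
    rw [hg]; refine Int.gcd_pos_of_ne_zero_right _ ?_
    have := Int.gcd_pos_of_ne_zero_left r (show q ≠ 0 by omega)
    omega
  have hgp : (g:ℤ) ∣ p := Int.gcd_dvd_left _ _
  have hgqr : (g:ℤ) ∣ (Int.gcd q r : ℤ) := Int.gcd_dvd_right _ _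
  have hgq : (g:ℤ) ∣ q := hgqr.trans (Int.gcd_dvd_left _ _)
  have hgr : (g:ℤ) ∣ r := hgqr.trans (Int.gcd_dvd_right _ _)
  obtain ⟨p', hp'⟩ := hgp
  obtain ⟨q', hq'⟩ := hgq
  obtain ⟨r', hr'⟩ := hgr
  have hgz : (1:ℤ) ≤ g := by exact_mod_cast hg0
  have hgr1 : (1:ℝ) ≤ g := by exact_mod_cast hg0
  have hq'1 : 1 ≤ q' := by
    by_contra hc
    push Not at hc
    have : q' ≤ 0 := by omega
    have : (g:ℤ) * q' ≤ 0 := by nlinarith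
    omega
  refine ⟨p', q', r', hq'1, ?_, ?_, ?_, ?_⟩
  · have : q' ≤ g * q' := by nlinarith
    omega
  · refine le_trans ?_ h3
    have : (q:ℝ) * β - p = g * (q' * β - p') := by
      rw [hp', hq']; push_cast; ring
    rw [this, abs_mul, abs_of_pos (show (0:ℝ) < g by linarith)]
    have := abs_nonneg (q' * β - p')
    nlinarith
  · refine le_trans ?_ h4
    have : a * p + b * q - r = g * (a * p' + b * q' - r') := by
      rw [hp', hq', hr']; push_cast; ring
    rw [this, abs_mul, abs_of_pos (show (0:ℝ) < g by linarith)]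
    have := abs_nonneg (a * p' + b * q' - r')
    nlinarith
  · intro d d1 d2 d3
    have e1 : (g:ℤ) * d ∣ p := by rw [hp']; exact mul_dvd_mul_left _ d1
    have e2 : (g:ℤ) * d ∣ q := by rw [hq']; exact mul_dvd_mul_left _ d2
    have e3 : (g:ℤ) * d ∣ r := by rw [hr']; exact mul_dvd_mul_left _ d3
    have e4 : (g:ℤ) * d ∣ g := by
      conv_rhs => rw [hg]
      exact Int.dvd_coe_gcd e1 (Int.dvd_coe_gcd e2 e3)
    have e5 : (g:ℤ) * d ∣ g * 1 := by rwa [mul_one]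
    exact isUnit_of_dvd_one (Int.dvd_of_mul_dvd_mul_left (by omega) e5)

lemma cover_le {ι : Type*} (F : Finset ι) (c r : ι → ℝ) (hr : ∀ i ∈ F, 0 ≤ r i) (lo hi : ℝ)
    (h : ∀ x, lo ≤ x → x ≤ hi → ∃ i ∈ F, |x - c i| ≤ r i) : hi - lo ≤ ∑ i ∈ F, 2 * r i := by
  have h1 : Set.Icc lo hi ⊆ ⋃ i ∈ F, Set.Icc (c i - r i) (c i + r i) := by
    intro x hx
    obtain ⟨i, hi, hxi⟩ := h x hx.1 hx.2
    rw [abs_le] at hxi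
    simp only [Set.mem_iUnion]
    exact ⟨i, hi, by constructor <;> linarith⟩
  have h2 := (measure_mono (μ := volume) h1).trans (measure_biUnion_finset_le F _)
  simp only [Real.volume_Icc] at h2
  rw [← ENNReal.ofReal_sum_of_nonneg (by intro i hi; have := hr i hi; linarith)] at h2
  rw [ENNReal.ofReal_le_ofReal_iff (Finset.sum_nonneg (by intro i hi; have := hr i hi; linarith))] at h2
  refine h2.trans (le_of_eq (Finset.sum_congr rfl fun i _ => by ring))

lemma block_count (a b : ℝ) (C0 : ℕ) (δ : ℝ) (hdc : DC a b C0 δ) (P d h : ℕ) (hP : 1 ≤ P)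
    (hd : 1 ≤ d) (hh : 1 ≤ h) (hsm : (h:ℝ) * (h * d : ℝ) ^ C0 ≤ 2 * δ * P)
    (E : Finset (ℤ × ℤ)) (J : Finset (ℤ × ℤ))
    (hE : ∀ v ∈ E, dn (d * (a * v.1 + b * v.2)) ≤ 1 / (8 * h) ∧ (v.1 / P, v.2 / P) ∈ J) :
    (E.card : ℝ) ≤ J.card * (8 * (P:ℝ) ^ 2 / h) := by
  have hδ := hdc.1
  have hhr : (1:ℝ) ≤ h := by exact_mod_cast hh
  have hPr : (1:ℝ) ≤ P := by exact_mod_cast hP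
  refine card_le_fiber E (fun v => (v.1 / (P:ℤ), v.2 / (P:ℤ))) J (fun v hv => (hE v hv).2) _ ?_
  intro y _
  have h1 := box_count a b C0 δ hdc (y.1 * P) (y.2 * P) P d h hd hh
  refine (le_trans ?_ h1).trans ?_
  · refine Nat.cast_le.mpr (Finset.card_le_card ?_)
    intro v hv
    rw [Finset.mem_filter] at hv
    obtain ⟨hv1, hv2⟩ := hv
    rw [Finset.mem_filter, Finset.mem_product, Finset.mem_Ico, Finset.mem_Ico]
    refine ⟨?_, (hE v hv1).1⟩
    have hPz : (0:ℤ) < P := by exact_mod_cast hP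
    rw [← hv2]
    simp only
    have e1 := Int.emod_add_mul_ediv v.1 P
    have e2 := Int.emod_nonneg v.1 hPz.ne'
    have e3 := Int.emod_lt_of_pos v.1 hPz
    have f1 := Int.emod_add_mul_ediv v.2 P
    have f2 := Int.emod_nonneg v.2 hPz.ne'
    have f3 := Int.emod_lt_of_pos v.2 hPz
    have c1 := mul_comm (P:ℤ) (v.1 / P)
    have c2 := mul_comm (P:ℤ) (v.2 / P)
    refine ⟨⟨?_, ?_⟩, ⟨?_, ?_⟩⟩ <;> linarith
  · have : (P:ℝ) * (h * d : ℝ) ^ C0 / (2 * δ) ≤ P ^ 2 / h := by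
      rw [div_le_div_iff₀ (by positivity) (by positivity)]
      nlinarith
    have e : 8 * (P:ℝ) ^ 2 / h = 4 * (P ^ 2 / h + P ^ 2 / h) := by ring
    rw [e]; gcongr

lemma row_count (a b : ℝ) (C0 : ℕ) (δ : ℝ) (hdc : DC a b C0 δ) (P h : ℕ) (hP : 1 ≤ P)
    (hh : 1 ≤ h) (hsm : (h:ℝ) * (h : ℝ) ^ C0 ≤ 2 * δ * P) (x0 lam : ℝ) (hl0 : 0 ≤ lam)
    (hx0 : 0 ≤ x0) (hx1 : x0 + lam ≤ 1) (i : ℕ)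
    (E : Finset (ℤ × ℤ))
    (hE : ∀ v ∈ E, dn (a * v.1 + b * v.2) ≤ 1 / (8 * h) ∧ v.2 / P = i ∧ x0 * v.2 ≤ v.1 ∧
      (v.1:ℝ) ≤ (x0 + lam) * v.2) :
    (E.card : ℝ) ≤ (lam * i + 3) * (8 * (P:ℝ) ^ 2 / h) := by
  have hPr : (1:ℝ) ≤ P := by exact_mod_cast hP
  have hPz : (0:ℤ) < P := by exact_mod_cast hP
  set J := (E.image fun v => v.1 / (P:ℤ)) ×ˢ ({(i:ℤ)} : Finset ℤ) with hJ
  refine (block_count a b C0 δ hdc P 1 h hP le_rfl hh (by simpa using hsm) E J ?_).trans ?_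
  · intro v hv
    refine ⟨by simpa using (hE v hv).1, ?_⟩
    rw [hJ, Finset.mem_product]
    exact ⟨Finset.mem_image_of_mem (fun v : ℤ × ℤ => v.1 / (P:ℤ)) hv,
      by simpa using (hE v hv).2.1⟩
  · gcongr
    rw [hJ, Finset.card_product, Finset.card_singleton, mul_one]
    have := card_ints' (E.image fun v => v.1 / (P:ℤ)) (x0 * i - 1) ((x0 + lam) * i + 1) (by
      have : 0 ≤ lam * i := by positivity
      nlinarith) ?_
    · refine this.trans (le_of_eq (by ring))
    · intro z hz
      rw [Finset.mem_image] at hz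
      obtain ⟨v, hv, rfl⟩ := hz
      obtain ⟨-, h1, h2, h3⟩ := hE v hv
      have e1 := Int.emod_add_mul_ediv v.1 P
      have e2 := Int.emod_nonneg v.1 hPz.ne'
      have e3 := Int.emod_lt_of_pos v.1 hPz
      have f1 := Int.emod_add_mul_ediv v.2 P
      have f2 := Int.emod_nonneg v.2 hPz.ne'
      have f3 := Int.emod_lt_of_pos v.2 hPz
      rw [h1] at f1
      set z := v.1 / (P:ℤ) with hz
      have g1 : (P:ℝ) * i ≤ v.2 := by exact_mod_cast (by omega : (P:ℤ) * i ≤ v.2)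
      have g2 : (v.2:ℝ) ≤ P * i + P := by exact_mod_cast (by omega : v.2 ≤ (P:ℤ) * i + P)
      have g3 : (P:ℝ) * z ≤ v.1 := by exact_mod_cast (by omega : (P:ℤ) * z ≤ v.1)
      have g4 : (v.1:ℝ) ≤ P * z + P := by exact_mod_cast (by omega : v.1 ≤ (P:ℤ) * z + P)
      have hPp : (0:ℝ) < P := by linarith
      constructor
      · have : (P:ℝ) * (x0 * i - 1) ≤ P * z := by nlinarith
        exact le_of_mul_le_mul_left this hPp
      · have k1 : (x0 + lam) * v.2 ≤ (x0 + lam) * (P * i + P) := by gcongr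
        have k2 : (x0 + lam) * P ≤ P := by nlinarith
        have : (P:ℝ) * z ≤ P * ((x0 + lam) * i + 1) := by nlinarith
        exact le_of_mul_le_mul_left this hPp



lemma toNat_aux1 (n : ℕ) : ((n:ℤ) + 1 - 0).toNat = n + 1 := by omega

lemma toNat_aux2 (n : ℕ) : ((n:ℤ) + 1 - 1).toNat = n := by omega

lemma total_count (a b : ℝ) (C0 : ℕ) (δ : ℝ) (hdc : DC a b C0 δ) (P h A : ℕ) (hP : 1 ≤ P)
    (hh : 1 ≤ h) (hsm : (h:ℝ) * (h : ℝ) ^ C0 ≤ 2 * δ * P) (x0 lam : ℝ) (hl0 : 0 ≤ lam)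
    (hx0 : 0 ≤ x0) (hx1 : x0 + lam ≤ 1) (hlP : 3 ≤ lam * P) (hPA : P ^ 2 ≤ A)
    (E : Finset (ℤ × ℤ))
    (hE : ∀ v ∈ E, dn (a * v.1 + b * v.2) ≤ 1 / (8 * h) ∧ 0 ≤ v.2 ∧ v.2 ≤ A ∧ x0 * v.2 ≤ v.1 ∧
      (v.1:ℝ) ≤ (x0 + lam) * v.2) :
    (E.card : ℝ) ≤ 32 * lam * A ^ 2 / h := by
  have hPr : (1:ℝ) ≤ P := by exact_mod_cast hP
  have hhr : (1:ℝ) ≤ h := by exact_mod_cast hh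
  have hPAr : (P:ℝ) ^ 2 ≤ A := by exact_mod_cast hPA
  have hPp : (0:ℝ) < P := by linarith
  set B : ℝ := (A:ℝ) / P with hB
  have hPB : (P:ℝ) ≤ B := by rw [hB, le_div_iff₀ hPp]; linarith [sq (P:ℝ)]
  have hdivB : ((A / P : ℕ):ℝ) ≤ B := Nat.cast_div_le
  have h1 := card_le_fiber E (fun v => (v.2 / (P:ℤ)).toNat) (Finset.range (A / P + 1)) ?_
    (2 * lam * B * (8 * (P:ℝ) ^ 2 / h)) ?_
  · refine h1.trans ?_
    rw [Finset.card_range]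
    push_cast
    calc (((A / P : ℕ):ℝ) + 1) * (2 * lam * B * (8 * (P:ℝ) ^ 2 / h))
        ≤ (2 * B) * (2 * lam * B * (8 * (P:ℝ) ^ 2 / h)) := by
          have : 0 ≤ B := by linarith
          gcongr; linarith
      _ = 32 * lam * (B * P) ^ 2 / h := by ring
      _ = _ := by rw [hB]; field_simp
  · intro v hv
    obtain ⟨-, h2, h3, -, -⟩ := hE v hv
    rw [Finset.mem_range]
    have h4 : v.2 / (P:ℤ) ≤ (A:ℤ) / P := Int.ediv_le_ediv (by exact_mod_cast hP) h3
    have h5 : ((A / P : ℕ):ℤ) = (A:ℤ) / P := by push_cast; rfl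
    exact Nat.lt_succ_of_le (Int.toNat_le.mpr (h4.trans h5.ge))
  · intro i hi
    rw [Finset.mem_range] at hi
    have hiB : (i:ℝ) ≤ B := le_trans (by exact_mod_cast (by omega : i ≤ A / P)) hdivB
    refine (row_count a b C0 δ hdc P h hP hh hsm x0 lam hl0 hx0 hx1 i _ ?_).trans ?_
    · intro v hv
      rw [Finset.mem_filter] at hv
      obtain ⟨k1, h2, h3, k4, k5⟩ := hE v hv.1
      refine ⟨k1, ?_, k4, k5⟩
      have : 0 ≤ v.2 / (P:ℤ) := Int.ediv_nonneg h2 (by positivity)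
      have := hv.2
      omega
    · have e1 : lam * i ≤ lam * B := by gcongr
      have e2 : lam * P ≤ lam * B := by gcongr
      gcongr
      linarith

lemma gcd_fiber (a b : ℝ) (d : ℕ) (hd : 1 ≤ d) (A h : ℕ) (E : Finset (ℤ × ℤ))
    (hE : ∀ v ∈ E, dn (a * v.1 + b * v.2) ≤ 1 / (8 * h) ∧ 0 ≤ v.1 ∧ v.1 ≤ v.2 ∧ 1 ≤ v.2 ∧ v.2 ≤ A ∧
      Int.gcd v.1 v.2 = d) :
    ∃ E' : Finset (ℤ × ℤ), E.card = E'.card ∧ ∀ v ∈ E', dn (d * (a * v.1 + b * v.2)) ≤ 1 / (8 * h) ∧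
      0 ≤ v.1 ∧ 1 ≤ v.2 ∧ v.1 ≤ (A / d : ℕ) ∧ v.2 ≤ (A / d : ℕ) := by
  have hdz : (0:ℤ) < d := by exact_mod_cast hd
  refine ⟨E.image fun v => (v.1 / (d:ℤ), v.2 / (d:ℤ)), ?_, ?_⟩
  · rw [Finset.card_image_of_injOn]
    intro v hv w hw hvw
    obtain ⟨-, -, -, -, -, hg⟩ := hE v hv
    obtain ⟨-, -, -, -, -, hg'⟩ := hE w hw
    have h1 : (d:ℤ) ∣ v.1 := by rw [← hg]; exact Int.gcd_dvd_left _ _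
    have h2 : (d:ℤ) ∣ v.2 := by rw [← hg]; exact Int.gcd_dvd_right _ _
    have h3 : (d:ℤ) ∣ w.1 := by rw [← hg']; exact Int.gcd_dvd_left _ _
    have h4 : (d:ℤ) ∣ w.2 := by rw [← hg']; exact Int.gcd_dvd_right _ _
    simp only [Prod.mk.injEq] at hvw
    refine Prod.ext ?_ ?_
    · rw [← Int.ediv_mul_cancel h1, ← Int.ediv_mul_cancel h3, hvw.1]
    · rw [← Int.ediv_mul_cancel h2, ← Int.ediv_mul_cancel h4, hvw.2]
  · intro u hu
    rw [Finset.mem_image] at hu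
    obtain ⟨v, hv, rfl⟩ := hu
    obtain ⟨k1, k2, k3, k4, k5, hg⟩ := hE v hv
    have h1 : (d:ℤ) ∣ v.1 := by rw [← hg]; exact Int.gcd_dvd_left _ _
    have h2 : (d:ℤ) ∣ v.2 := by rw [← hg]; exact Int.gcd_dvd_right _ _
    have e1 := Int.ediv_mul_cancel h1
    have e2 := Int.ediv_mul_cancel h2
    have e5 : ((A / d : ℕ):ℤ) = (A:ℤ) / d := by push_cast; rfl
    simp only
    refine ⟨?_, Int.ediv_nonneg k2 hdz.le, ?_, ?_, ?_⟩
    · refine le_trans (le_of_eq ?_) k1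
      congr 1
      have f1 : (v.1:ℝ) = ((v.1 / (d:ℤ) : ℤ):ℝ) * d := by exact_mod_cast e1.symm
      have f2 : (v.2:ℝ) = ((v.2 / (d:ℤ) : ℤ):ℝ) * d := by exact_mod_cast e2.symm
      rw [f1, f2]; ring
    · by_contra hc
      push Not at hc
      have : v.2 / (d:ℤ) ≤ 0 := by omega
      nlinarith
    · rw [e5]; exact Int.ediv_le_ediv hdz (by omega)
    · rw [e5]; exact Int.ediv_le_ediv hdz (by omega)

lemma gcd_count (a b : ℝ) (C0 : ℕ) (δ : ℝ) (hdc : DC a b C0 δ) (P h A T Y : ℕ) (hP : 1 ≤ P)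
    (hh : 1 ≤ h) (hhT : h ≤ T) (hY : 1 ≤ Y) (hYT : Y ≤ T) (hTP : T ^ 3 ≤ P)
    (hsm : (T:ℝ) ^ (3 * C0 + 1) ≤ 2 * δ * P) (hPA : P ^ 2 ≤ A)
    (E : Finset (ℤ × ℤ))
    (hE : ∀ v ∈ E, dn (a * v.1 + b * v.2) ≤ 1 / (8 * h) ∧ 0 ≤ v.1 ∧ v.1 ≤ v.2 ∧ 1 ≤ v.2 ∧ v.2 ≤ A ∧
      Y < Int.gcd v.1 v.2) :
    (E.card : ℝ) ≤ 32 * A ^ 2 / (h * Y) + 2 * A ^ 2 / T ^ 2 := by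
  have hPr : (1:ℝ) ≤ P := by exact_mod_cast hP
  have hhr : (1:ℝ) ≤ h := by exact_mod_cast hh
  have hT1 : 1 ≤ T := by omega
  have hTr : (1:ℝ) ≤ T := by exact_mod_cast hT1
  have hhTr : (h:ℝ) ≤ T := by exact_mod_cast hhT
  have hPAr : (P:ℝ) ^ 2 ≤ A := by exact_mod_cast hPA
  have hPp : (0:ℝ) < P := by linarith
  have hT2P : T ^ 2 ≤ P := le_trans (Nat.pow_le_pow_right hT1 (by norm_num)) hTP
  have hT2Pr : (T:ℝ) ^ 2 ≤ P := by exact_mod_cast hT2P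
  have hYT2 : Y ≤ T ^ 2 := by nlinarith
  have hT2A : T ^ 2 ≤ A := by nlinarith
  have hmaps : ∀ v ∈ E, Int.gcd v.1 v.2 ∈ Finset.Ioc Y A := by
    intro v hv
    obtain ⟨-, -, -, k4, k5, k6⟩ := hE v hv
    rw [Finset.mem_Ioc]
    refine ⟨k6, ?_⟩
    have : (Int.gcd v.1 v.2 : ℤ) ≤ v.2 := Int.le_of_dvd (by omega) (Int.gcd_dvd_right _ _)
    omega
  rw [Finset.card_eq_sum_card_fiberwise hmaps]
  push_cast
  rw [← Finset.sum_Ioc_consecutive _ hYT2 hT2A]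
  refine add_le_add ?_ ?_
  · calc _ ≤ ∑ d ∈ Finset.Ioc Y (T ^ 2), 32 * (A:ℝ) ^ 2 / h * ((d:ℝ) ^ 2)⁻¹ := by
          refine Finset.sum_le_sum fun d hd => ?_
          rw [Finset.mem_Ioc] at hd
          have hd1 : 1 ≤ d := by omega
          have hdr : (1:ℝ) ≤ d := by exact_mod_cast hd1
          have hdT : (d:ℝ) ≤ T ^ 2 := by exact_mod_cast hd.2
          obtain ⟨E', hc, hE'⟩ := gcd_fiber a b d hd1 A h (E.filter fun v => Int.gcd v.1 v.2 = d) (by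
            intro v hv
            rw [Finset.mem_filter] at hv
            obtain ⟨k1, k2, k3, k4, k5, k6⟩ := hE v hv.1
            exact ⟨k1, k2, k3, k4, k5, hv.2⟩)
          rw [hc]
          set Z : ℕ := A / d / P with hZ
          have hb := block_count a b C0 δ hdc P d h hP hd1 hh ?_ E'
            (Finset.Icc (0:ℤ) Z ×ˢ Finset.Icc (0:ℤ) Z) ?_
          · refine hb.trans ?_
            have hcard : (((Finset.Icc (0:ℤ) Z ×ˢ Finset.Icc (0:ℤ) Z).card : ℕ):ℝ) = ((Z:ℝ) + 1) ^ 2 := by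
              rw [Finset.card_product, Int.card_Icc]
              have := toNat_aux1 Z
              rw [this]; push_cast; ring
            rw [hcard]
            set B : ℝ := (A:ℝ) / (d * P) with hB
            have hB1 : 1 ≤ B := by
              rw [hB, le_div_iff₀ (by positivity), one_mul]
              calc (d:ℝ) * P ≤ P * P := by gcongr; linarith
                _ ≤ A := by linarith [sq (P:ℝ)]
            have hZB : (Z:ℝ) ≤ B := by
              rw [hZ, hB, Nat.div_div_eq_div_mul]
              refine Nat.cast_div_le.trans (le_of_eq ?_)
              push_cast; rfl
            calc ((Z:ℝ) + 1) ^ 2 * (8 * (P:ℝ) ^ 2 / h) ≤ (2 * B) ^ 2 * (8 * (P:ℝ) ^ 2 / h) := by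
                  gcongr; linarith
              _ = 32 * (A:ℝ) ^ 2 / h * ((d:ℝ) ^ 2)⁻¹ := by rw [hB]; field_simp; ring
          · refine le_trans ?_ hsm
            calc (h:ℝ) * (h * d) ^ C0 ≤ T * (T * T ^ 2) ^ C0 := by gcongr
              _ = T ^ (3 * C0 + 1) := by
                rw [show (T:ℝ) * T ^ 2 = T ^ 3 by ring, ← pow_mul]; ring
          · intro v hv
            obtain ⟨k1, k2, k3, k4, k5⟩ := hE' v hv
            refine ⟨k1, ?_⟩
            have hPz : (0:ℤ) < P := by exact_mod_cast hP
            have hZz : (Z:ℤ) = ((A / d : ℕ):ℤ) / P := by rw [hZ]; push_cast; rfl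
            rw [Finset.mem_product, Finset.mem_Icc, Finset.mem_Icc, hZz]
            exact ⟨⟨Int.ediv_nonneg k2 hPz.le, Int.ediv_le_ediv hPz k4⟩,
              ⟨Int.ediv_nonneg (by omega) hPz.le, Int.ediv_le_ediv hPz k5⟩⟩
      _ = 32 * (A:ℝ) ^ 2 / h * ∑ d ∈ Finset.Ioc Y (T ^ 2), ((d:ℝ) ^ 2)⁻¹ := by rw [Finset.mul_sum]
      _ ≤ 32 * (A:ℝ) ^ 2 / h * ((Y:ℝ)⁻¹ - ((T ^ 2 : ℕ):ℝ)⁻¹) := by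
          gcongr; exact sum_Ioc_inv_sq_le_sub (by omega) hYT2
      _ ≤ 32 * (A:ℝ) ^ 2 / h * (Y:ℝ)⁻¹ := by
          gcongr
          have : (0:ℝ) ≤ ((T ^ 2 : ℕ):ℝ)⁻¹ := by positivity
          linarith
      _ = _ := by rw [← div_div]; rfl
  · calc _ ≤ ∑ d ∈ Finset.Ioc (T ^ 2) A, 2 * (A:ℝ) ^ 2 * ((d:ℝ) ^ 2)⁻¹ := by
          refine Finset.sum_le_sum fun d hd => ?_
          rw [Finset.mem_Ioc] at hd
          have hd1 : 1 ≤ d := by omega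
          have hdr : (1:ℝ) ≤ d := by exact_mod_cast hd1
          obtain ⟨E', hc, hE'⟩ := gcd_fiber a b d hd1 A h (E.filter fun v => Int.gcd v.1 v.2 = d) (by
            intro v hv
            rw [Finset.mem_filter] at hv
            obtain ⟨k1, k2, k3, k4, k5, k6⟩ := hE v hv.1
            exact ⟨k1, k2, k3, k4, k5, hv.2⟩)
          rw [hc]
          set n : ℕ := A / d with hn
          have hsub : E' ⊆ Finset.Icc (0:ℤ) n ×ˢ Finset.Icc (1:ℤ) n := by
            intro v hv
            obtain ⟨k1, k2, k3, k4, k5⟩ := hE' v hv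
            rw [Finset.mem_product, Finset.mem_Icc, Finset.mem_Icc]
            exact ⟨⟨k2, k4⟩, ⟨k3, k5⟩⟩
          have h5 := Finset.card_le_card hsub
          rw [Finset.card_product, Int.card_Icc, Int.card_Icc] at h5
          have e1 := toNat_aux1 n
          have e2 := toNat_aux2 n
          rw [e1, e2] at h5
          have h6 : (n + 1) * n ≤ 2 * n ^ 2 := by
            rcases Nat.eq_zero_or_pos n with h0 | h0
            · simp [h0]
            · nlinarith
          have h7 : (E'.card:ℝ) ≤ 2 * (n:ℝ) ^ 2 := by exact_mod_cast h5.trans h6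
          have h8 : (n:ℝ) ≤ A / d := Nat.cast_div_le
          calc (E'.card:ℝ) ≤ 2 * (n:ℝ) ^ 2 := h7
            _ ≤ 2 * ((A:ℝ) / d) ^ 2 := by gcongr
            _ = _ := by field_simp
      _ = 2 * (A:ℝ) ^ 2 * ∑ d ∈ Finset.Ioc (T ^ 2) A, ((d:ℝ) ^ 2)⁻¹ := by rw [Finset.mul_sum]
      _ ≤ 2 * (A:ℝ) ^ 2 * (((T ^ 2 : ℕ):ℝ)⁻¹ - (A:ℝ)⁻¹) := by
          gcongr; exact sum_Ioc_inv_sq_le_sub (by positivity) hT2A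
      _ ≤ 2 * (A:ℝ) ^ 2 * ((T ^ 2 : ℕ):ℝ)⁻¹ := by
          gcongr
          have : (0:ℝ) ≤ (A:ℝ)⁻¹ := by positivity
          linarith
      _ = _ := by push_cast; rfl



def PC (a b x0 lam : ℝ) (A h Y : ℕ) (w : ℤ × ℤ) : Prop :=
  WCond a b x0 lam A h w ∧ (∃ r : ℤ, |a * w.1 + b * w.2 - r| ≤ 1 / (8 * h) ∧ Prim w.1 w.2 r) ∧
    Int.gcd w.1 w.2 ≤ Y

open Classical in
def PPs (a b x0 lam : ℝ) (A h Y : ℕ) : Finset (ℤ × ℤ) :=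
  (Finset.Icc (0:ℤ) A ×ˢ Finset.Icc (1:ℤ) A).filter (PC a b x0 lam A h Y)

/-- the pairs with small denominators -/
lemma fm_alpha (R M : ℕ) (hM : 1 ≤ M) (G : Finset (ℤ × ℤ))
    (hG : ∀ w ∈ G, 0 ≤ w.1 ∧ w.1 ≤ w.2 ∧ 1 ≤ w.2 ∧ w.2 < R) :
    ∑ w ∈ G, 2 * (1 / ((M:ℝ) * w.2)) ≤ 4 * R / M := by
  have hMr : (1:ℝ) ≤ M := by exact_mod_cast hM
  have hmaps : ∀ w ∈ G, w.2.toNat ∈ Finset.range R := by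
    intro w hw
    obtain ⟨-, -, h3, h4⟩ := hG w hw
    rw [Finset.mem_range]; omega
  rw [← Finset.sum_fiberwise_of_maps_to hmaps]
  have hq : ∀ q ∈ Finset.range R, ∑ w ∈ G with w.2.toNat = q, 2 * (1 / ((M:ℝ) * w.2)) ≤ 4 / M := by
    intro q hq
    rcases Nat.eq_zero_or_pos q with h0 | h0
    · have : (G.filter fun w => w.2.toNat = q) = ∅ := by
        rw [Finset.filter_eq_empty_iff]
        intro w hw
        obtain ⟨-, -, h3, h4⟩ := hG w hw
        omega
      rw [this, Finset.sum_empty]; positivity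
    · have hqr : (1:ℝ) ≤ q := by exact_mod_cast h0
      have hc : (G.filter fun w => w.2.toNat = q).card ≤ q + 1 := by
        have : (G.filter fun w => w.2.toNat = q) ⊆ Finset.Icc (0:ℤ) q ×ˢ {(q:ℤ)} := by
          intro w hw
          rw [Finset.mem_filter] at hw
          obtain ⟨h1, h2, h3, h4⟩ := hG w hw.1
          rw [Finset.mem_product, Finset.mem_Icc, Finset.mem_singleton]
          have := hw.2
          omega
        refine (Finset.card_le_card this).trans ?_
        rw [Finset.card_product, Int.card_Icc, Finset.card_singleton]; omega
      have hcr : ((G.filter fun w => w.2.toNat = q).card:ℝ) ≤ q + 1 := by exact_mod_cast hc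
      calc ∑ w ∈ G with w.2.toNat = q, 2 * (1 / ((M:ℝ) * w.2))
          = ∑ w ∈ G with w.2.toNat = q, 2 * (1 / ((M:ℝ) * q)) := by
            refine Finset.sum_congr rfl fun w hw => ?_
            rw [Finset.mem_filter] at hw
            obtain ⟨h1, h2, h3, h4⟩ := hG w hw.1
            have : (w.2:ℝ) = q := by
              have e : w.2 = (q:ℤ) := by have := hw.2; omega
              rw [e]; simp
            rw [this]
        _ = (G.filter fun w => w.2.toNat = q).card * (2 * (1 / ((M:ℝ) * q))) := by
            rw [Finset.sum_const, nsmul_eq_mul]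
        _ ≤ (2 * q) * (2 * (1 / ((M:ℝ) * q))) := by gcongr; linarith
        _ = 4 / M := by field_simp; norm_num
  refine (Finset.sum_le_sum hq).trans (le_of_eq ?_)
  rw [Finset.sum_const, Finset.card_range, nsmul_eq_mul]; ring

lemma fm_beta (a b : ℝ) (C0 : ℕ) (δ : ℝ) (hdc : DC a b C0 δ) (P h M A i0 : ℕ) (hP : 1 ≤ P)
    (hh : 1 ≤ h) (hM : 1 ≤ M) (hA : A = 8 * h * M)
    (hsm : (h:ℝ) * (h : ℝ) ^ C0 ≤ 2 * δ * P) (x0 lam : ℝ) (hl0 : 0 < lam)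
    (hx0 : 0 ≤ x0) (hx1 : x0 + lam ≤ 1) (hi0 : 3 ≤ lam * i0) (hi1 : 1 ≤ i0)
    (G : Finset (ℤ × ℤ))
    (hG : ∀ v ∈ G, dn (a * v.1 + b * v.2) ≤ 1 / (8 * h) ∧ x0 * v.2 ≤ v.1 ∧
      (v.1:ℝ) ≤ (x0 + lam) * v.2 ∧ (i0 * P : ℕ) ≤ v.2 ∧ 4096 * v.2 ≤ A) :
    ∑ w ∈ G, 2 * (1 / ((M:ℝ) * w.2)) ≤ lam / 16 := by
  have hMr : (1:ℝ) ≤ M := by exact_mod_cast hM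
  have hPr : (1:ℝ) ≤ P := by exact_mod_cast hP
  have hhr : (1:ℝ) ≤ h := by exact_mod_cast hh
  have hPz : (0:ℤ) < P := by exact_mod_cast hP
  have hmaps : ∀ w ∈ G, (w.2 / (P:ℤ)).toNat ∈ Finset.Icc i0 (A / (4096 * P)) := by
    intro w hw
    obtain ⟨-, -, -, h4, h5⟩ := hG w hw
    have e1 : (i0:ℤ) ≤ w.2 / (P:ℤ) := by
      rw [Int.le_ediv_iff_mul_le hPz]; exact_mod_cast h4
    have e2 : w.2 / (P:ℤ) ≤ ((A / (4096 * P) : ℕ):ℤ) := by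
      push_cast
      rw [Int.le_ediv_iff_mul_le (by positivity)]
      have := Int.ediv_mul_le w.2 hPz.ne'
      nlinarith
    rw [Finset.mem_Icc]
    generalize A / (4096 * P) = z at *
    generalize w.2 / (P:ℤ) = y at *
    omega
  rw [← Finset.sum_fiberwise_of_maps_to hmaps]
  have hq : ∀ i ∈ Finset.Icc i0 (A / (4096 * P)), ∑ w ∈ G with (w.2 / (P:ℤ)).toNat = i, 2 * (1 / ((M:ℝ) * w.2))
      ≤ 32 * lam * P / (h * M) := by
    intro i hi
    rw [Finset.mem_Icc] at hi
    have hi1' : 1 ≤ i := by omega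
    have hir : (1:ℝ) ≤ i := by exact_mod_cast hi1'
    have hi0r : (i0:ℝ) ≤ i := by exact_mod_cast hi.1
    have hdiv : ∀ w ∈ G, (w.2 / (P:ℤ)).toNat = i → w.2 / (P:ℤ) = i := by
      intro w hw hwi
      generalize w.2 / (P:ℤ) = y at *
      omega
    have hc := row_count a b C0 δ hdc P h hP hh hsm x0 lam hl0.le hx0 hx1 i
      (G.filter fun w => (w.2 / (P:ℤ)).toNat = i) (by
        intro v hv
        rw [Finset.mem_filter] at hv
        obtain ⟨k1, k2, k3, k4, k5⟩ := hG v hv.1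
        exact ⟨k1, hdiv v hv.1 hv.2, k2, k3⟩)
    calc ∑ w ∈ G with (w.2 / (P:ℤ)).toNat = i, 2 * (1 / ((M:ℝ) * w.2))
        ≤ ∑ w ∈ G with (w.2 / (P:ℤ)).toNat = i, 2 * (1 / ((M:ℝ) * (i * P))) := by
          refine Finset.sum_le_sum fun w hw => ?_
          rw [Finset.mem_filter] at hw
          have e1 := hdiv w hw.1 hw.2
          have e2 := Int.ediv_mul_le w.2 hPz.ne'
          rw [e1] at e2
          have e3 : (i:ℝ) * P ≤ w.2 := by exact_mod_cast e2
          gcongr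
      _ = (G.filter fun w => (w.2 / (P:ℤ)).toNat = i).card * (2 * (1 / ((M:ℝ) * (i * P)))) := by
          rw [Finset.sum_const, nsmul_eq_mul]
      _ ≤ ((2 * lam * i) * (8 * (P:ℝ) ^ 2 / h)) * (2 * (1 / ((M:ℝ) * (i * P)))) := by
          have e1 : lam * i0 ≤ lam * i := by gcongr
          have e2 : (lam * i + 3) * (8 * (P:ℝ) ^ 2 / h) ≤ (2 * lam * i) * (8 * (P:ℝ) ^ 2 / h) := by
            gcongr; linarith
          gcongr
          linarith
      _ = 32 * lam * P / (h * M) := by field_simp; ring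
  refine (Finset.sum_le_sum hq).trans ?_
  rw [Finset.sum_const, Nat.card_Icc, nsmul_eq_mul]
  have hc : ((A / (4096 * P) + 1 - i0 : ℕ):ℝ) ≤ A / (4096 * P) := by
    calc ((A / (4096 * P) + 1 - i0 : ℕ):ℝ) ≤ ((A / (4096 * P) : ℕ):ℝ) := by
          refine Nat.cast_le.mpr ?_
          generalize A / (4096 * P) = z
          omega
      _ ≤ _ := by refine Nat.cast_div_le.trans (le_of_eq ?_); push_cast; rfl
  calc _ ≤ (A:ℝ) / (4096 * P) * (32 * lam * P / (h * M)) := by gcongr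
    _ = lam / 16 := by rw [hA]; push_cast; field_simp; norm_num

lemma cone_aux (β x0 lam p q e : ℝ) (hl0 : 0 < lam) (hx0 : 0 ≤ x0) (hx1 : x0 + lam ≤ 1)
    (hq : 1 ≤ q) (he : e ≤ lam / 4) (h1 : -e ≤ q * β - p) (h2 : q * β - p ≤ e)
    (hb1 : x0 + lam / 4 ≤ β) (hb2 : β ≤ x0 + 3 * lam / 4) :
    x0 * q ≤ p ∧ p ≤ (x0 + lam) * q ∧ 0 ≤ p ∧ p ≤ q := by
  have hq0 : 0 ≤ q := by linarith
  have hlq : lam / 4 ≤ lam / 4 * q := by nlinarith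
  have e1 : q * (x0 + lam / 4) ≤ q * β := by gcongr
  have e2 : q * β ≤ q * (x0 + 3 * lam / 4) := by gcongr
  have m1 : x0 * q ≤ p := by linarith
  have m2 : p ≤ (x0 + lam) * q := by linarith
  have m3 : 0 ≤ p := le_trans (by positivity) m1
  have m4 : (x0 + lam) * q ≤ 1 * q := by gcongr
  exact ⟨m1, m2, m3, by linarith⟩

set_option maxHeartbeats 1000000 in
lemma first_moment (a b : ℝ) (C0 : ℕ) (δ : ℝ) (hdc : DC a b C0 δ) (P h M A T Y : ℕ) (hP : 1 ≤ P)
    (hh : 1 ≤ h) (hhT : h ≤ T) (hM : 1 ≤ M) (hA : A = 8 * h * M) (hPA : P ^ 2 ≤ A) (hTP : T ^ 3 ≤ P)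
    (hsm : (T:ℝ) ^ (3 * C0 + 1) ≤ 2 * δ * P) (x0 lam : ℝ) (hl0 : 0 < lam)
    (hx0 : 0 ≤ x0) (hx1 : x0 + lam ≤ 1) (hYT : Y ≤ T) (hlY : 2 ^ 26 ≤ lam * Y) :
    lam * A ^ 2 / (262144 * h) ≤ ((PPs a b x0 lam A h Y).card : ℝ) := by
  classical
  have hMr : (1:ℝ) ≤ M := by exact_mod_cast hM
  have hPr : (1:ℝ) ≤ P := by exact_mod_cast hP
  have hhr : (1:ℝ) ≤ h := by exact_mod_cast hh
  have hhTr : (h:ℝ) ≤ T := by exact_mod_cast hhT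
  have hT1 : 1 ≤ T := by omega
  have hTr : (1:ℝ) ≤ T := by exact_mod_cast hT1
  have hYTr : (Y:ℝ) ≤ T := by exact_mod_cast hYT
  have hTPr : (T:ℝ) ^ 3 ≤ P := by exact_mod_cast hTP
  have hPAr : (P:ℝ) ^ 2 ≤ A := by exact_mod_cast hPA
  have hAr : (A:ℝ) = 8 * h * M := by rw [hA]; push_cast; ring
  have hY1 : 1 ≤ Y := by
    by_contra hc
    have : Y = 0 := by omega
    rw [this] at hlY; norm_num at hlY
  have hYr : (1:ℝ) ≤ Y := by exact_mod_cast hY1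
  have hlT : 2 ^ 26 ≤ lam * T := hlY.trans (by gcongr)
  have hl1 : lam ≤ 1 := by linarith
  -- 2048 T ≤ lam^2 P
  have hlP : 2 ^ 52 * (T:ℝ) ≤ lam ^ 2 * P := by
    calc 2 ^ 52 * (T:ℝ) = (2 ^ 26) ^ 2 * T := by norm_num
      _ ≤ (lam * T) ^ 2 * T := by gcongr
      _ = lam ^ 2 * T ^ 3 := by ring
      _ ≤ _ := by gcongr
  have hMP : (P:ℝ) ^ 2 ≤ 8 * T * M := by
    calc (P:ℝ) ^ 2 ≤ 8 * h * M := by rw [← hAr]; exact hPAr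
      _ ≤ _ := by gcongr
  -- lam^2 M ≥ 256 P
  have hlM : 256 * (P:ℝ) ≤ lam ^ 2 * M := by
    have e1 : 2 ^ 52 * (T:ℝ) * P ≤ lam ^ 2 * P * P := by gcongr
    have e2 : lam ^ 2 * (P:ℝ) ^ 2 ≤ lam ^ 2 * (8 * T * M) := by gcongr
    have e3 : (T:ℝ) * (256 * P) ≤ T * (lam ^ 2 * M) := by
      have : 0 ≤ (T:ℝ) * P := by positivity
      nlinarith
    exact le_of_mul_le_mul_left e3 (by linarith)
  have hlM4 : 4 ≤ lam * M := by
    have : lam ^ 2 * M ≤ lam * M := by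
      have : lam ^ 2 ≤ lam := by nlinarith
      gcongr
    linarith
  set i0 := ⌈3 / lam⌉₊ with hi0
  have hi0a : 3 ≤ lam * i0 := by
    have := Nat.le_ceil (3 / lam)
    rw [div_le_iff₀ hl0] at this; linarith
  have hi0b : lam * i0 ≤ 4 := by
    have := Nat.ceil_lt_add_one (show 0 ≤ 3 / lam by positivity)
    have h2 : lam * i0 ≤ lam * (3 / lam + 1) := by gcongr
    have h3 : lam * (3 / lam + 1) = 3 + lam := by field_simp
    linarith
  have hi01 : 1 ≤ i0 := by
    by_contra hc
    have : i0 = 0 := by omega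
    rw [this] at hi0a; norm_num at hi0a
  have hsm1 : (h:ℝ) * (h : ℝ) ^ C0 ≤ 2 * δ * P := by
    refine le_trans ?_ hsm
    calc (h:ℝ) * (h : ℝ) ^ C0 = h ^ (C0 + 1) := by ring
      _ ≤ T ^ (C0 + 1) := by gcongr
      _ ≤ T ^ (3 * C0 + 1) := pow_le_pow_right₀ hTr (by omega)
  set G := (Finset.Icc (0:ℤ) A ×ˢ Finset.Icc (1:ℤ) A).filter fun w : ℤ × ℤ =>
    x0 * w.2 ≤ w.1 ∧ (w.1:ℝ) ≤ (x0 + lam) * w.2 ∧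
    ∃ r : ℤ, |a * w.1 + b * w.2 - r| ≤ 1 / (8 * h) ∧ Prim w.1 w.2 r with hG
  have hGm : ∀ w ∈ G, 0 ≤ w.1 ∧ w.1 ≤ w.2 ∧ 1 ≤ w.2 ∧ w.2 ≤ A ∧ x0 * w.2 ≤ w.1 ∧
      (w.1:ℝ) ≤ (x0 + lam) * w.2 ∧ dn (a * w.1 + b * w.2) ≤ 1 / (8 * h) := by
    intro w hw
    rw [hG, Finset.mem_filter, Finset.mem_product, Finset.mem_Icc, Finset.mem_Icc] at hw
    obtain ⟨⟨⟨k1, k2⟩, k3, k4⟩, k5, k6, r, k7, -⟩ := hw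
    have : (1:ℝ) ≤ w.2 := by exact_mod_cast k3
    refine ⟨k1, ?_, k3, k4, k5, k6, (dn_le _ r).trans k7⟩
    have : (w.1:ℝ) ≤ w.2 := by nlinarith
    exact_mod_cast this
  have hcover : x0 + 3 * lam / 4 - (x0 + lam / 4) ≤ ∑ w ∈ G, 2 * (1 / ((M:ℝ) * w.2)) := by
    refine cover_le G (fun w => (w.1:ℝ) / w.2) (fun w => 1 / ((M:ℝ) * w.2)) ?_ _ _ ?_
    · intro w hw
      have : (1:ℝ) ≤ w.2 := by exact_mod_cast (hGm w hw).2.2.1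
      positivity
    · intro β hβ1 hβ2
      obtain ⟨p, q, r, k1, k2, k3, k4, k5⟩ := dirichlet_prim a b β (8 * h) M (by omega) hM
      have hqr : (1:ℝ) ≤ q := by exact_mod_cast k1
      have hinv : 1 / (M:ℝ) ≤ lam / 4 := by
        rw [div_le_div_iff₀ (by positivity) (by norm_num)]; linarith
      obtain ⟨k3a, k3b⟩ := abs_le.mp k3
      obtain ⟨m1, m2, m3, m4⟩ := cone_aux β x0 lam p q (1 / M) hl0 hx0 hx1 hqr hinv k3a k3b hβ1 hβ2
      have m3' : 0 ≤ p := by exact_mod_cast m3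
      have m4' : p ≤ q := by exact_mod_cast m4
      have k2' : q ≤ A := by rw [hA]; push_cast at k2 ⊢; exact k2
      refine ⟨(p, q), ?_, ?_⟩
      · rw [hG, Finset.mem_filter, Finset.mem_product, Finset.mem_Icc, Finset.mem_Icc]
        refine ⟨⟨⟨m3', by simp only; omega⟩, k1, k2'⟩, m1, m2, r, ?_, k5⟩
        push_cast at k4; exact k4
      · simp only
        have : β - p / q = (q * β - p) / q := by field_simp
        rw [this, abs_div, abs_of_pos (show (0:ℝ) < q by linarith), ← div_div]
        gcongr
  have hlam2 : lam / 2 ≤ ∑ w ∈ G, 2 * (1 / ((M:ℝ) * w.2)) := by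
    refine le_trans (le_of_eq ?_) hcover; ring
  -- split
  set f : ℤ × ℤ → ℝ := fun w => 2 * (1 / ((M:ℝ) * w.2)) with hf
  set Ga := G.filter fun w => w.2 < ((i0 * P : ℕ):ℤ) with hGa
  set G1 := G.filter fun w => ¬ w.2 < ((i0 * P : ℕ):ℤ) with hG1
  set Gb := G1.filter fun w => 4096 * w.2 ≤ (A:ℤ) with hGb
  set G2 := G1.filter fun w => ¬ 4096 * w.2 ≤ (A:ℤ) with hG2
  set Gc := G2.filter fun w => ¬ Int.gcd w.1 w.2 ≤ Y with hGc
  set Gd := G2.filter fun w => Int.gcd w.1 w.2 ≤ Y with hGd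
  have s1 : ∑ w ∈ G, f w = ∑ w ∈ Ga, f w + ∑ w ∈ G1, f w :=
    (Finset.sum_filter_add_sum_filter_not G _ f).symm
  have s2 : ∑ w ∈ G1, f w = ∑ w ∈ Gb, f w + ∑ w ∈ G2, f w :=
    (Finset.sum_filter_add_sum_filter_not G1 _ f).symm
  have s3 : ∑ w ∈ G2, f w = ∑ w ∈ Gd, f w + ∑ w ∈ Gc, f w :=
    (Finset.sum_filter_add_sum_filter_not G2 _ f).symm
  have ba : ∑ w ∈ Ga, f w ≤ lam / 16 := by
    refine (fm_alpha (i0 * P) M hM Ga ?_).trans ?_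
    · intro w hw
      rw [hGa, Finset.mem_filter] at hw
      obtain ⟨k1, k2, k3, -⟩ := hGm w hw.1
      exact ⟨k1, k2, k3, hw.2⟩
    · rw [div_le_div_iff₀ (by linarith) (by norm_num)]
      push_cast
      have e : lam * (4 * ((i0:ℝ) * P) * 16) ≤ lam * (lam * M) := by
        have : lam * i0 * P ≤ 4 * P := by gcongr
        nlinarith
      exact le_of_mul_le_mul_left e hl0
  have bb : ∑ w ∈ Gb, f w ≤ lam / 16 := by
    refine fm_beta a b C0 δ hdc P h M A i0 hP hh hM hA hsm1 x0 lam hl0 hx0 hx1 hi0a hi01 Gb ?_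
    intro w hw
    rw [hGb, Finset.mem_filter, hG1, Finset.mem_filter] at hw
    obtain ⟨k1, k2, k3, k4, k5, k6, k7⟩ := hGm w hw.1.1
    exact ⟨k7, k5, k6, by have := hw.1.2; push Not at this; exact this, hw.2⟩
  have hAp : (0:ℝ) < A := lt_of_lt_of_le (by positivity) hPAr
  have hweight : ∀ w ∈ G2, f w ≤ 65536 * h / A ^ 2 := by
    intro w hw
    rw [hG2, Finset.mem_filter] at hw
    have h1 := hw.2
    push Not at h1
    have h2 : (A:ℝ) ≤ 4096 * w.2 := by exact_mod_cast h1.le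
    have h3 : (0:ℝ) < w.2 := by linarith
    simp only [hf]
    rw [mul_one_div, div_le_div_iff₀ (by positivity) (by positivity)]
    calc 2 * (A:ℝ) ^ 2 = 2 * A * A := by ring
      _ ≤ 2 * (8 * h * M) * (4096 * w.2) := by rw [← hAr]; gcongr
      _ = _ := by ring
  have bc : ∑ w ∈ Gc, f w ≤ lam / 16 := by
    have e1 : ∑ w ∈ Gc, f w ≤ Gc.card * (65536 * h / A ^ 2) := by
      rw [← nsmul_eq_mul]
      refine Finset.sum_le_card_nsmul _ _ _ fun w hw => hweight w ?_
      rw [hGc, Finset.mem_filter] at hw; exact hw.1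
    have e2 := gcd_count a b C0 δ hdc P h A T Y hP hh hhT hY1 hYT hTP hsm hPA Gc (by
      intro w hw
      rw [hGc, Finset.mem_filter, hG2, Finset.mem_filter, hG1, Finset.mem_filter] at hw
      obtain ⟨k1, k2, k3, k4, k5, k6, k7⟩ := hGm w hw.1.1.1
      exact ⟨k7, k1, k2, k3, k4, by have := hw.2; omega⟩)
    calc _ ≤ _ := e1
      _ ≤ (32 * A ^ 2 / (h * Y) + 2 * A ^ 2 / T ^ 2) * (65536 * h / A ^ 2) := by gcongr
      _ = 2097152 / Y + 131072 * (h / T ^ 2) := by field_simp; ring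
      _ ≤ 2097152 / Y + 131072 * (T / T ^ 2) := by gcongr
      _ = 2097152 / Y + 131072 / T := by field_simp
      _ ≤ lam / 32 + lam / 32 := by
          refine add_le_add ?_ ?_
          · rw [div_le_div_iff₀ (by linarith) (by norm_num)]; linarith
          · rw [div_le_div_iff₀ (by linarith) (by norm_num)]; linarith
      _ = _ := by ring
  have bd : ∑ w ∈ Gd, f w ≤ Gd.card * (65536 * h / A ^ 2) := by
    rw [← nsmul_eq_mul]
    refine Finset.sum_le_card_nsmul _ _ _ fun w hw => hweight w ?_
    rw [hGd, Finset.mem_filter] at hw; exact hw.1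
  have hsub : Gd ⊆ PPs a b x0 lam A h Y := by
    intro w hw
    rw [hGd, Finset.mem_filter, hG2, Finset.mem_filter, hG1, Finset.mem_filter] at hw
    obtain ⟨⟨⟨k1, -⟩, k2⟩, k3⟩ := hw
    obtain ⟨-, -, m3, m4, m5, m6, m7⟩ := hGm w k1
    rw [hG, Finset.mem_filter] at k1
    unfold PPs
    rw [Finset.mem_filter]
    push Not at k2
    refine ⟨k1.1, ⟨?_, ?_, m5, m6, m7⟩, k1.2.2.2, k3⟩
    · exact_mod_cast k2
    · exact_mod_cast m4
  have hcard : (Gd.card:ℝ) ≤ (PPs a b x0 lam A h Y).card := by exact_mod_cast Finset.card_le_card hsub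
  refine le_trans ?_ hcard
  have hfin : lam / 4 ≤ Gd.card * (65536 * h / A ^ 2) := by linarith
  rw [div_le_iff₀ (by positivity)]
  have e1 : (Gd.card:ℝ) * (65536 * h / A ^ 2) = (Gd.card * (65536 * h)) / A ^ 2 := by ring
  rw [e1, le_div_iff₀ (by positivity)] at hfin
  linarith



lemma second_moment_abs {ι : Type*} (F : Finset ι) (B : ι → Set ℝ) (hB : ∀ i, MeasurableSet (B i))
    (hfin : ∀ i, volume (B i) ≠ ⊤) (U : Set ℝ) (hU : U = ⋃ i ∈ F, B i) :
    (∑ i ∈ F, volume.real (B i)) ^ 2 ≤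
      volume.real U * ∑ i ∈ F, ∑ j ∈ F, volume.real (B i ∩ B j) := by
  have hUm : MeasurableSet U := by rw [hU]; exact Finset.measurableSet_biUnion F fun i _ => hB i
  have hUf : volume U ≠ ⊤ := by
    rw [hU]
    refine ((measure_biUnion_finset_le F B).trans_lt ?_).ne
    exact ENNReal.sum_lt_top.mpr fun i _ => lt_top_iff_ne_top.mpr (hfin i)
  have hint : ∀ s : Set ℝ, MeasurableSet s → volume s ≠ ⊤ →
      Integrable (s.indicator (fun _ => (1:ℝ))) volume := by
    intro s hs hf
    exact (integrable_indicator_iff hs).mpr (integrableOn_const hf)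
  have hval : ∀ s : Set ℝ, MeasurableSet s → ∫ x, s.indicator (fun _ => (1:ℝ)) x = volume.real s := by
    intro s hs
    rw [integral_indicator hs]; simp
  have hBB : ∀ i j, volume (B i ∩ B j) ≠ ⊤ := fun i j =>
    ((measure_mono Set.inter_subset_left).trans_lt (lt_top_iff_ne_top.mpr (hfin i))).ne
  have key : ∀ t : ℝ, 0 ≤ volume.real U * (t * t) + (-2 * ∑ i ∈ F, volume.real (B i)) * t +
      ∑ i ∈ F, ∑ j ∈ F, volume.real (B i ∩ B j) := by
    intro t
    have h0 : 0 ≤ ∫ x, (∑ i ∈ F, (B i).indicator (fun _ => (1:ℝ)) x -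
        t * U.indicator (fun _ => (1:ℝ)) x) ^ 2 := integral_nonneg fun x => sq_nonneg _
    have hpt : ∀ x, (∑ i ∈ F, (B i).indicator (fun _ => (1:ℝ)) x -
        t * U.indicator (fun _ => (1:ℝ)) x) ^ 2 =
        (∑ i ∈ F, ∑ j ∈ F, (B i ∩ B j).indicator (fun _ => (1:ℝ)) x +
        (-2 * t) * ∑ i ∈ F, (B i).indicator (fun _ => (1:ℝ)) x) +
        (t * t) * U.indicator (fun _ => (1:ℝ)) x := by
      intro x
      have e1 : ∑ i ∈ F, ∑ j ∈ F, (B i ∩ B j).indicator (fun _ => (1:ℝ)) x =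
          (∑ i ∈ F, (B i).indicator (fun _ => (1:ℝ)) x) ^ 2 := by
        rw [sq, Finset.sum_mul_sum]
        refine Finset.sum_congr rfl fun i _ => Finset.sum_congr rfl fun j _ => ?_
        by_cases h1 : x ∈ B i <;> by_cases h2 : x ∈ B j <;> simp [h1, h2]
      rw [e1]
      by_cases hx : x ∈ U
      · rw [Set.indicator_of_mem hx]; ring
      · have e2 : ∑ i ∈ F, (B i).indicator (fun _ => (1:ℝ)) x = 0 := by
          refine Finset.sum_eq_zero fun i hi => ?_
          refine Set.indicator_of_notMem ?_ _
          intro h; apply hx; rw [hU]; simp only [Set.mem_iUnion]; exact ⟨i, hi, h⟩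
        rw [Set.indicator_of_notMem hx, e2]; ring
    simp_rw [hpt] at h0
    have i1 : Integrable (fun x => ∑ i ∈ F, ∑ j ∈ F, (B i ∩ B j).indicator (fun _ => (1:ℝ)) x) volume :=
      integrable_finset_sum _ fun i _ => integrable_finset_sum _ fun j _ =>
        hint _ ((hB i).inter (hB j)) (hBB i j)
    have i2 : Integrable (fun x => ∑ i ∈ F, (B i).indicator (fun _ => (1:ℝ)) x) volume :=
      integrable_finset_sum _ fun i _ => hint _ (hB i) (hfin i)
    have i3 := hint U hUm hUf
    have i12 : Integrable (fun x => ∑ i ∈ F, ∑ j ∈ F, (B i ∩ B j).indicator (fun _ => (1:ℝ)) x +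
        (-2 * t) * ∑ i ∈ F, (B i).indicator (fun _ => (1:ℝ)) x) volume := i1.add (i2.const_mul _)
    rw [integral_add i12 (i3.const_mul _),
      integral_add i1 (i2.const_mul _), integral_const_mul, integral_const_mul, hval U hUm,
      integral_finset_sum _ (fun i _ => integrable_finset_sum _ fun j _ =>
        hint _ ((hB i).inter (hB j)) (hBB i j)),
      integral_finset_sum _ (fun i _ => hint _ (hB i) (hfin i))] at h0
    have e3 : ∀ i ∈ F, ∫ x, ∑ j ∈ F, (B i ∩ B j).indicator (fun _ => (1:ℝ)) x =
        ∑ j ∈ F, volume.real (B i ∩ B j) := by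
      intro i _
      rw [integral_finset_sum _ (fun j _ => hint _ ((hB i).inter (hB j)) (hBB i j))]
      exact Finset.sum_congr rfl fun j _ => hval _ ((hB i).inter (hB j))
    rw [Finset.sum_congr rfl e3, Finset.sum_congr rfl (fun i _ => hval _ (hB i))] at h0
    linarith
  have := discrim_le_zero key
  unfold discrim at this
  linarith

lemma inter_le (c c' r r' : ℝ) (hr : 0 ≤ r) (hr' : 0 ≤ r') :
    volume.real (Set.Icc (c - r) (c + r) ∩ Set.Icc (c' - r') (c' + r')) ≤
      if |c - c'| ≤ r + r' then 2 * min r r' else 0 := by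
  split_ifs with h
  · rw [mul_min_of_nonneg _ _ (by norm_num)]
    refine le_min ?_ ?_
    · refine (measureReal_mono Set.inter_subset_left (by simp)).trans ?_
      rw [Real.volume_real_Icc_of_le (by linarith)]; linarith
    · refine (measureReal_mono Set.inter_subset_right (by simp)).trans ?_
      rw [Real.volume_real_Icc_of_le (by linarith)]; linarith
  · have : Set.Icc (c - r) (c + r) ∩ Set.Icc (c' - r') (c' + r') = ∅ := by
      rw [Set.eq_empty_iff_forall_notMem]
      rintro x ⟨⟨h1, h2⟩, h3, h4⟩
      apply h
      rw [abs_le]; constructor <;> linarith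
    rw [this]; simp

lemma diag_aux (p q p' q' : ℤ) (g g' : ℕ) (hq : 1 ≤ q) (hq' : 1 ≤ q')
    (hg : g = Int.gcd p q) (hg' : g' = Int.gcd p' q') (hc : p * q' - q * p' = 0) :
    (g':ℤ) * p = g * p' ∧ (g':ℤ) * q = g * q' := by
  have hgp : 0 < Int.gcd p q := Int.gcd_pos_of_ne_zero_right _ (by omega)
  have hgp' : 0 < Int.gcd p' q' := Int.gcd_pos_of_ne_zero_right _ (by omega)
  have h1 := Int.isCoprime_iff_gcd_eq_one.mpr (Int.gcd_ediv_gcd_ediv_gcd hgp)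
  have h2 := Int.isCoprime_iff_gcd_eq_one.mpr (Int.gcd_ediv_gcd_ediv_gcd hgp')
  rw [← hg] at h1 hgp
  rw [← hg'] at h2 hgp'
  have e1 : p = p / g * g := (Int.ediv_mul_cancel (by rw [hg]; exact Int.gcd_dvd_left _ _)).symm
  have e2 : q = q / g * g := (Int.ediv_mul_cancel (by rw [hg]; exact Int.gcd_dvd_right _ _)).symm
  have e3 : p' = p' / g' * g' := (Int.ediv_mul_cancel (by rw [hg']; exact Int.gcd_dvd_left _ _)).symm
  have e4 : q' = q' / g' * g' := (Int.ediv_mul_cancel (by rw [hg']; exact Int.gcd_dvd_right _ _)).symm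
  generalize p / (g:ℤ) = u at *
  generalize q / (g:ℤ) = v at *
  generalize p' / (g':ℤ) = u' at *
  generalize q' / (g':ℤ) = v' at *
  have hgz : (0:ℤ) < g := by exact_mod_cast hgp
  have hgz' : (0:ℤ) < g' := by exact_mod_cast hgp'
  have hv : 0 < v := by
    by_contra hh; push Not at hh; nlinarith
  have hv' : 0 < v' := by
    by_contra hh; push Not at hh; nlinarith
  have hcr : u * v' = v * u' := by
    have : (u * v' - v * u') * (g * g') = 0 := by rw [← hc, e1, e2, e3, e4]; ring
    rcases mul_eq_zero.mp this with h | h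
    · linarith
    · exact absurd h (by positivity)
  have d1 : v ∣ v' := h1.symm.dvd_of_dvd_mul_left (Dvd.intro _ hcr.symm)
  have d2 : v' ∣ v := h2.symm.dvd_of_dvd_mul_right (Dvd.intro_left _ hcr)
  have hvv : v = v' := Int.dvd_antisymm hv.le hv'.le d1 d2
  have huu : u = u' := by
    rw [hvv, mul_comm] at hcr
    exact mul_left_cancel₀ hv'.ne' hcr
  constructor
  · rw [e1, e3, huu]; ring
  · rw [e2, e4, hvv]; ring

lemma mem_PPs (a b x0 lam : ℝ) (A h Y : ℕ) (w : ℤ × ℤ) : w ∈ PPs a b x0 lam A h Y ↔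
    ((0 ≤ w.1 ∧ w.1 ≤ A) ∧ 1 ≤ w.2 ∧ w.2 ≤ A) ∧ PC a b x0 lam A h Y w := by
  classical
  unfold PPs
  rw [Finset.mem_filter, Finset.mem_product, Finset.mem_Icc, Finset.mem_Icc]

lemma diag_eq (a b x0 lam : ℝ) (A A' h h' Y : ℕ) (w w' : ℤ × ℤ)
    (hw : w ∈ PPs a b x0 lam A h Y) (hw' : w' ∈ PPs a b x0 lam A' h' Y)
    (hY : (Y:ℝ) * (1 / (8 * h)) ≤ 1 / 4) (hY' : (Y:ℝ) * (1 / (8 * h')) ≤ 1 / 4)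
    (hc : w.1 * w'.2 - w.2 * w'.1 = 0) : w = w' := by
  rw [mem_PPs] at hw hw'
  obtain ⟨⟨-, hq, -⟩, -, ⟨r, hr, hpr⟩, hg⟩ := hw
  obtain ⟨⟨-, hq', -⟩, -, ⟨r', hr', hpr'⟩, hg'⟩ := hw'
  obtain ⟨p, q⟩ := w
  obtain ⟨p', q'⟩ := w'
  simp only at *
  obtain ⟨e1, e2⟩ := diag_aux p q p' q' _ _ hq hq' rfl rfl hc
  have hgp : 0 < Int.gcd p q := Int.gcd_pos_of_ne_zero_right _ (by omega)
  have hgp' : 0 < Int.gcd p' q' := Int.gcd_pos_of_ne_zero_right _ (by omega)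
  set g := Int.gcd p q with hgd
  set g' := Int.gcd p' q' with hgd'
  have hgr : (g:ℝ) ≤ Y := by exact_mod_cast hg
  have hgr' : (g':ℝ) ≤ Y := by exact_mod_cast hg'
  have f1 : (g':ℝ) * p = g * p' := by exact_mod_cast e1
  have f2 : (g':ℝ) * q = g * q' := by exact_mod_cast e2
  have e3 : (g':ℤ) * r = g * r' := by
    have k1 : |((g':ℤ) * r - g * r' : ℝ)| ≤ 1 / 2 := by
      have : ((g':ℤ) * r - g * r' : ℝ) = g * (a * p' + b * q' - r') - g' * (a * p + b * q - r) := by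
        push_cast
        linear_combination a * f1 + b * f2
      rw [this]
      calc _ ≤ |(g:ℝ) * (a * p' + b * q' - r')| + |(g':ℝ) * (a * p + b * q - r)| := abs_sub _ _
        _ = (g:ℝ) * |a * p' + b * q' - r'| + (g':ℝ) * |a * p + b * q - r| := by
            rw [abs_mul, abs_mul, Nat.abs_cast, Nat.abs_cast]
        _ ≤ Y * (1 / (8 * h')) + Y * (1 / (8 * h)) := by gcongr
        _ ≤ 1 / 2 := by linarith
    have k2 : |(((g':ℤ) * r - g * r' : ℤ):ℝ)| < 1 := by
      refine lt_of_le_of_lt (le_of_eq ?_) (lt_of_le_of_lt k1 (by norm_num))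
      push_cast; rfl
    have k3 : |(g':ℤ) * r - g * r'| < 1 := by exact_mod_cast k2
    rw [Int.abs_lt_one_iff] at k3
    linarith
  -- common gcd
  obtain ⟨G, x, y, hG, hcop, hx, hy⟩ : ∃ G x y : ℤ, 0 < G ∧ IsCoprime x y ∧ (g:ℤ) = G * x ∧ (g':ℤ) = G * y := by
    have hpos : 0 < Int.gcd (g:ℤ) g' := Int.gcd_pos_of_ne_zero_left _ (by exact_mod_cast hgp.ne')
    refine ⟨Int.gcd (g:ℤ) g', g / Int.gcd (g:ℤ) g', g' / Int.gcd (g:ℤ) g', by exact_mod_cast hpos,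
      Int.isCoprime_iff_gcd_eq_one.mpr (Int.gcd_ediv_gcd_ediv_gcd hpos), ?_, ?_⟩
    · exact (Int.mul_ediv_cancel' (Int.gcd_dvd_left _ _)).symm
    · exact (Int.mul_ediv_cancel' (Int.gcd_dvd_right _ _)).symm
  have hxp : 0 < x := by
    have : (0:ℤ) < g := by exact_mod_cast hgp
    by_contra hh; push Not at hh; nlinarith
  have hyp : 0 < y := by
    have : (0:ℤ) < g' := by exact_mod_cast hgp'
    by_contra hh; push Not at hh; nlinarith
  rw [hx, hy] at e1 e2 e3
  have c1 : y * p = x * p' := mul_left_cancel₀ hG.ne' (by linarith)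
  have c2 : y * q = x * q' := mul_left_cancel₀ hG.ne' (by linarith)
  have c3 : y * r = x * r' := mul_left_cancel₀ hG.ne' (by linarith)
  have ux : IsUnit x := hpr x (hcop.dvd_of_dvd_mul_left (Dvd.intro _ c1.symm))
    (hcop.dvd_of_dvd_mul_left (Dvd.intro _ c2.symm)) (hcop.dvd_of_dvd_mul_left (Dvd.intro _ c3.symm))
  have uy : IsUnit y := hpr' y (hcop.symm.dvd_of_dvd_mul_left (Dvd.intro _ c1))
    (hcop.symm.dvd_of_dvd_mul_left (Dvd.intro _ c2)) (hcop.symm.dvd_of_dvd_mul_left (Dvd.intro _ c3))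
  have hx1 : x = 1 := by rcases Int.isUnit_iff.mp ux with h | h <;> omega
  have hy1 : y = 1 := by rcases Int.isUnit_iff.mp uy with h | h <;> omega
  rw [hx1, hy1] at c1 c2
  refine Prod.ext ?_ ?_
  · simp only; linarith
  · simp only; linarith

lemma geom_dist (n j : ℕ) : ∑ x ∈ Finset.range n, ((1:ℝ) / 2) ^ ((j - x) + (x - j)) ≤ 4 := by
  have h1 : ∑ x ∈ Finset.range n, ((1:ℝ) / 2) ^ ((j - x) + (x - j)) ≤
      ∑ x ∈ Finset.range (j + 1 + n), ((1:ℝ) / 2) ^ ((j - x) + (x - j)) := by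
    refine Finset.sum_le_sum_of_subset_of_nonneg ?_ fun _ _ _ => by positivity
    intro x; simp only [Finset.mem_range]; omega
  refine h1.trans ?_
  rw [Finset.sum_range_add]
  have h2 : ∑ x ∈ Finset.range (j + 1), ((1:ℝ) / 2) ^ ((j - x) + (x - j)) ≤ 2 := by
    rw [← Finset.sum_range_reflect]
    refine le_trans (le_of_eq ?_) (sum_geometric_two_le (j + 1))
    refine Finset.sum_congr rfl fun x hx => ?_
    rw [Finset.mem_range] at hx
    congr 1; omega
  have h3 : ∑ x ∈ Finset.range n, ((1:ℝ) / 2) ^ ((j - (j + 1 + x)) + (j + 1 + x - j)) ≤ 2 := by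
    refine le_trans ?_ (sum_geometric_two_le n)
    refine Finset.sum_le_sum fun x hx => ?_
    refine pow_le_pow_of_le_one (by norm_num) (by norm_num) ?_
    omega
  linarith



lemma PPs_card_le (a b : ℝ) (C0 : ℕ) (δ : ℝ) (hdc : DC a b C0 δ) (P h A T Y : ℕ) (hP : 1 ≤ P)
    (hh : 1 ≤ h) (hhT : h ≤ T) (hsm : (T:ℝ) ^ (3 * C0 + 1) ≤ 2 * δ * P) (x0 lam : ℝ) (hl0 : 0 ≤ lam)
    (hx0 : 0 ≤ x0) (hx1 : x0 + lam ≤ 1) (hlP : 3 ≤ lam * P) (hPA : P ^ 2 ≤ A) :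
    ((PPs a b x0 lam A h Y).card : ℝ) ≤ 32 * lam * A ^ 2 / h := by
  have hhr : (1:ℝ) ≤ h := by exact_mod_cast hh
  have hhTr : (h:ℝ) ≤ T := by exact_mod_cast hhT
  refine total_count a b C0 δ hdc P h A hP hh ?_ x0 lam hl0 hx0 hx1 hlP hPA _ ?_
  · calc (h:ℝ) * (h:ℝ) ^ C0 = (h:ℝ) ^ (C0 + 1) := by ring
      _ ≤ (T:ℝ) ^ (C0 + 1) := by gcongr
      _ ≤ (T:ℝ) ^ (3 * C0 + 1) := by gcongr <;> first | linarith | omega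
      _ ≤ _ := hsm
  · intro w hw
    rw [mem_PPs] at hw
    obtain ⟨⟨-, h1, h2⟩, ⟨-, -, h3, h4, h5⟩, -⟩ := hw
    exact ⟨h5, by omega, h2, h3, h4⟩

def Bw (ρ : ℝ) (w : ℤ × ℤ) : Set ℝ := Set.Icc ((w.1:ℝ) / w.2 - ρ) ((w.1:ℝ) / w.2 + ρ)

lemma diag_sum (S S' : Finset (ℤ × ℤ)) (c : ℝ) (hc : 0 ≤ c) :
    ∑ w ∈ S, ∑ w' ∈ S', (if w = w' then c else 0) ≤ (min S.card S'.card : ℕ) * c := by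
  have h1 : ∑ w ∈ S, ∑ w' ∈ S', (if w = w' then c else 0) ≤ S.card * c := by
    rw [← nsmul_eq_mul]
    refine Finset.sum_le_card_nsmul _ _ _ fun w _ => ?_
    rw [Finset.sum_ite_eq]; split_ifs <;> linarith
  have h2 : ∑ w ∈ S, ∑ w' ∈ S', (if w = w' then c else 0) ≤ S'.card * c := by
    rw [← nsmul_eq_mul, Finset.sum_comm]
    refine Finset.sum_le_card_nsmul _ _ _ fun w _ => ?_
    rw [Finset.sum_ite_eq']; split_ifs <;> linarith
  rcases le_total S.card S'.card with h | h
  · rwa [min_eq_left h]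
  · rwa [min_eq_right h]

lemma min_add_le (r r' : ℝ) (hr : 0 ≤ r) (hr' : 0 ≤ r') : (r + r') * min r r' ≤ 2 * (r * r') := by
  rcases le_total r r' with h | h
  · rw [min_eq_left h]; nlinarith
  · rw [min_eq_right h]; nlinarith

lemma off_sum (a b : ℝ) (T P N τ : ℕ) (hp : Par a b T P N τ) (x0 lam : ℝ) (hl0 : 0 ≤ lam)
    (hx0 : 0 ≤ x0) (hx1 : x0 + lam ≤ 1) (hlT : (N:ℝ) + 1 ≤ lam * T)
    (A A' h h' Y : ℕ) (hA : (P:ℝ) ^ 2 ≤ A) (hA2 : (A:ℝ) ≤ (P:ℝ) ^ 2 * T) (hA' : (P:ℝ) ^ 2 ≤ A')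
    (hA2' : (A':ℝ) ≤ (P:ℝ) ^ 2 * T)
    (hh : 1 ≤ h) (hh' : 1 ≤ h') (hhT : h ≤ T) (hhT' : h' ≤ T) (hP : (1:ℝ) ≤ P)
    (ρ ρ' s : ℝ) (hs : 0 < s) (hρ : ρ = 8 * h / (A ^ 2 * s)) (hρ' : ρ' = 8 * h' / (A' ^ 2 * s))
    (hD : A * A' * (ρ + ρ') ≤ 4 * T ^ 2) :
    ∑ w ∈ PPs a b x0 lam A h Y, ∑ w' ∈ PPs a b x0 lam A' h' Y,
      (if w.1 * w'.2 - w.2 * w'.1 ≠ 0 ∧ |(w.1:ℝ) / w.2 - w'.1 / w'.2| ≤ ρ + ρ'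
        then 2 * min ρ ρ' else 0) ≤ 51200000000 * lam / s ^ 2 := by
  classical
  have hAp : (0:ℝ) < A := by nlinarith
  have hAp' : (0:ℝ) < A' := by nlinarith
  have hhr : (1:ℝ) ≤ h := by exact_mod_cast hh
  have hhr' : (1:ℝ) ≤ h' := by exact_mod_cast hh'
  have hρ0 : 0 < ρ := by rw [hρ]; positivity
  have hρ0' : 0 < ρ' := by rw [hρ']; positivity
  rw [← Finset.sum_product', ← Finset.sum_filter, Finset.sum_const, nsmul_eq_mul]
  set E := (PPs a b x0 lam A h Y ×ˢ PPs a b x0 lam A' h' Y).filter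
    (fun w => w.1.1 * w.2.2 - w.1.2 * w.2.1 ≠ 0 ∧ |(w.1.1:ℝ) / w.1.2 - w.2.1 / w.2.2| ≤ ρ + ρ') with hE
  have hEp : ∀ e ∈ E, WCond a b x0 lam A h e.1 ∧ WCond a b x0 lam A' h' e.2 ∧
      e.1.1 * e.2.2 - e.1.2 * e.2.1 ≠ 0 ∧
      |((e.1.1 * e.2.2 - e.1.2 * e.2.1 : ℤ):ℝ)| ≤ A * A' * (ρ + ρ') := by
    intro e he
    rw [hE, Finset.mem_filter, Finset.mem_product, mem_PPs, mem_PPs] at he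
    obtain ⟨⟨⟨⟨-, h1, h2⟩, h3⟩, ⟨-, h1', h2'⟩, h3'⟩, h4, h5⟩ := he
    refine ⟨h3.1, h3'.1, h4, ?_⟩
    have q1 : (1:ℝ) ≤ e.1.2 := by exact_mod_cast h1
    have q1' : (1:ℝ) ≤ e.2.2 := by exact_mod_cast h1'
    have q2 : (e.1.2:ℝ) ≤ A := by exact_mod_cast h2
    have q2' : (e.2.2:ℝ) ≤ A' := by exact_mod_cast h2'
    have : ((e.1.1 * e.2.2 - e.1.2 * e.2.1 : ℤ):ℝ) =
        e.1.2 * e.2.2 * ((e.1.1:ℝ) / e.1.2 - e.2.1 / e.2.2) := by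
      push_cast; field_simp
    rw [this, abs_mul, abs_of_pos (by positivity : (0:ℝ) < e.1.2 * e.2.2)]
    gcongr
  have hrhs : 0 ≤ 51200000000 * lam / s ^ 2 := by positivity
  by_cases hD1 : 1 ≤ A * A' * (ρ + ρ')
  · have hc := pair_bound a b T P N τ hp x0 lam hl0 hx0 hx1 hlT A A' _ hA hA2 hA' hA2' hD1 hD h h' hh hh'
      hhT hhT' E hEp
    have hm0 : 0 ≤ min ρ ρ' := le_min hρ0.le hρ0'.le
    calc (E.card : ℝ) * (2 * min ρ ρ') ≤ 200000000 * lam * (A * A' * (A * A' * (ρ + ρ'))) / (h * h') *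
          (2 * min ρ ρ') := by gcongr
      _ = 200000000 * lam * (A * A') ^ 2 / (h * h') * 2 * ((ρ + ρ') * min ρ ρ') := by ring
      _ ≤ 200000000 * lam * (A * A') ^ 2 / (h * h') * 2 * (2 * (ρ * ρ')) := by
          exact mul_le_mul_of_nonneg_left (min_add_le ρ ρ' hρ0.le hρ0'.le) (by positivity)
      _ = 51200000000 * lam / s ^ 2 := by
          rw [hρ, hρ']; field_simp; ring
  · have : E = ∅ := by
      rw [Finset.eq_empty_iff_forall_notMem]
      intro e he
      obtain ⟨-, -, h3, h4⟩ := hEp e he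
      apply hD1
      refine le_trans ?_ h4
      exact_mod_cast Int.one_le_abs h3
    rw [this]; simpa using hrhs

/-- bound for a fixed pair of scales -/
lemma pair_total (a b : ℝ) (T P N τ : ℕ) (hp : Par a b T P N τ) (x0 lam : ℝ) (hl0 : 0 ≤ lam)
    (hx0 : 0 ≤ x0) (hx1 : x0 + lam ≤ 1) (hlT : (N:ℝ) + 1 ≤ lam * T)
    (C0 : ℕ) (δ : ℝ) (hdc : DC a b C0 δ) (hsm : (T:ℝ) ^ (3 * C0 + 1) ≤ 2 * δ * P)
    (hlP : 3 ≤ lam * P)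
    (A A' h h' Y : ℕ) (hA : P ^ 2 ≤ A) (hA2 : A ≤ P ^ 2 * T) (hA' : P ^ 2 ≤ A')
    (hA2' : A' ≤ P ^ 2 * T)
    (hh : 1 ≤ h) (hh' : 1 ≤ h') (hhT : h ≤ T) (hhT' : h' ≤ T) (hP : 1 ≤ P)
    (hY : (Y:ℝ) * (1 / (8 * h)) ≤ 1 / 4) (hY' : (Y:ℝ) * (1 / (8 * h')) ≤ 1 / 4)
    (ρ ρ' s : ℝ) (hs : 0 < s) (hρ : ρ = 8 * h / (A ^ 2 * s)) (hρ' : ρ' = 8 * h' / (A' ^ 2 * s))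
    (hD : A * A' * (ρ + ρ') ≤ 4 * T ^ 2) (hAA : A = A' ∨ 4096 * A ≤ A' ∨ 4096 * A' ≤ A) :
    ∑ w ∈ PPs a b x0 lam A h Y, ∑ w' ∈ PPs a b x0 lam A' h' Y,
      volume.real (Bw ρ w ∩ Bw ρ' w') ≤ 51200000000 * lam / s ^ 2 +
        (if A = A' then 512 * lam / s * (min h h' / max h h' : ℝ) else 0) := by
  classical
  have hPr : (1:ℝ) ≤ P := by exact_mod_cast hP
  have hAr : (P:ℝ) ^ 2 ≤ A := by exact_mod_cast hA
  have hAr' : (P:ℝ) ^ 2 ≤ A' := by exact_mod_cast hA'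
  have hAp : (0:ℝ) < A := by nlinarith
  have hAp' : (0:ℝ) < A' := by nlinarith
  have hhr : (1:ℝ) ≤ h := by exact_mod_cast hh
  have hhr' : (1:ℝ) ≤ h' := by exact_mod_cast hh'
  have hρ0 : 0 < ρ := by rw [hρ]; positivity
  have hρ0' : 0 < ρ' := by rw [hρ']; positivity
  have hm0 : 0 ≤ 2 * min ρ ρ' := by have := le_min hρ0.le hρ0'.le; linarith
  have key : ∀ w ∈ PPs a b x0 lam A h Y, ∀ w' ∈ PPs a b x0 lam A' h' Y,
      volume.real (Bw ρ w ∩ Bw ρ' w') ≤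
      (if w.1 * w'.2 - w.2 * w'.1 ≠ 0 ∧ |(w.1:ℝ) / w.2 - w'.1 / w'.2| ≤ ρ + ρ'
        then 2 * min ρ ρ' else 0) + (if w = w' then 2 * min ρ ρ' else 0) := by
    intro w hw w' hw'
    refine (inter_le _ _ ρ ρ' hρ0.le hρ0'.le).trans ?_
    by_cases hc : w.1 * w'.2 - w.2 * w'.1 = 0
    · have := diag_eq a b x0 lam A A' h h' Y w w' hw hw' hY hY' hc
      rw [if_pos this]
      split_ifs <;> linarith
    · by_cases hd : |(w.1:ℝ) / w.2 - w'.1 / w'.2| ≤ ρ + ρ'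
      · rw [if_pos hd, if_pos ⟨hc, hd⟩]; split_ifs <;> linarith
      · rw [if_neg hd]; split_ifs <;> linarith
  have h1 := Finset.sum_le_sum fun w hw => Finset.sum_le_sum (key w hw)
  simp_rw [Finset.sum_add_distrib] at h1
  have hoff := off_sum a b T P N τ hp x0 lam hl0 hx0 hx1 hlT A A' h h' Y hAr (by exact_mod_cast hA2)
    hAr' (by exact_mod_cast hA2') hh hh' hhT hhT' hPr ρ ρ' s hs hρ hρ' hD
  refine h1.trans (add_le_add hoff ?_)
  split_ifs with hE
  · refine (diag_sum _ _ _ hm0).trans ?_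
    have c1 := PPs_card_le a b C0 δ hdc P h A T Y hP hh hhT hsm x0 lam hl0 hx0 hx1 hlP hA
    have c2 := PPs_card_le a b C0 δ hdc P h' A' T Y hP hh' hhT' hsm x0 lam hl0 hx0 hx1 hlP hA'
    subst hE
    rcases le_total h h' with hc | hc
    · have hcr : (h:ℝ) ≤ h' := by exact_mod_cast hc
      rw [min_eq_left hc, max_eq_right hc]
      calc _ ≤ (32 * lam * A ^ 2 / h') * (2 * ρ) := by
            gcongr
            · refine le_trans ?_ c2
              exact_mod_cast min_le_right _ _
            · exact min_le_left _ _
        _ = _ := by rw [hρ]; field_simp; ring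
    · have hcr : (h':ℝ) ≤ h := by exact_mod_cast hc
      rw [min_eq_right hc, max_eq_left hc]
      calc _ ≤ (32 * lam * A ^ 2 / h) * (2 * ρ') := by
            gcongr
            · refine le_trans ?_ c1
              exact_mod_cast min_le_left _ _
            · exact min_le_right _ _
        _ = _ := by rw [hρ']; field_simp; ring
  · refine le_of_eq (Finset.sum_eq_zero fun w hw => Finset.sum_eq_zero fun w' hw' => ?_)
    rw [if_neg]
    rintro rfl
    rw [mem_PPs] at hw hw'
    obtain ⟨-, ⟨g1, g2, -⟩, -⟩ := hw
    obtain ⟨-, ⟨g1', g2', -⟩, -⟩ := hw'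
    rcases hAA with hq | hq | hq
    · exact hE hq
    · have : (4096:ℝ) * A ≤ A' := by exact_mod_cast hq
      linarith
    · have : (4096:ℝ) * A' ≤ A := by exact_mod_cast hq
      linarith



def Asc (N i : ℕ) : ℕ := 2 ^ (2 * N + 12 * i)
def hsc (σ j : ℕ) : ℕ := 2 ^ (12 * σ + j - 3)
def rsc (σ N : ℕ) (ξ : ℕ × ℕ) : ℝ := 8 * (hsc σ ξ.2 : ℝ) / ((Asc N ξ.1 : ℝ) ^ 2 * (σ:ℝ) ^ 2)

lemma eight_hsc (σ j : ℕ) (hσ : 1 ≤ σ) : 8 * hsc σ j = 2 ^ (12 * σ + j) := by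
  unfold hsc
  rw [show (8:ℕ) = 2 ^ 3 by norm_num, ← pow_add]
  congr 1; omega

lemma half_ratio (σ j j' : ℕ) (hσ : 1 ≤ σ) :
    (((min (hsc σ j) (hsc σ j') : ℕ):ℝ) / ((max (hsc σ j) (hsc σ j') : ℕ):ℝ)) =
      (1 / 2) ^ ((j - j') + (j' - j)) := by
  rcases le_total j j' with h | h
  · have h2 : hsc σ j ≤ hsc σ j' := Nat.pow_le_pow_right (by norm_num) (by omega)
    rw [min_eq_left h2, max_eq_right h2]
    have : hsc σ j' = hsc σ j * 2 ^ ((j - j') + (j' - j)) := by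
      unfold hsc; rw [← pow_add]; congr 1; omega
    rw [this]
    have h3 : (0:ℝ) < hsc σ j := by unfold hsc; positivity
    push_cast
    rw [one_div, inv_pow]
    field_simp
  · have h2 : hsc σ j' ≤ hsc σ j := Nat.pow_le_pow_right (by norm_num) (by omega)
    rw [min_eq_right h2, max_eq_left h2]
    have : hsc σ j = hsc σ j' * 2 ^ ((j - j') + (j' - j)) := by
      unfold hsc; rw [← pow_add]; congr 1; omega
    rw [this]
    have h3 : (0:ℝ) < hsc σ j' := by unfold hsc; positivity
    push_cast
    rw [one_div, inv_pow]
    field_simp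

lemma D_half (N σ i i' j : ℕ) (hσ : 1 ≤ σ) (hi : i < σ) (hi' : i' < σ) (hj : j < σ) :
    (Asc N i : ℝ) * Asc N i' * rsc σ N (i, j) ≤ 2 * ((2 ^ (24 * σ) : ℕ):ℝ) ^ 2 := by
  unfold rsc
  have h8 : (8:ℝ) * hsc σ j = 2 ^ (12 * σ + j) := by exact_mod_cast eight_hsc σ j hσ
  rw [h8]
  have hA : (0:ℝ) < Asc N i := by unfold Asc; positivity
  have hσr : (1:ℝ) ≤ σ := by exact_mod_cast hσ
  have e : (Asc N i : ℝ) * Asc N i' * (2 ^ (12 * σ + j) / ((Asc N i : ℝ) ^ 2 * (σ:ℝ) ^ 2)) =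
      (Asc N i' * 2 ^ (12 * σ + j)) / (Asc N i * (σ:ℝ) ^ 2) := by field_simp
  simp only
  rw [e, div_le_iff₀ (by positivity)]
  have h1 : (Asc N i' : ℝ) * 2 ^ (12 * σ + j) ≤ ((2 ^ (24 * σ) : ℕ):ℝ) ^ 2 * Asc N i := by
    unfold Asc
    push_cast
    rw [← pow_add, ← pow_mul, ← pow_add]
    exact pow_le_pow_right₀ (by norm_num) (by omega)
  have h2 : (1:ℝ) ≤ (σ:ℝ) ^ 2 := one_le_pow₀ hσr
  have h3 : 0 ≤ ((2 ^ (24 * σ) : ℕ):ℝ) ^ 2 * Asc N i := by positivity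
  nlinarith

set_option maxHeartbeats 1000000 in
lemma union_lower (a b : ℝ) (C0 : ℕ) (δ : ℝ) (hdc : DC a b C0 δ) (σ T P N : ℕ) (hσ : 1 ≤ σ)
    (hp : Par a b T P N (24 * σ)) (hsm : (T:ℝ) ^ (3 * C0 + 1) ≤ 2 * δ * P)
    (x0 lam : ℝ) (hl0 : 0 < lam) (hx0 : 0 ≤ x0) (hx1 : x0 + lam ≤ 1)
    (hlT : (N:ℝ) + 1 ≤ lam * T) (hlY : 2 ^ 26 ≤ lam * (2 ^ (12 * σ - 2) : ℕ)) :
    lam / 10 ^ 20 ≤ volume.real (⋃ z ∈ (Finset.range σ ×ˢ Finset.range σ).sigma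
      (fun ξ => PPs a b x0 lam (Asc N ξ.1) (hsc σ ξ.2) (2 ^ (12 * σ - 2))), Bw (rsc σ N z.1) z.2) := by
  classical
  have hT : T = 2 ^ (24 * σ) := hp.hT
  have hP : P = 2 ^ N := hp.hP
  have hN : 60 * (24 * σ) ≤ N := by
    have := hp.hTP
    rw [hT, hP, ← pow_mul] at this
    have := (Nat.pow_le_pow_iff_right (by norm_num : 1 < 2)).mp this
    linarith
  have hP1 : 1 ≤ P := by rw [hP]; exact Nat.one_le_two_pow
  have hTP1 : T ≤ P := by rw [hT, hP]; exact Nat.pow_le_pow_right (by norm_num) (by omega)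
  have hTP3 : T ^ 3 ≤ P := by
    rw [hT, hP, ← pow_mul]; exact Nat.pow_le_pow_right (by norm_num) (by omega)
  have hlP : 3 ≤ lam * P := by
    have h1 : (T:ℝ) ≤ P := by exact_mod_cast hTP1
    have h2 : (3:ℝ) ≤ (N:ℝ) + 1 := by
      have : (3:ℕ) ≤ N + 1 := by omega
      exact_mod_cast this
    nlinarith
  have hσr : (1:ℝ) ≤ σ := by exact_mod_cast hσ
  set s : ℝ := (σ:ℝ) ^ 2 with hs
  have hs0 : 0 < s := by positivity
  set Y : ℕ := 2 ^ (12 * σ - 2) with hY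
  have hYT : Y ≤ T := by rw [hT, hY]; exact Nat.pow_le_pow_right (by norm_num) (by omega)
  have fA1 : ∀ i, P ^ 2 ≤ Asc N i := by
    intro i; unfold Asc; rw [hP, ← pow_mul]; exact Nat.pow_le_pow_right (by norm_num) (by omega)
  have fA2 : ∀ i, i < σ → Asc N i ≤ P ^ 2 * T := by
    intro i hi; unfold Asc; rw [hP, hT, ← pow_mul, ← pow_add]
    exact Nat.pow_le_pow_right (by norm_num) (by omega)
  have fA3 : ∀ i, (0:ℝ) < Asc N i := by intro i; unfold Asc; positivity
  have fh1 : ∀ j, 1 ≤ hsc σ j := fun j => Nat.one_le_two_pow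
  have fh2 : ∀ j, j < σ → hsc σ j ≤ T := by
    intro j hj; unfold hsc; rw [hT]; exact Nat.pow_le_pow_right (by norm_num) (by omega)
  have fh3 : ∀ j, (0:ℝ) < hsc σ j := by intro i; unfold hsc; positivity
  have fY : ∀ j, (Y:ℝ) * (1 / (8 * hsc σ j)) ≤ 1 / 4 := by
    intro j
    have h3 := fh3 j
    have : 4 * Y ≤ 8 * hsc σ j := by
      rw [eight_hsc σ j hσ, hY, show 4 = 2 ^ 2 by norm_num, ← pow_add]
      exact Nat.pow_le_pow_right (by norm_num) (by omega)
    have hr : 4 * (Y:ℝ) ≤ 8 * hsc σ j := by exact_mod_cast this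
    rw [mul_one_div, div_le_iff₀ (by positivity)]
    linarith
  have fr : ∀ ξ, 0 < rsc σ N ξ := by
    intro ξ; unfold rsc
    have := fA3 ξ.1; have := fh3 ξ.2; positivity
  set R := Finset.range σ ×ˢ Finset.range σ with hR
  have hRm : ∀ ξ ∈ R, ξ.1 < σ ∧ ξ.2 < σ := by
    intro ξ h; rw [hR, Finset.mem_product, Finset.mem_range, Finset.mem_range] at h; exact h
  have hRc : (R.card : ℝ) = s := by
    rw [hR, Finset.card_product, Finset.card_range, hs]; push_cast; ring
  set G : ℕ × ℕ → Finset (ℤ × ℤ) := fun ξ => PPs a b x0 lam (Asc N ξ.1) (hsc σ ξ.2) Y with hG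
  have hsm2 := second_moment_abs (R.sigma G) (fun z => Bw (rsc σ N z.1) z.2)
    (fun z => measurableSet_Icc) (fun z => by unfold Bw; simp) _ rfl
  set U := ⋃ z ∈ R.sigma G, Bw (rsc σ N z.1) z.2
  -- first moment
  have hfirst : lam / 16384 ≤ ∑ z ∈ R.sigma G, volume.real (Bw (rsc σ N z.1) z.2) := by
    rw [Finset.sum_sigma]
    have h1 : ∀ ξ ∈ R, lam / 16384 / s ≤ ∑ w ∈ G ξ, volume.real (Bw (rsc σ N ξ) w) := by
      intro ξ hξ
      obtain ⟨k1, k2⟩ := hRm ξ hξ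
      have hv : ∀ w ∈ G ξ, volume.real (Bw (rsc σ N ξ) w) = 2 * rsc σ N ξ := by
        intro w _
        unfold Bw
        rw [Real.volume_real_Icc_of_le (by have := fr ξ; linarith)]; ring
      rw [Finset.sum_congr rfl hv, Finset.sum_const, nsmul_eq_mul]
      have hfm := first_moment a b C0 δ hdc P (hsc σ ξ.2) (2 ^ (2 * N + 12 * ξ.1 - (12 * σ + ξ.2)))
        (Asc N ξ.1) T Y hP1 (fh1 _) (fh2 _ k2) Nat.one_le_two_pow
        (by rw [eight_hsc σ _ hσ, ← pow_add]; unfold Asc; congr 1; omega) (fA1 _) hTP3 hsm x0 lam hl0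
        hx0 hx1 hYT hlY
      have := fr ξ
      calc _ = lam * (Asc N ξ.1:ℝ) ^ 2 / (262144 * hsc σ ξ.2) * (2 * rsc σ N ξ) := by
            unfold rsc
            have := fA3 ξ.1; have := fh3 ξ.2
            rw [← hs]
            field_simp; norm_num
        _ ≤ _ := by gcongr
    calc lam / 16384 = ∑ ξ ∈ R, lam / 16384 / s := by
          rw [Finset.sum_const, nsmul_eq_mul, hRc]; field_simp
      _ ≤ _ := Finset.sum_le_sum h1
  -- second moment
  have hsecond : ∑ z ∈ R.sigma G, ∑ z' ∈ R.sigma G,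
      volume.real (Bw (rsc σ N z.1) z.2 ∩ Bw (rsc σ N z'.1) z'.2) ≤ 51200002048 * lam := by
    have e1 : ∑ z ∈ R.sigma G, ∑ z' ∈ R.sigma G,
        volume.real (Bw (rsc σ N z.1) z.2 ∩ Bw (rsc σ N z'.1) z'.2) =
        ∑ ξ ∈ R, ∑ ξ' ∈ R, ∑ w ∈ G ξ, ∑ w' ∈ G ξ',
          volume.real (Bw (rsc σ N ξ) w ∩ Bw (rsc σ N ξ') w') := by
      rw [Finset.sum_sigma]
      refine Finset.sum_congr rfl fun ξ _ => ?_
      rw [Finset.sum_comm, Finset.sum_sigma]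
      exact Finset.sum_congr rfl fun ξ' _ => Finset.sum_comm
    rw [e1]
    have h1 : ∀ ξ ∈ R, ∀ ξ' ∈ R, ∑ w ∈ G ξ, ∑ w' ∈ G ξ',
          volume.real (Bw (rsc σ N ξ) w ∩ Bw (rsc σ N ξ') w') ≤
        51200000000 * lam / s ^ 2 + (if ξ.1 = ξ'.1 then
          512 * lam / s * (1 / 2) ^ ((ξ.2 - ξ'.2) + (ξ'.2 - ξ.2)) else 0) := by
      intro ξ hξ ξ' hξ'
      obtain ⟨k1, k2⟩ := hRm ξ hξ
      obtain ⟨k1', k2'⟩ := hRm ξ' hξ'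
      have := pair_total a b T P N (24 * σ) hp x0 lam hl0.le hx0 hx1 hlT C0 δ hdc hsm hlP
        (Asc N ξ.1) (Asc N ξ'.1) (hsc σ ξ.2) (hsc σ ξ'.2) Y (fA1 _) (fA2 _ k1) (fA1 _) (fA2 _ k1')
        (fh1 _) (fh1 _) (fh2 _ k2) (fh2 _ k2') hP1 (fY _) (fY _) (rsc σ N ξ) (rsc σ N ξ') s hs0 rfl rfl
        (by
          have d1 := D_half N σ ξ.1 ξ'.1 ξ.2 hσ k1 k1' k2
          have d2 := D_half N σ ξ'.1 ξ.1 ξ'.2 hσ k1' k1 k2'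
          rw [← hT] at d1 d2
          simp only [Prod.mk.eta] at d1 d2
          linarith)
        (by
          rcases lt_trichotomy ξ.1 ξ'.1 with h | h | h
          · right; left; unfold Asc
            rw [show 4096 = 2 ^ 12 by norm_num, ← pow_add]
            exact Nat.pow_le_pow_right (by norm_num) (by omega)
          · left; rw [h]
          · right; right; unfold Asc
            rw [show 4096 = 2 ^ 12 by norm_num, ← pow_add]
            exact Nat.pow_le_pow_right (by norm_num) (by omega))
      refine this.trans (add_le_add le_rfl ?_)
      rw [half_ratio σ _ _ hσ]
      by_cases hq : ξ.1 = ξ'.1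
      · rw [if_pos (by rw [hq]), if_pos hq]
      · rw [if_neg hq, if_neg]
        intro hc
        unfold Asc at hc
        have := Nat.pow_right_injective (le_refl 2) hc
        omega
    refine (Finset.sum_le_sum fun ξ hξ => Finset.sum_le_sum (h1 ξ hξ)).trans ?_
    simp_rw [Finset.sum_add_distrib]
    have e2 : ∑ ξ ∈ R, ∑ ξ' ∈ R, 51200000000 * lam / s ^ 2 = 51200000000 * lam := by
      rw [Finset.sum_const, Finset.sum_const, nsmul_eq_mul, nsmul_eq_mul, hRc]; field_simp
    have e3 : ∀ ξ ∈ R, ∑ ξ' ∈ R, (if ξ.1 = ξ'.1 then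
          512 * lam / s * (1 / 2) ^ ((ξ.2 - ξ'.2) + (ξ'.2 - ξ.2)) else 0) ≤ 2048 * lam / s := by
      intro ξ hξ
      obtain ⟨k1, k2⟩ := hRm ξ hξ
      rw [hR, Finset.sum_product_right]
      simp only
      have : ∀ y ∈ Finset.range σ, ∑ x ∈ Finset.range σ, (if ξ.1 = x then
          512 * lam / s * (1 / 2) ^ ((ξ.2 - y) + (y - ξ.2)) else 0) =
          512 * lam / s * (1 / 2) ^ ((ξ.2 - y) + (y - ξ.2)) := by
        intro y _
        rw [Finset.sum_ite_eq, if_pos (Finset.mem_range.mpr k1)]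
      rw [Finset.sum_congr rfl this, ← Finset.mul_sum]
      calc _ ≤ 512 * lam / s * 4 := mul_le_mul_of_nonneg_left (geom_dist σ ξ.2) (by positivity)
        _ = _ := by ring
    have e4 : ∑ ξ ∈ R, 2048 * lam / s = 2048 * lam := by
      rw [Finset.sum_const, nsmul_eq_mul, hRc]; field_simp
    have := Finset.sum_le_sum e3
    rw [e2]
    linarith
  have hU0 : 0 ≤ volume.real U := measureReal_nonneg
  have h3 : (lam / 16384) ^ 2 ≤ volume.real U * (51200002048 * lam) := by
    calc _ ≤ (∑ z ∈ R.sigma G, volume.real (Bw (rsc σ N z.1) z.2)) ^ 2 := by gcongr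
      _ ≤ _ := hsm2
      _ ≤ _ := by gcongr
  have h4 : lam * (lam / 16384 ^ 2) ≤ lam * (volume.real U * 51200002048) := by
    calc _ = (lam / 16384) ^ 2 := by ring
      _ ≤ _ := h3
      _ = _ := by ring
  have h5 := le_of_mul_le_mul_left h4 hl0
  rw [div_le_iff₀ (by positivity)]
  rw [div_le_iff₀ (by positivity)] at h5
  nlinarith



open Filter Topology

def Eset (a b : ℝ) (N σ : ℕ) : Set ℝ :=
  {β | ∃ i j : ℕ, i < σ ∧ j < σ ∧ ∃ p q r : ℤ, 1 ≤ q ∧ q ≤ Asc N i ∧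
    |β - p / q| ≤ rsc σ N (i, j) ∧ |a * p + b * q - r| ≤ 1 / (8 * hsc σ j)}

lemma Eset_meas (a b : ℝ) (N σ : ℕ) : MeasurableSet (Eset a b N σ) := by
  have : Eset a b N σ = ⋃ (i : ℕ) (j : ℕ) (p : ℤ) (q : ℤ) (r : ℤ),
      {β : ℝ | (i < σ ∧ j < σ ∧ 1 ≤ q ∧ q ≤ Asc N i ∧ |a * p + b * q - r| ≤ 1 / (8 * hsc σ j)) ∧
        |β - p / q| ≤ rsc σ N (i, j)} := by
    ext β
    simp only [Eset, Set.mem_iUnion, Set.mem_setOf_eq]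
    constructor
    · rintro ⟨i, j, h1, h2, p, q, r, h3, h4, h5, h6⟩
      exact ⟨i, j, p, q, r, ⟨h1, h2, h3, h4, h6⟩, h5⟩
    · rintro ⟨i, j, p, q, r, ⟨h1, h2, h3, h4, h6⟩, h5⟩
      exact ⟨i, j, h1, h2, p, q, r, h3, h4, h5, h6⟩
  rw [this]
  refine MeasurableSet.iUnion fun i => MeasurableSet.iUnion fun j => MeasurableSet.iUnion fun p =>
    MeasurableSet.iUnion fun q => MeasurableSet.iUnion fun r => ?_
  refine MeasurableSet.inter (MeasurableSet.const _) ?_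
  exact measurableSet_le (f := fun β : ℝ => |β - (p:ℝ) / q|) (by fun_prop) measurable_const

def Nσ (C0 σ : ℕ) : ℕ := (120 * C0 + 121) * (24 * σ)

lemma ev_lin (C : ℝ) : ∀ᶠ σ : ℕ in atTop, C * ((σ:ℝ) + 1) ≤ 2 ^ σ := by
  have h1 := tendsto_pow_const_div_const_pow_of_one_lt 1 (by norm_num : (1:ℝ) < 2)
  have h2 : Tendsto (fun n : ℕ => (2 * |C|) * ((n:ℝ) ^ 1 / 2 ^ n)) atTop (𝓝 ((2 * |C|) * 0)) :=
    h1.const_mul _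
  rw [mul_zero] at h2
  filter_upwards [h2.eventually (gt_mem_nhds (by norm_num : (0:ℝ) < 1)), eventually_ge_atTop 1]
    with n hn hn1
  have hn1r : (1:ℝ) ≤ n := by exact_mod_cast hn1
  rw [pow_one, ← mul_div_assoc, div_lt_one (by positivity)] at hn
  have : C ≤ |C| := le_abs_self C
  have h0 : 0 ≤ |C| := abs_nonneg C
  nlinarith

lemma DC_nu (a b : ℝ) (C0 : ℕ) (δ : ℝ) (hdc : DC a b C0 δ) (T P : ℕ) (hT : 1 ≤ T)
    (hP : P = T ^ (120 * C0 + 121)) (hδ : 2 < δ * T) (q : ℕ) (hq : 1 ≤ q) (hq2 : q ≤ (T ^ 60) ^ 2) :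
    2 * (T ^ 60 : ℕ) * ((T:ℝ) ^ 60 / P) < max (dn (q * a)) (dn (q * b)) := by
  have hTr : (1:ℝ) ≤ T := by exact_mod_cast hT
  have h1 := hdc.2 q hq
  set m := max (dn (q * a)) (dn (q * b)) with hm
  have hq2r : (q:ℝ) ≤ ((T:ℝ) ^ 60) ^ 2 := by exact_mod_cast hq2
  have hqC : (q:ℝ) ^ C0 ≤ (((T:ℝ) ^ 60) ^ 2) ^ C0 := by gcongr
  have hqp : (0:ℝ) < (q:ℝ) ^ C0 := by positivity
  have hm0 : 0 < m := by
    by_contra hh; push Not at hh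
    have := hdc.1
    nlinarith
  have h2 : δ ≤ (((T:ℝ) ^ 60) ^ 2) ^ C0 * m := h1.trans (by gcongr)
  have hPr : (P:ℝ) = (((T:ℝ) ^ 60) ^ 2) ^ C0 * ((T:ℝ) ^ 60) ^ 2 * T := by
    rw [hP]; push_cast; rw [← pow_mul, ← pow_mul, ← pow_mul, ← pow_add, ← pow_succ]
    congr 1; ring
  have hTp : (0:ℝ) < T := by linarith
  set V := (((T:ℝ) ^ 60) ^ 2) ^ C0 with hV
  have hV0 : 0 < V := by positivity
  set W := (T:ℝ) ^ 60 with hW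
  have hW0 : 0 < W := by positivity
  push_cast
  rw [← hW, hPr]
  have : 2 * W * (W / (V * W ^ 2 * T)) = 2 / (V * T) := by field_simp
  rw [this, div_lt_iff₀ (by positivity)]
  nlinarith

lemma big (a b : ℝ) (C0 : ℕ) (δ : ℝ) (hdc : DC a b C0 δ) (lam : ℝ) (hl0 : 0 < lam) :
    ∀ᶠ σ : ℕ in atTop, 1 ≤ σ ∧ Par a b (2 ^ (24 * σ)) (2 ^ (Nσ C0 σ)) (Nσ C0 σ) (24 * σ) ∧
      ((2 ^ (24 * σ) : ℕ):ℝ) ^ (3 * C0 + 1) ≤ 2 * δ * (2 ^ (Nσ C0 σ) : ℕ) ∧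
      ((Nσ C0 σ : ℕ):ℝ) + 1 ≤ lam * (2 ^ (24 * σ) : ℕ) ∧
      2 ^ 26 ≤ lam * (2 ^ (12 * σ - 2) : ℕ) ∧
      ∀ i j, i < σ → j < σ → rsc σ (Nσ C0 σ) (i, j) ≤ lam := by
  have hδ := hdc.1
  obtain ⟨K, hK⟩ : ∃ K : ℕ, K = 120 * C0 + 121 := ⟨_, rfl⟩
  filter_upwards [ev_lin (3 / δ), ev_lin (24 * K / lam + 1 / lam), ev_lin (8 + 2 * 24 * K + 12 * 24),
    ev_lin (2 ^ 26 / lam), eventually_ge_atTop 1] with σ e1 e2 e3 e4 hσ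
  have hσr : (1:ℝ) ≤ σ := by exact_mod_cast hσ
  have hN : Nσ C0 σ = K * (24 * σ) := by rw [hK]; rfl
  have h24 : (2:ℝ) ^ σ ≤ 2 ^ (24 * σ) := pow_le_pow_right₀ (by norm_num) (by omega)
  have hP : 2 ^ (Nσ C0 σ) = (2 ^ (24 * σ)) ^ K := by rw [hN, ← pow_mul]; congr 1; ring
  have hT1 : 1 ≤ 2 ^ (24 * σ) := Nat.one_le_two_pow
  have hδT : 2 < δ * ((2 ^ (24 * σ) : ℕ):ℝ) := by
    push_cast
    rw [div_mul_eq_mul_div, div_le_iff₀ hδ] at e1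
    clear hP hT1 hN e2 e3 e4
    generalize (2:ℝ) ^ (24 * σ) = T at *
    generalize (2:ℝ) ^ σ = S at *
    nlinarith
  have h2p : (0:ℝ) < 2 ^ σ := by positivity
  refine ⟨hσ, ⟨rfl, rfl, ?_, ?_, ?_⟩, ?_, ?_, ?_, ?_⟩
  · rw [hP]; exact Nat.pow_le_pow_right (by positivity) (by omega)
  · have : (8:ℝ) + 2 * (K * (24 * σ)) + 12 * (24 * σ) ≤ 2 ^ (24 * σ) := by
      have hK0 : (0:ℝ) ≤ K := by positivity
      have : 0 ≤ (K:ℝ) * σ := by positivity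
      clear hP hT1 hN e1 e2 e4 hδT hK
      generalize (2:ℝ) ^ (24 * σ) = T at *
      generalize (2:ℝ) ^ σ = S at *
      nlinarith
    rw [hN]
    exact_mod_cast this
  · intro q hq hq2
    rw [hK] at hP
    exact DC_nu a b C0 δ hdc _ _ hT1 hP hδT q hq hq2
  · rw [hP]
    push_cast at hδT ⊢
    have hTr : (1:ℝ) ≤ 2 ^ (24 * σ) := one_le_pow₀ (by norm_num)
    set T : ℝ := 2 ^ (24 * σ)
    have : T ^ (3 * C0 + 1) ≤ T ^ (120 * C0 + 120) := pow_le_pow_right₀ hTr (by omega)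
    have h0 : 0 ≤ T ^ (120 * C0 + 120) := by positivity
    rw [hK, pow_succ T (120 * C0 + 120)]
    clear hP hT1 hN e1 e2 e3 e4 h24
    clear_value T
    generalize T ^ (120 * C0 + 120) = X at *
    nlinarith
  · rw [hN]; push_cast
    rw [← add_div, div_mul_eq_mul_div, div_le_iff₀ hl0] at e2
    have hK0 : (0:ℝ) ≤ K := by positivity
    clear hP hT1 hN e1 e3 e4 hδT hK
    generalize (2:ℝ) ^ (24 * σ) = T at *
    generalize (2:ℝ) ^ σ = S at *
    have : 0 ≤ (K:ℝ) * σ := by positivity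
    nlinarith
  · push_cast
    have : (2:ℝ) ^ σ ≤ 2 ^ (12 * σ - 2) := pow_le_pow_right₀ (by norm_num) (by omega)
    rw [div_mul_eq_mul_div, div_le_iff₀ hl0] at e4
    clear hP hT1 hN e1 e2 e3 hδT h24
    generalize (2:ℝ) ^ (12 * σ - 2) = T at *
    generalize (2:ℝ) ^ σ = S at *
    nlinarith
  · intro i j hi hj
    unfold rsc
    have h8 : (8:ℝ) * hsc σ j = 2 ^ (12 * σ + j) := by exact_mod_cast eight_hsc σ j hσ
    simp only
    rw [h8]
    have hA : (2:ℝ) ^ (14 * σ) ≤ (Asc (Nσ C0 σ) i : ℝ) ^ 2 := by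
      unfold Asc; push_cast; rw [← pow_mul]
      refine pow_le_pow_right₀ (by norm_num) ?_
      have : 121 * (24 * σ) ≤ Nσ C0 σ := by rw [hN]; exact Nat.mul_le_mul_right _ (by omega)
      omega
    have hs : (1:ℝ) ≤ (σ:ℝ) ^ 2 := one_le_pow₀ hσr
    have h1 : (2:ℝ) ^ (12 * σ + j) ≤ 2 ^ (13 * σ) := pow_le_pow_right₀ (by norm_num) (by omega)
    have h2 : (2:ℝ) ^ (14 * σ) = 2 ^ (13 * σ) * 2 ^ σ := by rw [← pow_add]; congr 1; ring
    rw [div_mul_eq_mul_div, div_le_iff₀ hl0] at e4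
    have h3 : 1 ≤ lam * 2 ^ σ := by
      clear hP hT1 hN e1 e2 e3 hδT h24 h1 h2 hA
      generalize (2:ℝ) ^ σ = S at *
      nlinarith
    have h4 : (0:ℝ) < 2 ^ (13 * σ) := by positivity
    have h5 : (0:ℝ) < 2 ^ (14 * σ) := by positivity
    have hAp : (0:ℝ) < (Asc (Nσ C0 σ) i : ℝ) ^ 2 := h5.trans_le hA
    rw [div_le_iff₀ (by positivity)]
    calc (2:ℝ) ^ (12 * σ + j) ≤ 2 ^ (13 * σ) * 1 := by linarith
      _ ≤ 2 ^ (13 * σ) * (lam * 2 ^ σ) := by gcongr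
      _ = lam * (2 ^ (14 * σ) * 1) := by rw [h2]; ring
      _ ≤ lam * ((Asc (Nσ C0 σ) i : ℝ) ^ 2 * (σ:ℝ) ^ 2) := by gcongr

lemma E_lower (a b : ℝ) (C0 : ℕ) (δ : ℝ) (hdc : DC a b C0 δ) (x0 lam : ℝ) (hl0 : 0 < lam)
    (hx0 : 0 ≤ x0) (hx1 : x0 + lam ≤ 1) :
    ∀ᶠ σ : ℕ in atTop, ENNReal.ofReal (lam / 10 ^ 20) ≤
      volume (Eset a b (Nσ C0 σ) σ ∩ Set.Icc (x0 - lam) (x0 + 2 * lam)) := by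
  filter_upwards [big a b C0 δ hdc lam hl0] with σ ⟨hσ, hp, hsm, hlT, hlY, hr⟩
  have h := union_lower a b C0 δ hdc σ _ _ _ hσ hp hsm x0 lam hl0 hx0 hx1 hlT hlY
  refine (ENNReal.ofReal_le_ofReal h).trans ?_
  unfold Measure.real
  refine ENNReal.ofReal_toReal_le.trans (measure_mono ?_)
  intro β hβ
  simp only [Set.mem_iUnion, Finset.mem_sigma, Finset.mem_product, Finset.mem_range] at hβ
  obtain ⟨⟨ξ, w⟩, ⟨⟨k1, k2⟩, hw⟩, hB⟩ := hβ
  simp only at k1 k2 hw hB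
  rw [mem_PPs] at hw
  obtain ⟨⟨-, q1, q2⟩, ⟨-, -, w3, w4, -⟩, ⟨r, hr1, -⟩, -⟩ := hw
  unfold Bw at hB
  obtain ⟨b1, b2⟩ := hB
  have hrr := hr ξ.1 ξ.2 k1 k2
  simp only [Prod.mk.eta] at hrr
  have q1r : (0:ℝ) < w.2 := by exact_mod_cast (by omega : 0 < w.2)
  refine ⟨⟨ξ.1, ξ.2, k1, k2, w.1, w.2, r, q1, q2, ?_, hr1⟩, ?_, ?_⟩
  · rw [abs_le]; constructor <;> simp only [Prod.mk.eta] <;> linarith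
  · have : x0 ≤ (w.1:ℝ) / w.2 := by rw [le_div_iff₀ q1r]; exact w3
    linarith
  · have : (w.1:ℝ) / w.2 ≤ x0 + lam := by rw [div_le_iff₀ q1r]; exact w4
    linarith



lemma limsup_lower (E : ℕ → Set ℝ) (hE : ∀ n, MeasurableSet (E n)) (J : Set ℝ) (hJ : MeasurableSet J)
    (hJf : volume J ≠ ⊤) (c : ENNReal) (h : ∀ᶠ n in atTop, c ≤ volume (E n ∩ J)) :
    c ≤ volume ({x | ∃ᶠ n in atTop, x ∈ E n} ∩ J) := by
  set s : ℕ → Set ℝ := fun n => ⋃ m ∈ Set.Ici n, (E m ∩ J) with hs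
  have hss : {x | ∃ᶠ n in atTop, x ∈ E n} ∩ J = ⋂ n, s n := by
    ext x
    simp only [hs, Set.mem_inter_iff, Set.mem_setOf_eq, Set.mem_iInter, Set.mem_iUnion, Set.mem_Ici,
      frequently_atTop]
    constructor
    · rintro ⟨h1, h2⟩ n
      obtain ⟨m, hm, hx⟩ := h1 n
      exact ⟨m, hm, hx, h2⟩
    · intro h1
      refine ⟨fun n => ?_, ?_⟩
      · obtain ⟨m, hm, hx, -⟩ := h1 n
        exact ⟨m, hm, hx⟩
      · obtain ⟨m, hm, -, hx⟩ := h1 0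
        exact hx
  rw [hss]
  have hsub : ∀ n, s n ⊆ J := fun n => by
    simp only [hs]
    exact Set.iUnion₂_subset fun _ _ => Set.inter_subset_right
  have ht : Tendsto (volume ∘ s) atTop (𝓝 (volume (⋂ n, s n))) := by
    refine tendsto_measure_iInter_atTop ?_ ?_ ⟨0, ?_⟩
    · intro n
      exact (MeasurableSet.biUnion (Set.to_countable _) fun m _ => (hE m).inter hJ).nullMeasurableSet
    · intro n m hnm
      simp only [hs]
      exact Set.biUnion_subset_biUnion_left (Set.Ici_subset_Ici.mpr hnm)
    · exact ((measure_mono (hsub 0)).trans_lt (lt_top_iff_ne_top.mpr hJf)).ne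
  refine ge_of_tendsto ht ?_
  filter_upwards [h] with n hn
  refine hn.trans (measure_mono ?_)
  simp only [hs]
  exact Set.subset_biUnion_of_mem (u := fun m => E m ∩ J) (Set.mem_Ici.mpr le_rfl)

lemma ae_freq (a b : ℝ) (C0 : ℕ) (δ : ℝ) (hdc : DC a b C0 δ) :
    ∀ᵐ β ∂(volume : Measure ℝ), β ∈ Set.Ioo (0:ℝ) 1 →
      ∃ᶠ σ : ℕ in atTop, β ∈ Eset a b (Nσ C0 σ) σ := by
  set L : Set ℝ := {x | ∃ᶠ σ : ℕ in atTop, x ∈ Eset a b (Nσ C0 σ) σ} with hL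
  have hLm : MeasurableSet L := by
    have : L = limsup (fun σ => Eset a b (Nσ C0 σ) σ) atTop := by
      ext x; rw [Filter.mem_limsup_iff_frequently_mem]; rfl
    rw [this]
    exact MeasurableSet.measurableSet_limsup fun n => Eset_meas _ _ _ _
  have hd := Besicovitch.ae_tendsto_measure_inter_div_of_measurableSet (volume : Measure ℝ) hLm
  filter_upwards [hd] with β hβ hβ01
  by_contra hnot
  have hnL : β ∉ L := hnot
  rw [Set.indicator_of_notMem hnL] at hβ
  have hlow : ∀ r : ℝ, 0 < r → r < β → r < 1 - β →
      ENNReal.ofReal (1 / (3 * 10 ^ 20)) ≤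
        volume (L ∩ Metric.closedBall β r) / volume (Metric.closedBall β r) := by
    intro r hr h1 h2
    have h := limsup_lower (fun σ => Eset a b (Nσ C0 σ) σ) (fun σ => Eset_meas _ _ _ _)
      (Metric.closedBall β r) measurableSet_closedBall measure_closedBall_lt_top.ne
      (ENNReal.ofReal ((2 * r / 3) / 10 ^ 20)) (by
        have := E_lower a b C0 δ hdc (β - r / 3) (2 * r / 3) (by linarith) (by linarith) (by linarith)
        rw [Real.closedBall_eq_Icc]
        rw [show β - r / 3 - 2 * r / 3 = β - r by ring, show β - r / 3 + 2 * (2 * r / 3) = β + r by ring]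
          at this
        exact this)
    rw [ENNReal.le_div_iff_mul_le (Or.inl ?_) (Or.inl measure_closedBall_lt_top.ne)]
    · refine le_trans (le_of_eq ?_) h
      rw [Real.volume_closedBall, ← ENNReal.ofReal_mul (by positivity)]
      congr 1; ring
    · rw [Real.volume_closedBall]
      simp [hr]
  have hpos : (0:ENNReal) < ENNReal.ofReal (1 / (3 * 10 ^ 20)) := by
    rw [ENNReal.ofReal_pos]; positivity
  have ev1 := hβ.eventually (gt_mem_nhds hpos)
  have ev2 : ∀ᶠ r : ℝ in 𝓝[>] 0, r < min β (1 - β) ∧ 0 < r := by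
    have hm : 0 < min β (1 - β) := lt_min hβ01.1 (by linarith [hβ01.2])
    exact (eventually_nhdsWithin_of_eventually_nhds (gt_mem_nhds hm)).and self_mem_nhdsWithin
  obtain ⟨r, hr1, hr2, hr3⟩ := (ev1.and ev2).exists
  exact absurd (hlow r hr3 (hr2.trans_le (min_le_left _ _)) (hr2.trans_le (min_le_right _ _)))
    (not_le.mpr hr1)



lemma DC_of_dioph (a b : ℝ) (hab : IsDiophantine a b) : ∃ C0 : ℕ, ∃ δ : ℝ, DC a b C0 δ := by
  obtain ⟨κ, hκ, δ, hδ, h⟩ := hab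
  obtain ⟨C0, hC⟩ := exists_nat_ge ((1:ℝ) / 2 + κ)
  refine ⟨C0, δ, hδ, fun q hq => (h q hq).trans ?_⟩
  have hq1 : (1:ℝ) ≤ q := by exact_mod_cast hq
  have hm : 0 ≤ max (dn (q * a)) (dn (q * b)) := le_max_of_le_left (dn_nonneg _)
  refine mul_le_mul_of_nonneg_right ?_ hm
  rw [← Real.rpow_natCast]
  exact Real.rpow_le_rpow_of_exponent_le hq1 hC

lemma DC_shift (a b : ℝ) (C0 : ℕ) (δ : ℝ) (h : DC a b C0 δ) (n : ℤ) :
    DC a (b + a * n) C0 (δ / (1 + |(n:ℝ)|)) := by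
  have hn : 0 ≤ |(n:ℝ)| := abs_nonneg _
  refine ⟨div_pos h.1 (by linarith), fun q hq => ?_⟩
  rw [div_le_iff₀ (by linarith)]
  refine (h.2 q hq).trans ?_
  rw [mul_assoc]
  refine mul_le_mul_of_nonneg_left ?_ (by positivity)
  have h1 : dn (q * a) ≤ max (dn (q * a)) (dn (q * (b + a * n))) := le_max_left _ _
  have h2 : dn (q * (b + a * n)) ≤ max (dn (q * a)) (dn (q * (b + a * n))) := le_max_right _ _
  have h3 : dn (q * b) ≤ dn (q * (b + a * n)) + |(n:ℝ)| * dn (q * a) := by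
    have := dn_sub_le (q * (b + a * n)) (n * (q * a))
    rw [show (q:ℝ) * (b + a * n) - n * (q * a) = q * b by ring] at this
    linarith [dn_int_mul_le n (q * a)]
  have h0 : 0 ≤ dn (q * a) := dn_nonneg _
  set M := max (dn (q * a)) (dn (q * (b + a * n)))
  refine max_le ?_ ?_
  · nlinarith
  · nlinarith

lemma mulVec_eq (t s y x : ℝ) (v : Fin 3 → ℝ) :
    (aM t s * uM y x).mulVec v = ![Real.exp t * (v 0 + y * v 2), Real.exp s * (v 1 + x * v 2),
      Real.exp (-t - s) * v 2] := by
  unfold aM uM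
  funext i
  fin_cases i <;>
  · simp [Matrix.mulVec, Matrix.mul_apply, dotProduct, Fin.sum_univ_three, Matrix.diagonal]
    try ring

lemma norm_lower (t s y x : ℝ) (ht : 0 ≤ t) (hs : 0 ≤ s) (v : Fin 3 → ℤ) (hv : v ≠ 0) :
    Real.exp (-t - s) ≤ ‖(aM t s * uM y x).mulVec fun i => (v i : ℝ)‖ := by
  set g := (aM t s * uM y x).mulVec fun i => (v i : ℝ) with hg
  rw [mulVec_eq] at hg
  have g0 : |Real.exp t * (v 0 + y * v 2)| ≤ ‖g‖ := by
    have := norm_le_pi_norm g 0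
    rw [hg] at this ⊢; simpa using this
  have g1 : |Real.exp s * (v 1 + x * v 2)| ≤ ‖g‖ := by
    have := norm_le_pi_norm g 1
    rw [hg] at this ⊢; simpa using this
  have g2 : |Real.exp (-t - s) * v 2| ≤ ‖g‖ := by
    have := norm_le_pi_norm g 2
    rw [hg] at this ⊢; simpa using this
  rw [abs_mul, abs_of_pos (Real.exp_pos _)] at g0 g1 g2
  have hint : ∀ z : ℤ, z ≠ 0 → (1:ℝ) ≤ |(z:ℝ)| := fun z hz => by exact_mod_cast Int.one_le_abs hz
  have e1 : Real.exp (-t - s) ≤ 1 := Real.exp_le_one_iff.mpr (by linarith)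
  have e2 := Real.one_le_exp ht
  have e3 := Real.one_le_exp hs
  have e0 := Real.exp_pos (-t - s)
  by_cases h2 : v 2 = 0
  · by_cases h1 : v 1 = 0
    · have h0 : v 0 ≠ 0 := by
        intro h0; apply hv; funext i; fin_cases i <;> simp [h0, h1, h2]
      have := hint _ h0
      rw [h2, Int.cast_zero, mul_zero, add_zero] at g0
      nlinarith
    · have := hint _ h1
      rw [h2, Int.cast_zero, mul_zero, add_zero] at g1
      nlinarith
  · have := hint _ h2
    nlinarith

lemma latDelta_ge (t s y x r0 : ℝ) (ht : 0 ≤ t) (hs : 0 ≤ s) (p q r : ℤ) (hq : 1 ≤ q)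
    (hr0 : 0 ≤ r0)
    (h0 : Real.exp t * |q * y - r| ≤ r0) (h1 : Real.exp s * |q * x - p| ≤ r0)
    (h2 : Real.exp (-t - s) * q ≤ r0) : Real.log (1 / r0) ≤ latDelta (aM t s * uM y x) := by
  set v : Fin 3 → ℤ := ![-r, -p, q] with hv
  have hvne : v ≠ 0 := by
    intro h
    have := congrFun h 2
    simp [hv] at this
    omega
  have hbdd : BddAbove (Set.range fun v : {v : Fin 3 → ℤ // v ≠ 0} =>
      Real.log (1 / ‖(aM t s * uM y x).mulVec fun i => ((v : Fin 3 → ℤ) i : ℝ)‖)) := by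
    refine ⟨t + s, ?_⟩
    rintro _ ⟨⟨w, hw⟩, rfl⟩
    simp only
    have := norm_lower t s y x ht hs w hw
    have hp := (Real.exp_pos (-t - s)).trans_le this
    rw [one_div, Real.log_inv]
    have := Real.log_le_log (Real.exp_pos _) this
    rw [Real.log_exp] at this
    linarith
  have hle := le_ciSup hbdd ⟨v, hvne⟩
  refine le_trans ?_ hle
  simp only
  have hlow := (Real.exp_pos (-t - s)).trans_le (norm_lower t s y x ht hs v hvne)
  refine Real.log_le_log (by
    have : 0 < r0 := lt_of_lt_of_le (by have : (0:ℝ) < q := by exact_mod_cast (by omega : 0 < q)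
                                        have := Real.exp_pos (-t - s); positivity) h2
    positivity) ?_
  refine one_div_le_one_div_of_le hlow ?_
  rw [pi_norm_le_iff_of_nonneg hr0]
  intro i
  rw [mulVec_eq, Real.norm_eq_abs]
  have hq0 : (0:ℝ) ≤ q := by exact_mod_cast (by omega : 0 ≤ q)
  fin_cases i
  · simp only [hv]
    simp only [Fin.zero_eta, Matrix.cons_val_zero, Matrix.cons_val]
    rw [abs_mul, abs_of_pos (Real.exp_pos _)]
    refine le_trans (le_of_eq ?_) h0
    congr 2
    push_cast; ring
  · simp only [hv]
    simp only [Fin.mk_one, Matrix.cons_val_one, Matrix.cons_val]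
    rw [abs_mul, abs_of_pos (Real.exp_pos _)]
    refine le_trans (le_of_eq ?_) h1
    congr 2
    push_cast; ring
  · simp only [hv]
    simp only [Fin.reduceFinMk, Matrix.cons_val]
    rw [abs_mul, abs_of_pos (Real.exp_pos _), abs_of_nonneg hq0]
    exact h2



/-- the deterministic step in terms of real parameters -/
lemma det_step (c X Z A S r0 y x : ℝ) (p q r : ℤ) (hq : 1 ≤ q) (hc : 1 ≤ c) (hX : 0 < X) (hZ : 1 ≤ Z)
    (hA : A = X * Z) (hS : 0 < S) (hr0 : 0 < r0) (hr1 : r0 ≤ 1) (hr3 : r0 ^ 3 * S = c) (hX2 : c * S ≤ X)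
    (hqA : (q:ℝ) ≤ A) (h0 : |q * y - r| ≤ c / X) (h1 : |q * x - p| ≤ 1 / (Z * S)) :
    ∃ t s : ℝ, 0 ≤ t ∧ 0 ≤ s ∧ Real.log (X / (c * S)) ≤ t ∧ t ≤ Real.log X ∧ s ≤ Real.log (Z * S) ∧
      Real.log (1 / r0) ≤ latDelta (aM t s * uM y x) := by
  have hr2 : r0 ^ 3 ≤ r0 := by
    calc r0 ^ 3 = r0 * (r0 * r0) := by ring
      _ ≤ r0 * 1 := by gcongr; nlinarith
      _ = r0 := mul_one _
  have hcS : 1 ≤ r0 * S := by nlinarith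
  have hZ0 : 0 < Z := by linarith
  have hc0 : 0 < c := by linarith
  have e1 : 0 < X * r0 / c := by positivity
  have e2 : 0 < Z * S * r0 := by positivity
  have hl1 : X / (c * S) ≤ X * r0 / c := by
    rw [div_le_div_iff₀ (by positivity) hc0]
    calc X * c = X * c * 1 := by ring
      _ ≤ X * c * (r0 * S) := by gcongr
      _ = _ := by ring
  have hl0 : 1 ≤ X / (c * S) := by rw [le_div_iff₀ (by positivity)]; linarith
  have ht0 : 0 ≤ Real.log (X / (c * S)) := Real.log_nonneg hl0
  have htl : Real.log (X / (c * S)) ≤ Real.log (X * r0 / c) :=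
    Real.log_le_log (by positivity) hl1
  have hs0 : 0 ≤ Real.log (Z * S * r0) := by
    apply Real.log_nonneg
    nlinarith
  have hex : Real.exp (-Real.log (X * r0 / c) - Real.log (Z * S * r0)) = r0 / A := by
    rw [← neg_add', ← Real.log_mul e1.ne' e2.ne', Real.exp_neg, Real.exp_log (by positivity), hA, ← hr3]
    field_simp
  refine ⟨Real.log (X * r0 / c), Real.log (Z * S * r0), ht0.trans htl, hs0, htl, ?_, ?_, ?_⟩
  · refine Real.log_le_log e1 ?_
    rw [div_le_iff₀ hc0]
    have : X * r0 ≤ X * 1 := by gcongr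
    nlinarith
  · refine Real.log_le_log e2 ?_
    have : 0 < Z * S := by positivity
    nlinarith
  · refine latDelta_ge _ _ y x r0 (ht0.trans htl) hs0 p q r hq hr0.le ?_ ?_ ?_
    · rw [Real.exp_log e1]
      calc X * r0 / c * |q * y - r| ≤ X * r0 / c * (c / X) := by gcongr
        _ = r0 := by field_simp
    · rw [Real.exp_log e2]
      calc Z * S * r0 * |q * x - p| ≤ Z * S * r0 * (1 / (Z * S)) := by gcongr
        _ = r0 := by field_simp
    · rw [hex]
      have hA0 : 0 < A := by rw [hA]; positivity
      rw [div_mul_eq_mul_div, div_le_iff₀ hA0]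
      gcongr

set_option maxHeartbeats 1000000 in
lemma E_to_lat (a b : ℝ) (C0 σ : ℕ) (β : ℝ) (n : ℤ) (hσ : 1 ≤ σ) (hcσ : (1 + |a|) ≤ σ)
    (hσ2 : (σ:ℝ) ^ 3 ≤ 2 ^ σ)
    (hβ : β - n ∈ Eset a (b + a * n) (Nσ C0 σ) σ) :
    ∃ t s : ℝ, 0 ≤ t ∧ 0 ≤ s ∧ (σ:ℝ) ≤ max t s ∧ max t s ≤ (48 * (120 * C0 + 121) + 14 : ℕ) * (σ:ℝ) ∧
      (2 * Real.log σ - Real.log (1 + |a|)) / 3 ≤ latDelta (aM t s * uM (a * β + b) β) := by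
  obtain ⟨i, j, hi, hj, p, q, r, hq1, hq2, h3, h4⟩ := hβ
  set N := Nσ C0 σ with hN
  have hNv : N = (120 * C0 + 121) * (24 * σ) := rfl
  have hN121 : 121 * (24 * σ) ≤ N := by rw [hNv]; exact Nat.mul_le_mul_right _ (by omega)
  set c : ℝ := 1 + |a| with hc
  have hc1 : 1 ≤ c := by rw [hc]; linarith [abs_nonneg a]
  have hσr : (1:ℝ) ≤ σ := by exact_mod_cast hσ
  set S : ℝ := (σ:ℝ) ^ 2 with hS
  have hS1 : 1 ≤ S := one_le_pow₀ hσr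
  obtain ⟨X, hX⟩ : ∃ X : ℝ, X = 2 ^ (12 * σ + j) := ⟨_, rfl⟩
  obtain ⟨Z, hZ⟩ : ∃ Z : ℝ, Z = 2 ^ (2 * N + 12 * i - (12 * σ + j)) := ⟨_, rfl⟩
  have hA : (Asc N i : ℝ) = X * Z := by
    rw [hX, hZ, ← pow_add]; unfold Asc; push_cast; congr 1; omega
  have hX0 : 0 < X := by rw [hX]; positivity
  have hZ1 : 1 ≤ Z := by rw [hZ]; exact one_le_pow₀ (by norm_num)
  have hXZ : X ≤ Z := by rw [hX, hZ]; exact pow_le_pow_right₀ (by norm_num) (by omega)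
  have h8 : (8:ℝ) * hsc σ j = X := by rw [hX]; exact_mod_cast eight_hsc σ j hσ
  rw [h8] at h4
  have hr : rsc σ N (i, j) = X / ((X * Z) ^ 2 * S) := by
    unfold rsc; simp only; rw [h8, hA]
  rw [hr] at h3
  have hq0 : (0:ℝ) < q := by exact_mod_cast (by omega : 0 < q)
  have hqA : (q:ℝ) ≤ X * Z := by rw [← hA]; exact_mod_cast hq2
  have hZ0 : 0 < Z := by linarith
  have hS0 : 0 < S := by linarith
  have k1 : |q * (β - n) - p| ≤ 1 / (Z * S) := by
    have : q * (β - n) - p = q * (β - n - p / q) := by field_simp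
    rw [this, abs_mul, abs_of_pos hq0]
    calc (q:ℝ) * |β - n - p / q| ≤ (X * Z) * (X / ((X * Z) ^ 2 * S)) := by gcongr
      _ = _ := by field_simp
  have k2 : |q * β - ((p + n * q : ℤ):ℝ)| ≤ 1 / (Z * S) := by
    refine le_trans (le_of_eq ?_) k1
    congr 1; push_cast; ring
  have k3 : |q * (a * β + b) - r| ≤ c / X := by
    have : q * (a * β + b) - r = (a * p + (b + a * n) * q - r) + a * (q * (β - n) - p) := by ring
    rw [this]
    calc _ ≤ |a * p + (b + a * n) * q - r| + |a * (q * (β - n) - p)| := abs_add_le _ _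
      _ = |a * p + (b + a * n) * q - r| + |a| * |q * (β - n) - p| := by rw [abs_mul]
      _ ≤ 1 / X + |a| * (1 / (Z * S)) := by gcongr
      _ ≤ 1 / X + |a| * (1 / X) := by
          gcongr
          nlinarith
      _ = c / X := by rw [hc]; ring
  have hcS : c * S ≤ 2 ^ σ := by
    refine le_trans ?_ hσ2
    rw [hS]
    calc c * (σ:ℝ) ^ 2 ≤ σ * (σ:ℝ) ^ 2 := by gcongr
      _ = _ := by ring
  have h2σ : (0:ℝ) < 2 ^ σ := by positivity
  have hXb : (2:ℝ) ^ (12 * σ) ≤ X := by rw [hX]; exact pow_le_pow_right₀ (by norm_num) (by omega)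
  have hXc : c * S ≤ X := by
    refine hcS.trans (le_trans ?_ hXb)
    exact pow_le_pow_right₀ (by norm_num) (by omega)
  have hc0 : 0 < c := by linarith
  have hcS1 : c ≤ S := by
    rw [hS, pow_two]; exact hcσ.trans (le_mul_of_one_le_left (by linarith) hσr)
  set r0 : ℝ := (c / S) ^ ((1:ℝ) / 3) with hr0
  have hr0p : 0 < r0 := Real.rpow_pos_of_pos (by positivity) _
  have hr01 : r0 ≤ 1 := Real.rpow_le_one (by positivity) (by rw [div_le_one hS0]; exact hcS1) (by norm_num)
  have hr03 : r0 ^ 3 * S = c := by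
    rw [hr0, ← Real.rpow_natCast, ← Real.rpow_mul (by positivity)]
    norm_num
    field_simp
  obtain ⟨t, s, ht, hs, h5, h6, h7, h9⟩ := det_step c X Z (X * Z) S r0 (a * β + b) β (p + n * q) q r hq1
    hc1 hX0 hZ1 rfl hS0 hr0p hr01 hr03 hXc hqA k3 k2
  have hlog2 : Real.log 2 ≤ 1 := by linarith [Real.log_two_lt_d9]
  have hlog2p : 0.69 < Real.log 2 := by linarith [Real.log_two_gt_d9]
  refine ⟨t, s, ht, hs, ?_, ?_, ?_⟩
  · refine le_trans ?_ ((h5.trans (le_max_left t s)))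
    have : (2:ℝ) ^ (2 * σ) ≤ X / (c * S) := by
      rw [le_div_iff₀ (by positivity)]
      calc (2:ℝ) ^ (2 * σ) * (c * S) ≤ 2 ^ (2 * σ) * 2 ^ σ := by gcongr
        _ = 2 ^ (2 * σ + σ) := by rw [← pow_add]
        _ ≤ 2 ^ (12 * σ) := pow_le_pow_right₀ (by norm_num) (by omega)
        _ ≤ X := hXb
    have := Real.log_le_log (by positivity) this
    rw [Real.log_pow] at this
    push_cast at this
    have h20 := mul_le_mul_of_nonneg_left hlog2p.le (by linarith : (0:ℝ) ≤ 2 * σ)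
    linarith
  · have hX' : Real.log X ≤ 13 * σ := by
      rw [hX, Real.log_pow]
      have : ((12 * σ + j : ℕ):ℝ) ≤ 13 * σ := by exact_mod_cast (by omega : 12 * σ + j ≤ 13 * σ)
      calc _ ≤ ((12 * σ + j : ℕ):ℝ) * 1 := by gcongr
        _ ≤ _ := by linarith
    have hZ' : Real.log (Z * S) ≤ (48 * (120 * C0 + 121) + 13 : ℕ) * (σ:ℝ) := by
      have h1 : Z * S ≤ 2 ^ (2 * N + 12 * σ + σ) := by
        have : S ≤ 2 ^ σ := (le_mul_of_one_le_left hS0.le hc1).trans hcS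
        have hz : Z ≤ 2 ^ (2 * N + 12 * σ) := by
          rw [hZ]; exact pow_le_pow_right₀ (by norm_num) (by omega)
        rw [pow_add _ _ σ]
        gcongr
      have h2 := Real.log_le_log (by positivity) h1
      rw [Real.log_pow] at h2
      refine h2.trans ?_
      calc _ ≤ ((2 * N + 12 * σ + σ : ℕ):ℝ) * 1 := by gcongr
        _ = _ := by rw [hNv]; push_cast; ring
    have hC0 : (0:ℝ) ≤ C0 := by positivity
    have : 0 ≤ (C0:ℝ) * σ := by positivity
    push_cast at hZ' ⊢
    refine max_le ?_ ?_ <;> first | linarith | nlinarith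
  · refine le_trans (le_of_eq ?_) h9
    rw [one_div, Real.log_inv, hr0, Real.log_rpow (by positivity), Real.log_div hc0.ne' hS0.ne', hS,
      Real.log_pow]
    push_cast; ring

/-- **Logarithm law, lower bound** (from Chow–Yang, Corollary 1.8). -/
theorem log_law_lower_bound (a b : ℝ) (hab : IsDiophantine a b) :
    ∀ᵐ β ∂(volume : Measure ℝ),
      ∀ ε : ℝ, 0 < ε → ∀ T : ℝ, ∃ t s : ℝ, 0 ≤ t ∧ 0 ≤ s ∧ T ≤ max t s ∧
        (2 / 3 - ε) * Real.log (max t s) ≤ latDelta (aM t s * uM (a * β + b) β) := by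
  obtain ⟨C0, δ, hdc⟩ := DC_of_dioph a b hab
  have h1 : ∀ n : ℤ, ∀ᵐ β ∂(volume : Measure ℝ), β - (n:ℝ) ∈ Set.Ioo (0:ℝ) 1 →
      ∃ᶠ σ : ℕ in atTop, β - (n:ℝ) ∈ Eset a (b + a * n) (Nσ C0 σ) σ := by
    intro n
    have h := ae_freq a (b + a * n) C0 _ (DC_shift a b C0 δ hdc n)
    have hm := (measurePreserving_sub_right (volume : Measure ℝ) (n:ℝ)).quasiMeasurePreserving
    exact hm.ae h
  have h2 : ∀ᵐ β ∂(volume : Measure ℝ), β ∉ Set.range (fun n : ℤ => (n:ℝ)) := by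
    exact (Set.countable_range _).ae_notMem _
  filter_upwards [ae_all_iff.mpr h1, h2] with β hβ hβZ ε hε T
  have hfl : β - ⌊β⌋ ∈ Set.Ioo (0:ℝ) 1 := by
    refine ⟨?_, by linarith [Int.lt_floor_add_one β]⟩
    have h := Int.floor_le β
    rcases h.lt_or_eq with h | h
    · linarith
    · exact absurd ⟨⌊β⌋, h⟩ hβZ
  have hf := hβ ⌊β⌋ hfl
  have hcast : Tendsto (fun σ : ℕ => (σ:ℝ)) atTop atTop := tendsto_natCast_atTop_atTop
  set Q : ℕ := 48 * (120 * C0 + 121) + 14 with hQ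
  have ev1 : ∀ᶠ σ : ℕ in atTop, max T (1 + |a|) ≤ σ := hcast.eventually_ge_atTop _
  have ev2 : ∀ᶠ σ : ℕ in atTop, (2 / 3 * Real.log Q + Real.log (1 + |a|) / 3) / ε ≤ Real.log σ :=
    (Real.tendsto_log_atTop.comp hcast).eventually_ge_atTop _
  have ev3 : ∀ᶠ σ : ℕ in atTop, (σ:ℝ) ^ 3 ≤ 2 ^ σ := by
    have h1 := tendsto_pow_const_div_const_pow_of_one_lt 3 (by norm_num : (1:ℝ) < 2)
    filter_upwards [h1.eventually (gt_mem_nhds (by norm_num : (0:ℝ) < 1))] with n hn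
    rw [div_lt_one (by positivity)] at hn
    exact hn.le
  obtain ⟨σ, hσE, e1, e2, e3, e4⟩ :=
    (hf.and_eventually (ev1.and (ev2.and (ev3.and (eventually_ge_atTop 1))))).exists
  obtain ⟨t, s, ht, hs, m1, m2, m3⟩ := E_to_lat a b C0 σ β ⌊β⌋ e4 ((le_max_right _ _).trans e1) e3 hσE
  refine ⟨t, s, ht, hs, ((le_max_left _ _).trans e1).trans m1, le_trans ?_ m3⟩
  have hσr : (1:ℝ) ≤ σ := by exact_mod_cast e4
  have hQp : (0:ℝ) < Q := by rw [hQ]; positivity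
  have l1 : Real.log σ ≤ Real.log (max t s) := Real.log_le_log (by linarith) m1
  have l2 : Real.log (max t s) ≤ Real.log Q + Real.log σ := by
    rw [← Real.log_mul hQp.ne' (by linarith)]
    exact Real.log_le_log (by linarith) m2
  rw [div_le_iff₀ hε] at e2
  have l3 := mul_le_mul_of_nonneg_left l1 hε.le
  clear e3 hQ m2
  clear_value Q
  have l4 : (2 / 3 - ε) * Real.log (max t s) = 2 / 3 * Real.log (max t s) - ε * Real.log (max t s) := by
    ring
  rw [l4]
  linarith

end
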